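/- Let N ≥ 2, 0 < p < N, Ω ⊆ ℝ^N open, and let A(x,D) = Σ_{|α|≤m} a_α(x)∂^α be an elliptic linear differential operator of order m with smooth matrix coefficients on Ω (from ℂ^{n₁}- to ℂ^{n₂}-valued functions, n₂ ≥ n₁), with principal part A_ν(x,D) := Σ_{|α|=m} a_α(x)∂^α. Then for every x₀ ∈ Ω there exist an open ball B = B(x₀,ℓ) ⊂ Ω and a constant C = C(B,p) > 0 such that ‖A_ν(·,D)u‖_{h^p} ≤ C ‖A(·,D)u‖_{h^p} for all u ∈ C_c^∞(B, ℂ^{n₁}). -/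

import Mathlib

open MeasureTheory Set Metric Filter
open scoped ENNReal NNReal Topology

noncomputable section

abbrev RN (N : ℕ) := EuclideanSpace ℝ (Fin N)

variable {N : ℕ}

/-- Partial derivative in the `i`-th coordinate direction. -/
def pd {E : Type*} [NormedAddCommGroup E] [NormedSpace ℝ E] (i : Fin N)
    (f : RN N → E) : RN N → E :=
  fun x => fderiv ℝ f x (EuclideanSpace.single i 1)

/-- Multi-index partial derivative `∂^α`. -/
def md {E : Type*} [NormedAddCommGroup E] [NormedSpace ℝ E] (α : Fin N → ℕ)
    (f : RN N → E) : RN N → E :=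
  ((List.ofFn fun i : Fin N => (pd i)^[α i]).foldr (· ∘ ·) id) f

/-- Order `|α|` of a multi-index. -/
def mOrder (α : Fin N → ℕ) : ℕ := ∑ i, α i

/-- Multi-indices of order at most `k`. -/
def idxLe (N k : ℕ) : Finset (Fin N → ℕ) :=
  (Fintype.piFinset fun _ : Fin N => Finset.range (k + 1)).filter fun α => mOrder α ≤ k

/-- Multi-indices of order exactly `k`. -/
def idxEq (N k : ℕ) : Finset (Fin N → ℕ) :=
  (Fintype.piFinset fun _ : Fin N => Finset.range (k + 1)).filter fun α => mOrder α = k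

/-- The dilate `φ_t(z) = t^{-N} φ(z/t)`. -/
def dil (φ : RN N → ℝ) (t : ℝ) (z : RN N) : ℝ := φ (t⁻¹ • z) / t ^ N

/-- Convolution `(u * φ_t)(x)`. -/
def convAt (φ : RN N → ℝ) (t : ℝ) (u : RN N → ℂ) (x : RN N) : ℂ :=
  ∫ y, dil φ t (x - y) • u y

/-- The small maximal function `sup_{0<t<1} |(u * φ_t)(x)|`. -/
def smallMax (φ : RN N → ℝ) (u : RN N → ℂ) (x : RN N) : ℝ≥0∞ :=
  ⨆ t ∈ Ioo (0 : ℝ) 1, ENNReal.ofReal ‖convAt φ t u x‖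

/-- The localizable Hardy space quasi-norm `‖u‖_{h^p}` (for `0 < p < ∞`). -/
def hNorm (φ : RN N → ℝ) (p : ℝ) (u : RN N → ℂ) : ℝ≥0∞ :=
  (∫⁻ x, smallMax φ u x ^ p) ^ (1 / p)

/-- A fixed radial nonnegative smooth function supported in the unit ball with integral 1. -/
structure GoodPhi (φ : RN N → ℝ) : Prop where
  smooth : ContDiff ℝ (⊤ : ℕ∞) φ
  nonneg : ∀ x, 0 ≤ φ x
  radial : ∀ x y : RN N, ‖x‖ = ‖y‖ → φ x = φ y
  supp : tsupport φ ⊆ closedBall 0 1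
  int_one : ∫ x, φ x = 1

/-- `h^p` quasi-norm of a `ℂ^n`-valued function: sum of the quasi-norms of its components. -/
def hNormVec (φ : RN N → ℝ) (p : ℝ) {n : ℕ} (u : RN N → (Fin n → ℂ)) : ℝ≥0∞ :=
  ∑ j, hNorm φ p fun x => u x j

/-- The operator `A(x,D)φ(x) = Σ_{|α| ≤ m} a_α(x) ∂^α φ(x)`. -/
def applyA {N n₁ n₂ : ℕ} (a : (Fin N → ℕ) → RN N → Matrix (Fin n₂) (Fin n₁) ℂ) (m : ℕ)
    (φ : RN N → (Fin n₁ → ℂ)) : RN N → (Fin n₂ → ℂ) :=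
  fun x => ∑ α ∈ idxLe N m, (a α x).mulVec (md α φ x)

/-- The principal part `A_ν(x,D)φ(x) = Σ_{|α| = m} a_α(x) ∂^α φ(x)`. -/
def applyAP {N n₁ n₂ : ℕ} (a : (Fin N → ℕ) → RN N → Matrix (Fin n₂) (Fin n₁) ℂ) (m : ℕ)
    (φ : RN N → (Fin n₁ → ℂ)) : RN N → (Fin n₂ → ℂ) :=
  fun x => ∑ α ∈ idxEq N m, (a α x).mulVec (md α φ x)

/-- The formal adjoint `A*(x,D)ψ = Σ_{|α| ≤ m} (-1)^{|α|} ∂^α (ā_α^T ψ)`. -/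
def applyAdj {N n₁ n₂ : ℕ} (a : (Fin N → ℕ) → RN N → Matrix (Fin n₂) (Fin n₁) ℂ) (m : ℕ)
    (ψ : RN N → (Fin n₂ → ℂ)) : RN N → (Fin n₁ → ℂ) :=
  fun x => ∑ α ∈ idxLe N m,
    ((-1 : ℂ) ^ mOrder α) • md α (fun y => (a α y).conjTranspose.mulVec (ψ y)) x

/-- Ellipticity: the principal symbol is injective at every point of `Ω`
for every nonzero real frequency `ξ`. -/
def Elliptic {N n₁ n₂ : ℕ} (a : (Fin N → ℕ) → RN N → Matrix (Fin n₂) (Fin n₁) ℂ) (m : ℕ)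
    (Ω : Set (RN N)) : Prop :=
  ∀ x ∈ Ω, ∀ ξ : RN N, ξ ≠ 0 →
    Function.Injective fun w : Fin n₁ → ℂ =>
      (∑ α ∈ idxEq N m, (∏ i, ((ξ i : ℝ) : ℂ) ^ α i) • a α x).mulVec w

/-- The Sobolev norm `‖v‖_{W^{k,q}} = Σ_{|γ| ≤ k} ‖∂^γ v‖_{L^q}`. -/
def sobNorm {N : ℕ} (q : ℝ≥0∞) (k : ℕ) {n : ℕ} (v : RN N → (Fin n → ℂ)) : ℝ≥0∞ :=
  ∑ γ ∈ idxLe N k, eLpNorm (md γ v) q volume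


/-! ### Partial derivatives -/

section PartialDerivatives

variable {f g : RN N → ℂ}

lemma ContDiff.pd {E : Type*} [NormedAddCommGroup E] [NormedSpace ℝ E] {f : RN N → E}
    (hf : ContDiff ℝ (⊤ : ℕ∞) f) (i : Fin N) : ContDiff ℝ (⊤ : ℕ∞) (pd i f) := by
  have h : ContDiff ℝ (⊤ : ℕ∞) (fderiv ℝ f) := hf.fderiv_right (by simp)
  exact h.clm_apply contDiff_const

lemma tsupport_pd_subset {E : Type*} [NormedAddCommGroup E] [NormedSpace ℝ E] (f : RN N → E)
    (i : Fin N) : tsupport (pd i f) ⊆ tsupport f :=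
  tsupport_fderiv_apply_subset ℝ _

lemma HasCompactSupport.pd {E : Type*} [NormedAddCommGroup E] [NormedSpace ℝ E] {f : RN N → E}
    (hf : HasCompactSupport f) (i : Fin N) : HasCompactSupport (pd i f) :=
  hf.mono' ((subset_tsupport _).trans (tsupport_pd_subset f i))

lemma pd_add (hf : ContDiff ℝ (⊤ : ℕ∞) f) (hg : ContDiff ℝ (⊤ : ℕ∞) g) (i : Fin N) :
    pd i (fun y => f y + g y) = fun y => pd i f y + pd i g y := by
  funext y
  simp only [pd]
  rw [fderiv_fun_add (hf.differentiable (by simp) y) (hg.differentiable (by simp) y)]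
  simp

lemma pd_sub (hf : ContDiff ℝ (⊤ : ℕ∞) f) (hg : ContDiff ℝ (⊤ : ℕ∞) g) (i : Fin N) :
    pd i (fun y => f y - g y) = fun y => pd i f y - pd i g y := by
  funext y
  simp only [pd]
  rw [fderiv_fun_sub (hf.differentiable (by simp) y) (hg.differentiable (by simp) y)]
  simp

lemma pd_mul (hf : ContDiff ℝ (⊤ : ℕ∞) f) (hg : ContDiff ℝ (⊤ : ℕ∞) g) (i : Fin N) :
    pd i (fun y => f y * g y) = fun y => pd i f y * g y + f y * pd i g y := by
  funext y
  simp only [pd]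
  rw [fderiv_fun_mul (hf.differentiable (by simp) y) (hg.differentiable (by simp) y)]
  simp [mul_comm, add_comm]

lemma pd_const_mul (hf : ContDiff ℝ (⊤ : ℕ∞) f) (a : ℂ) (i : Fin N) :
    pd i (fun y => a * f y) = fun y => a * pd i f y := by
  rw [pd_mul contDiff_const hf]
  funext y
  simp [pd]

lemma fderiv_apply_eq_sum_pd {E : Type*} [NormedAddCommGroup E] [NormedSpace ℝ E]
    (f : RN N → E) (x v : RN N) : fderiv ℝ f x v = ∑ i, v i • pd i f x := by
  conv_lhs => rw [← (EuclideanSpace.basisFun (Fin N) ℝ).sum_repr v]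
  simp [pd]

lemma norm_fderiv_apply_le {A : ℝ} {x : RN N} (hA : ∀ i, ‖pd i f x‖ ≤ A) (v : RN N) :
    ‖fderiv ℝ f x v‖ ≤ N * A * ‖v‖ := by
  rw [fderiv_apply_eq_sum_pd]
  calc ‖∑ i, v i • pd i f x‖ ≤ ∑ i : Fin N, ‖v‖ * A := by
        refine norm_sum_le_of_le _ fun i _ => ?_
        rw [norm_smul]
        exact mul_le_mul (PiLp.norm_apply_le v i) (hA i) (norm_nonneg _) (norm_nonneg _)
    _ = N * A * ‖v‖ := by simp; ring

lemma norm_fderiv_le_of_pd {A : ℝ} {x : RN N} (hA0 : 0 ≤ A) (hA : ∀ i, ‖pd i f x‖ ≤ A) :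
    ‖fderiv ℝ f x‖ ≤ N * A :=
  ContinuousLinearMap.opNorm_le_bound _ (by positivity) (norm_fderiv_apply_le hA)

/-- A mean value inequality in terms of partial derivatives. -/
lemma norm_sub_le_of_pd (hf : ContDiff ℝ (⊤ : ℕ∞) f) {A : ℝ} (hA0 : 0 ≤ A) {s : Set (RN N)}
    (hs : Convex ℝ s) (hA : ∀ x ∈ s, ∀ i, ‖pd i f x‖ ≤ A) {x y : RN N} (hx : x ∈ s) (hy : y ∈ s) :
    ‖f y - f x‖ ≤ N * A * ‖y - x‖ :=
  hs.norm_image_sub_le_of_norm_fderiv_le (𝕜 := ℝ)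
    (fun z _ => hf.differentiable (by simp) z)
    (fun z hz => norm_fderiv_le_of_pd hA0 (hA z hz)) hx hy

lemma pd_comp_sub (hf : ContDiff ℝ (⊤ : ℕ∞) f) (t : ℝ) (y₀ : RN N) (i : Fin N) :
    pd i (fun y => f (t • (y - y₀))) = fun y => (t : ℂ) * pd i f (t • (y - y₀)) := by
  funext y
  have h : HasFDerivAt (fun y : RN N => t • (y - y₀)) (t • ContinuousLinearMap.id ℝ (RN N)) y :=
    ((hasFDerivAt_id y).sub_const y₀).const_smul t
  have h2 := ((hf.differentiable (by simp) (t • (y - y₀))).hasFDerivAt).comp y h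
  simp only [pd]
  rw [show (fun y => f (t • (y - y₀))) = f ∘ fun y => t • (y - y₀) from rfl, h2.fderiv]
  simp

/-- Iterated partial derivatives along a list of coordinate directions. -/
def pdList {E : Type*} [NormedAddCommGroup E] [NormedSpace ℝ E] : List (Fin N) →
    (RN N → E) → RN N → E
  | [], f => f
  | i :: I, f => pd i (pdList I f)

lemma ContDiff.pdList {E : Type*} [NormedAddCommGroup E] [NormedSpace ℝ E] {f : RN N → E}
    (hf : ContDiff ℝ (⊤ : ℕ∞) f) (I : List (Fin N)) : ContDiff ℝ (⊤ : ℕ∞) (pdList I f) := by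
  induction I with
  | nil => exact hf
  | cons i I ih => exact ih.pd i

lemma tsupport_pdList_subset {E : Type*} [NormedAddCommGroup E] [NormedSpace ℝ E] (f : RN N → E)
    (I : List (Fin N)) : tsupport (pdList I f) ⊆ tsupport f := by
  induction I with
  | nil => exact subset_rfl
  | cons i I ih => exact (tsupport_pd_subset _ i).trans ih

lemma HasCompactSupport.pdList {E : Type*} [NormedAddCommGroup E] [NormedSpace ℝ E] {f : RN N → E}
    (hf : HasCompactSupport f) (I : List (Fin N)) : HasCompactSupport (pdList I f) :=
  hf.mono' ((subset_tsupport _).trans (tsupport_pdList_subset f I))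

lemma pdList_append {E : Type*} [NormedAddCommGroup E] [NormedSpace ℝ E] (I J : List (Fin N))
    (f : RN N → E) : pdList (I ++ J) f = pdList I (pdList J f) := by
  induction I with
  | nil => rfl
  | cons i I ih => simp [pdList, ih]

lemma pdList_replicate {E : Type*} [NormedAddCommGroup E] [NormedSpace ℝ E] (k : ℕ) (i : Fin N)
    (f : RN N → E) : pdList (List.replicate k i) f = (pd i)^[k] f := by
  induction k with
  | zero => rfl
  | succ k ih => rw [List.replicate_succ, Function.iterate_succ_apply', pdList, ih]

/-- The list of directions underlying the multi-index derivative `md α`. -/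
def multiList (α : Fin N → ℕ) : List (Fin N) :=
  (List.ofFn fun i : Fin N => List.replicate (α i) i).flatten

lemma md_eq_pdList {E : Type*} [NormedAddCommGroup E] [NormedSpace ℝ E] (α : Fin N → ℕ)
    (f : RN N → E) : md α f = pdList (multiList α) f := by
  have key : ∀ l : List (Fin N),
      ((l.map fun i => (pd i : (RN N → E) → RN N → E)^[α i]).foldr (· ∘ ·) id) f =
        pdList ((l.map fun i => List.replicate (α i) i).flatten) f := by
    intro l
    induction l with
    | nil => rfl
    | cons i l ih =>
      simp only [List.map_cons, List.foldr_cons, Function.comp_apply, List.flatten_cons,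
        pdList_append, pdList_replicate, ih]
  rw [md, multiList, List.ofFn_eq_map, List.ofFn_eq_map]
  exact key (List.finRange N)

lemma length_multiList (α : Fin N → ℕ) : (multiList α).length = mOrder α := by
  simp [multiList, mOrder, List.length_flatten, List.sum_ofFn, Function.comp_def]

lemma prod_map_multiList {R : Type*} [CommMonoid R] (α : Fin N → ℕ) (c : Fin N → R) :
    ((multiList α).map c).prod = ∏ i, c i ^ α i := by
  rw [← List.prod_ofFn, multiList, List.ofFn_eq_map, List.ofFn_eq_map, List.map_flatten,
    List.prod_flatten]
  simp [Function.comp_def]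

lemma pdList_apply {n : ℕ} {u : RN N → Fin n → ℂ} (hu : ContDiff ℝ (⊤ : ℕ∞) u)
    (I : List (Fin N)) (j : Fin n) :
    (fun x => pdList I u x j) = pdList I (fun x => u x j) := by
  induction I with
  | nil => rfl
  | cons i I ih =>
    simp only [pdList, ← ih]
    funext x
    have h := hasFDerivAt_pi'.1 (((hu.pdList I).differentiable (by simp) x).hasFDerivAt) j
    simp only [pd, h.fderiv]
    rfl

end PartialDerivatives

/-! ### Weighted derivative bounds -/

/-- All partial derivatives of `f` of order `n ≤ k` are bounded by `c r⁻ⁿ w`. -/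
def DerivBound : ℕ → (RN N → ℝ) → ℝ → (RN N → ℂ) → ℝ → Prop
  | 0, w, _, f, c => ∀ y, ‖f y‖ ≤ c * w y
  | k + 1, w, r, f, c => (∀ y, ‖f y‖ ≤ c * w y) ∧ ∀ i, DerivBound k w r (pd i f) (c / r)

namespace DerivBound

variable {k : ℕ} {w w' : RN N → ℝ} {r r' c c' : ℝ} {f g : RN N → ℂ}

lemma norm_le (h : DerivBound k w r f c) (y : RN N) : ‖f y‖ ≤ c * w y := by
  cases k with
  | zero => exact h y
  | succ k => exact h.1 y

lemma of_succ (h : DerivBound (k + 1) w r f c) : DerivBound k w r f c := by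
  induction k generalizing f c with
  | zero => exact h.1
  | succ k ih => exact ⟨h.1, fun i => ih (h.2 i)⟩

lemma of_le {l : ℕ} (hl : l ≤ k) (h : DerivBound k w r f c) : DerivBound l w r f c := by
  induction hl with
  | refl => exact h
  | step _ ih => exact ih h.of_succ

lemma mono (hr : 0 < r) (hww : ∀ y, c * w y ≤ c' * w' y) (h : DerivBound k w r f c) :
    DerivBound k w' r f c' := by
  induction k generalizing f c c' with
  | zero => exact fun y => (h y).trans (hww y)
  | succ k ih =>
    refine ⟨fun y => (h.1 y).trans (hww y), fun i => ih (fun y => ?_) (h.2 i)⟩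
    rw [div_mul_eq_mul_div, div_mul_eq_mul_div]
    exact div_le_div_of_nonneg_right (hww y) hr.le

lemma mono_const (hr : 0 < r) (hw : ∀ y, 0 ≤ w y) (hc : c ≤ c') (h : DerivBound k w r f c) :
    DerivBound k w r f c' :=
  h.mono hr fun y => mul_le_mul_of_nonneg_right hc (hw y)

lemma mono_radius (hr' : 0 < r') (hr : r' ≤ r) (hc : 0 ≤ c) (hw : ∀ y, 0 ≤ w y)
    (h : DerivBound k w r f c) : DerivBound k w r' f c := by
  induction k generalizing f c with
  | zero => exact h
  | succ k ih =>
    refine ⟨h.1, fun i => ?_⟩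
    exact (ih (by have := hr'.trans_le hr; positivity) (h.2 i)).mono_const hr' hw
      (div_le_div_of_nonneg_left hc hr' hr)

lemma add (hf : ContDiff ℝ (⊤ : ℕ∞) f) (hg : ContDiff ℝ (⊤ : ℕ∞) g)
    (h : DerivBound k w r f c) (h' : DerivBound k w r g c') :
    DerivBound k w r (fun y => f y + g y) (c + c') := by
  induction k generalizing f g c c' with
  | zero => exact fun y => (norm_add_le _ _).trans (by linarith [h y, h' y])
  | succ k ih =>
    refine ⟨fun y => (norm_add_le _ _).trans (by linarith [h.1 y, h'.1 y]), fun i => ?_⟩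
    rw [pd_add hf hg, add_div]
    exact ih (hf.pd i) (hg.pd i) (h.2 i) (h'.2 i)

lemma const_mul (hf : ContDiff ℝ (⊤ : ℕ∞) f) (a : ℂ) (h : DerivBound k w r f c) :
    DerivBound k w r (fun y => a * f y) (‖a‖ * c) := by
  induction k generalizing f c with
  | zero =>
    intro y
    rw [norm_mul, mul_assoc]
    exact mul_le_mul_of_nonneg_left (h y) (norm_nonneg _)
  | succ k ih =>
    refine ⟨fun y => ?_, fun i => ?_⟩
    · rw [norm_mul, mul_assoc]
      exact mul_le_mul_of_nonneg_left (h.1 y) (norm_nonneg _)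
    · rw [pd_const_mul hf, mul_div_assoc]
      exact ih (hf.pd i) (h.2 i)

lemma mul (hr : 0 < r) (hf : ContDiff ℝ (⊤ : ℕ∞) f) (hg : ContDiff ℝ (⊤ : ℕ∞) g)
    (hc : 0 ≤ c) (hc' : 0 ≤ c') (hw : ∀ y, 0 ≤ w y) (hw' : ∀ y, 0 ≤ w' y)
    (h : DerivBound k w r f c) (h' : DerivBound k w' r g c') :
    DerivBound k (fun y => w y * w' y) r (fun y => f y * g y) (2 ^ k * (c * c')) := by
  have base : ∀ {f g : RN N → ℂ} {c c' : ℝ}, 0 ≤ c → (∀ y, ‖f y‖ ≤ c * w y) →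
      (∀ y, ‖g y‖ ≤ c' * w' y) → ∀ y, ‖f y * g y‖ ≤ (c * c') * (w y * w' y) := by
    intro f g c c' hc h h' y
    rw [norm_mul]
    calc ‖f y‖ * ‖g y‖ ≤ (c * w y) * (c' * w' y) :=
          mul_le_mul (h y) (h' y) (norm_nonneg _) (mul_nonneg hc (hw y))
      _ = _ := by ring
  induction k generalizing f g c c' with
  | zero => intro y; simpa using base hc h h' y
  | succ k ih =>
    refine ⟨fun y => (base hc h.1 h'.1 y).trans ?_, fun i => ?_⟩
    · exact mul_le_mul_of_nonneg_right (le_mul_of_one_le_left (by positivity)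
        (one_le_pow₀ (by norm_num))) (mul_nonneg (hw y) (hw' y))
    · rw [pd_mul hf hg]
      have h1 := ih (hf.pd i) hg (by positivity) hc' (h.2 i) h'.of_succ
      have h2 := ih hf (hg.pd i) hc (by positivity) h.of_succ (h'.2 i)
      have h3 := h1.add ((hf.pd i).mul hg) (hf.mul (hg.pd i)) h2
      refine h3.mono_const hr (fun y => mul_nonneg (hw y) (hw' y)) (le_of_eq ?_)
      field_simp
      ring

lemma comp_smul_sub (hf : ContDiff ℝ (⊤ : ℕ∞) f) {t : ℝ} (ht : 0 < t) (ε : ℝ) (hε : |ε| = 1)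
    (y₀ : RN N) (h : DerivBound k w 1 f c) :
    DerivBound k (fun y => w ((ε * t⁻¹) • (y - y₀))) t (fun y => f ((ε * t⁻¹) • (y - y₀))) c := by
  induction k generalizing f c with
  | zero => exact fun y => h _
  | succ k ih =>
    refine ⟨fun y => h.1 _, fun i => ?_⟩
    rw [pd_comp_sub hf]
    have hs : ContDiff ℝ (⊤ : ℕ∞) (fun y : RN N => (ε * t⁻¹) • (y - y₀)) :=
      (contDiff_id.sub contDiff_const).const_smul _
    have h1 := (ih (hf.pd i) (h.2 i)).const_mul ((hf.pd i).comp hs) ((ε * t⁻¹ : ℝ) : ℂ)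
    have h2 : ‖((ε * t⁻¹ : ℝ) : ℂ)‖ * (c / 1) = c / t := by
      rw [Complex.norm_real, norm_mul, Real.norm_eq_abs, hε, norm_inv, Real.norm_of_nonneg ht.le]
      field_simp
    rwa [h2] at h1

/-- Smooth compactly supported functions satisfy all derivative bounds. -/
lemma of_hasCompactSupport (hf : ContDiff ℝ (⊤ : ℕ∞) f) (hs : HasCompactSupport f) (k : ℕ) :
    ∃ c, 0 ≤ c ∧ DerivBound k (fun _ => 1) 1 f c := by
  induction k generalizing f with
  | zero =>
    obtain ⟨C, hC⟩ := hf.continuous.bounded_above_of_compact_support hs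
    exact ⟨max C 0, le_max_right _ _, fun y => by simpa using Or.inl (hC y)⟩
  | succ k ih =>
    choose c hc0 hc using fun i => ih (hf.pd i) (hs.pd i)
    obtain ⟨C, hC⟩ := hf.continuous.bounded_above_of_compact_support hs
    refine ⟨max C 0 + ∑ i, c i, add_nonneg (le_max_right _ _) (Finset.sum_nonneg fun i _ => hc0 i),
      fun y => ?_, fun i => ?_⟩
    · have := Finset.sum_nonneg fun i (_ : i ∈ Finset.univ) => hc0 i
      linarith [hC y, le_max_left C 0]
    · refine (hc i).mono_const one_pos (fun _ => zero_le_one) ?_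
      have := Finset.single_le_sum (fun i _ => hc0 i) (Finset.mem_univ i)
      linarith [le_max_right C 0]

end DerivBound

/-! ### Convolution with the dilates of `φ` -/

section Conv

variable {φ : RN N → ℝ} {t : ℝ}

lemma GoodPhi.hasCompactSupport (hφ : GoodPhi φ) : HasCompactSupport φ :=
  HasCompactSupport.of_support_subset_isCompact (isCompact_closedBall 0 1)
    ((subset_tsupport _).trans hφ.supp)

lemma GoodPhi.norm_le_of_dil_ne_zero (hφ : GoodPhi φ) (ht : 0 < t) {z : RN N}
    (hz : dil φ t z ≠ 0) : ‖z‖ ≤ t := by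
  have h1 : φ (t⁻¹ • z) ≠ 0 := fun h => hz (by simp [dil, h])
  have h2 := hφ.supp (subset_tsupport _ h1)
  rw [mem_closedBall_zero_iff, norm_smul, norm_inv, Real.norm_of_nonneg ht.le] at h2
  rwa [inv_mul_le_iff₀ ht, mul_one] at h2

lemma GoodPhi.dil_smooth (hφ : GoodPhi φ) (t : ℝ) : ContDiff ℝ (⊤ : ℕ∞) (dil φ t) :=
  (hφ.smooth.comp (contDiff_id.const_smul t⁻¹)).div_const _

lemma GoodPhi.dil_nonneg (hφ : GoodPhi φ) (ht : 0 < t) (z : RN N) : 0 ≤ dil φ t z :=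
  div_nonneg (hφ.nonneg _) (by positivity)

lemma GoodPhi.dil_hasCompactSupport (hφ : GoodPhi φ) (ht : 0 < t) :
    HasCompactSupport (dil φ t) :=
  HasCompactSupport.of_support_subset_isCompact (isCompact_closedBall 0 t) fun z hz => by
    simpa using hφ.norm_le_of_dil_ne_zero ht hz

lemma GoodPhi.dil_integrable (hφ : GoodPhi φ) (ht : 0 < t) : Integrable (dil φ t) :=
  (hφ.dil_smooth t).continuous.integrable_of_hasCompactSupport (hφ.dil_hasCompactSupport ht)

lemma GoodPhi.integral_dil (hφ : GoodPhi φ) (ht : 0 < t) : ∫ z, dil φ t z = 1 := by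
  have ht' : t ^ N ≠ 0 := by positivity
  simp only [dil, integral_div]
  rw [Measure.integral_comp_smul, hφ.int_one]
  simp [abs_of_pos ht, ht']

lemma GoodPhi.dil_sub_comm (hφ : GoodPhi φ) (t : ℝ) (x y : RN N) :
    dil φ t (x - y) = dil φ t (y - x) := by
  rw [dil, dil, hφ.radial _ (t⁻¹ • (y - x))]
  rw [norm_smul, norm_smul, norm_sub_rev]

lemma convAt_eq (φ : RN N → ℝ) (t : ℝ) (g : RN N → ℂ) (y : RN N) :
    convAt φ t g y = ∫ z, dil φ t z • g (y - z) := by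
  rw [convAt, ← integral_sub_left_eq_self _ _ y]
  simp

lemma convAt_eq_convolution (φ : RN N → ℝ) (t : ℝ) (g : RN N → ℂ) :
    convAt φ t g = convolution (dil φ t) g (ContinuousLinearMap.lsmul ℝ ℝ) volume := by
  funext y
  rw [convAt_eq]
  rfl

variable {g : RN N → ℂ}

lemma GoodPhi.convAt_smooth (hφ : GoodPhi φ) (ht : 0 < t) (hg : ContDiff ℝ (⊤ : ℕ∞) g)
    (hs : HasCompactSupport g) : ContDiff ℝ (⊤ : ℕ∞) (convAt φ t g) := by
  rw [convAt_eq_convolution]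
  exact hs.contDiff_convolution_right _ (hφ.dil_integrable ht).locallyIntegrable hg

lemma GoodPhi.convAt_continuous (hφ : GoodPhi φ) (ht : 0 < t) (hg : Continuous g)
    (hs : HasCompactSupport g) : Continuous (convAt φ t g) := by
  rw [convAt_eq_convolution]
  exact hs.continuous_convolution_right _ (hφ.dil_integrable ht).locallyIntegrable hg

lemma GoodPhi.convAt_hasCompactSupport (hφ : GoodPhi φ) (ht : 0 < t)
    (hs : HasCompactSupport g) : HasCompactSupport (convAt φ t g) := by
  rw [convAt_eq_convolution]
  exact (hφ.dil_hasCompactSupport ht).convolution _ hs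

lemma GoodPhi.pd_convAt (hφ : GoodPhi φ) (ht : 0 < t) (hg : ContDiff ℝ (⊤ : ℕ∞) g)
    (hs : HasCompactSupport g) (i : Fin N) :
    pd i (convAt φ t g) = convAt φ t (pd i g) := by
  funext x
  have h := hs.hasFDerivAt_convolution_right (ContinuousLinearMap.lsmul ℝ ℝ)
    (hφ.dil_integrable ht).locallyIntegrable (hg.of_le (by simp)) x
  rw [convAt_eq_convolution, pd, h.fderiv, convolution_precompR_apply _
    (hφ.dil_integrable ht).locallyIntegrable (hs.fderiv ℝ)
    (hg.continuous_fderiv (by simp)), ← convAt_eq_convolution]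
  rfl

lemma GoodPhi.norm_convAt_le (hφ : GoodPhi φ) (ht : 0 < t) {A : ℝ} {y : RN N}
    (hA : ∀ z, ‖z‖ ≤ t → ‖g (y - z)‖ ≤ A) : ‖convAt φ t g y‖ ≤ A := by
  rw [convAt_eq]
  calc ‖∫ z, dil φ t z • g (y - z)‖ ≤ ∫ z, dil φ t z * A := by
        refine norm_integral_le_of_norm_le ((hφ.dil_integrable ht).mul_const A)
          (Eventually.of_forall fun z => ?_)
        rw [norm_smul, Real.norm_of_nonneg (hφ.dil_nonneg ht z)]
        by_cases hz : dil φ t z = 0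
        · simp [hz]
        · exact mul_le_mul_of_nonneg_left (hA z (hφ.norm_le_of_dil_ne_zero ht hz))
            (hφ.dil_nonneg ht z)
    _ = A := by rw [integral_mul_const, hφ.integral_dil ht, one_mul]

lemma GoodPhi.integrable_dil_smul (hφ : GoodPhi φ) (ht : 0 < t) (hg : Continuous g) :
    Integrable fun z => dil φ t z • g z :=
  ((hφ.dil_smooth t).continuous.smul hg).integrable_of_hasCompactSupport
    (hφ.dil_hasCompactSupport ht).smul_right

lemma GoodPhi.norm_sub_convAt_le (hφ : GoodPhi φ) (ht : 0 < t) (hg : Continuous g) {A : ℝ}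
    {y : RN N} (hA : ∀ z, ‖z‖ ≤ t → ‖g y - g (y - z)‖ ≤ A) : ‖g y - convAt φ t g y‖ ≤ A := by
  have h : g y - convAt φ t g y = convAt φ t (fun x => g y - g x) y := by
    have h2 : Integrable fun z => dil φ t z • g (y - z) :=
      hφ.integrable_dil_smul (g := fun z => g (y - z)) ht (by fun_prop)
    simp only [convAt_eq, smul_sub]
    rw [integral_sub ((hφ.dil_integrable ht).smul_const _) h2,
      integral_smul_const, hφ.integral_dil ht, one_smul]
  rw [h]
  exact hφ.norm_convAt_le ht hA

lemma GoodPhi.integral_convAt_mul (hφ : GoodPhi φ) {v : RN N → ℂ}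
    (hg : Continuous g) (hgs : HasCompactSupport g) (hv : Continuous v)
    (hvs : HasCompactSupport v) :
    ∫ y, convAt φ t g y * v y = ∫ y, g y * convAt φ t v y := by
  simp only [convAt, ← integral_mul_const, ← integral_const_mul]
  rw [integral_integral_swap_of_hasCompactSupport]
  · congr 1
    funext y
    congr 1
    funext z
    rw [hφ.dil_sub_comm]
    simp only [Complex.real_smul]
    ring
  · have := (hφ.dil_smooth t).continuous
    fun_prop
  · refine HasCompactSupport.of_support_subset_isCompact (hvs.isCompact.prod hgs.isCompact) ?_
    rintro ⟨y, z⟩ h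
    simp only [Function.uncurry, Function.mem_support] at h
    exact ⟨subset_tsupport _ fun h0 => h (by simp [h0]),
      subset_tsupport _ fun h0 => h (by simp [h0])⟩

/-- `g - g * φ_t`. -/
def convDefect (φ : RN N → ℝ) (t : ℝ) (g : RN N → ℂ) : RN N → ℂ :=
  fun y => g y - convAt φ t g y

lemma GoodPhi.convDefect_smooth (hφ : GoodPhi φ) (ht : 0 < t) (hg : ContDiff ℝ (⊤ : ℕ∞) g)
    (hs : HasCompactSupport g) : ContDiff ℝ (⊤ : ℕ∞) (convDefect φ t g) :=
  hg.sub (hφ.convAt_smooth ht hg hs)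

lemma GoodPhi.convDefect_hasCompactSupport (hφ : GoodPhi φ) (ht : 0 < t)
    (hs : HasCompactSupport g) : HasCompactSupport (convDefect φ t g) :=
  hs.sub (hφ.convAt_hasCompactSupport ht hs)

lemma GoodPhi.pd_convDefect (hφ : GoodPhi φ) (ht : 0 < t) (hg : ContDiff ℝ (⊤ : ℕ∞) g)
    (hs : HasCompactSupport g) (i : Fin N) :
    pd i (convDefect φ t g) = convDefect φ t (pd i g) := by
  unfold convDefect
  rw [pd_sub hg (hφ.convAt_smooth ht hg hs), hφ.pd_convAt ht hg hs]

variable {k : ℕ} {w : RN N → ℝ} {r c L : ℝ}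

lemma DerivBound.convDefect (hφ : GoodPhi φ) (ht : 0 < t) (htr : t ≤ r)
    (hg : ContDiff ℝ (⊤ : ℕ∞) g) (hs : HasCompactSupport g) (hc : 0 ≤ c)
    (hwL : ∀ y z, ‖z‖ ≤ r → w (y - z) ≤ L * w y)
    (h : DerivBound k w r g c) : DerivBound k w r (convDefect φ t g) ((1 + L) * c) := by
  have base : ∀ {g : RN N → ℂ} {c : ℝ}, 0 ≤ c → (∀ y, ‖g y‖ ≤ c * w y) →
      ∀ y, ‖_root_.convDefect φ t g y‖ ≤ (1 + L) * c * w y := by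
    intro g c hc h y
    have h1 : ‖convAt φ t g y‖ ≤ c * (L * w y) := hφ.norm_convAt_le ht fun z hz =>
      (h _).trans (mul_le_mul_of_nonneg_left (hwL y z (hz.trans htr)) hc)
    have h2 := norm_sub_le (g y) (convAt φ t g y)
    have h3 := h y
    rw [_root_.convDefect]
    linarith
  induction k generalizing g c with
  | zero => exact base hc h
  | succ k ih =>
    refine ⟨base hc h.1, fun i => ?_⟩
    rw [hφ.pd_convDefect ht hg hs, mul_div_assoc]
    exact ih (hg.pd i) (hs.pd i) (by have := ht.trans_le htr; positivity) (h.2 i)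

lemma DerivBound.convDefect_gain (hφ : GoodPhi φ) (ht : 0 < t) (htr : t ≤ r)
    (hg : ContDiff ℝ (⊤ : ℕ∞) g) (hs : HasCompactSupport g) (hc : 0 ≤ c)
    (hw : ∀ y, 0 ≤ w y) (hL : 0 ≤ L)
    (hwL : ∀ y z, ‖z‖ ≤ r → w (y - z) ≤ L * w y)
    (h : DerivBound (k + 1) w r g c) :
    DerivBound k w r (_root_.convDefect φ t g) (N * L * (t / r) * c) := by
  have hr : 0 < r := ht.trans_le htr
  have base : ∀ {g : RN N → ℂ} {c : ℝ}, ContDiff ℝ (⊤ : ℕ∞) g → 0 ≤ c →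
      (∀ i y, ‖pd i g y‖ ≤ c / r * w y) →
      ∀ y, ‖_root_.convDefect φ t g y‖ ≤ N * L * (t / r) * c * w y := by
    intro g c hg hc h y
    refine hφ.norm_sub_convAt_le ht hg.continuous fun z hz => ?_
    have hmem : ∀ x ∈ closedBall y r, ∀ i, ‖pd i g x‖ ≤ c / r * (L * w y) := by
      intro x hx i
      refine (h i x).trans (mul_le_mul_of_nonneg_left ?_ (by positivity))
      have := hwL y (y - x) (by rwa [← dist_eq_norm, dist_comm])
      simpa using this
    have hwy := hw y
    have h1 := norm_sub_le_of_pd hg (by positivity) (convex_closedBall y r) hmem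
      (x := y - z) (y := y) (by simpa using hz.trans htr) (mem_closedBall_self hr.le)
    refine h1.trans ?_
    rw [sub_sub_cancel]
    calc N * (c / r * (L * w y)) * ‖z‖ ≤ N * (c / r * (L * w y)) * t := by gcongr
      _ = _ := by ring
  induction k generalizing g c with
  | zero => exact base hg hc fun i => h.2 i
  | succ k ih =>
    refine ⟨base hg hc fun i => (h.2 i).norm_le, fun i => ?_⟩
    rw [hφ.pd_convDefect ht hg hs, mul_div_assoc]
    exact ih (hg.pd i) (hs.pd i) (by positivity) (h.2 i)

/-- The iterated defects `∏_{i<j} (1 - φ_{r/2^{i+1}} *) g`. -/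
def iterDefect (φ : RN N → ℝ) (r : ℝ) (g : RN N → ℂ) : ℕ → RN N → ℂ
  | 0 => g
  | j + 1 => convDefect φ (r / 2 ^ (j + 1)) (iterDefect φ r g j)

lemma GoodPhi.iterDefect_smooth (hφ : GoodPhi φ) (hr : 0 < r) (hg : ContDiff ℝ (⊤ : ℕ∞) g)
    (hs : HasCompactSupport g) (j : ℕ) : ContDiff ℝ (⊤ : ℕ∞) (iterDefect φ r g j) ∧
      HasCompactSupport (iterDefect φ r g j) := by
  induction j with
  | zero => exact ⟨hg, hs⟩
  | succ j ih => exact ⟨hφ.convDefect_smooth (by positivity) ih.1 ih.2,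
      hφ.convDefect_hasCompactSupport (by positivity) ih.2⟩

/-- Constants in the bounds for the iterated defects. -/
def defectConst (A : ℝ) : ℕ → ℝ
  | 0 => 1
  | q + 1 => (1 + A) * 2 ^ q * defectConst A q

lemma one_le_defectConst {A : ℝ} (hA : 0 ≤ A) (q : ℕ) : 1 ≤ defectConst A q := by
  induction q with
  | zero => exact le_rfl
  | succ q ih =>
    have : (1 : ℝ) ≤ 2 ^ q := one_le_pow₀ (by norm_num)
    exact one_le_mul_of_one_le_of_one_le
      (one_le_mul_of_one_le_of_one_le (by linarith) this) ih

lemma DerivBound.iterDefect (hφ : GoodPhi φ) (hr : 0 < r)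
    (hg : ContDiff ℝ (⊤ : ℕ∞) g) (hs : HasCompactSupport g) (hc : 0 ≤ c)
    (hw : ∀ y, 0 ≤ w y) (hL : 0 ≤ L)
    (hwL : ∀ y z, ‖z‖ ≤ r → w (y - z) ≤ L * w y) (j : ℕ) :
    ∀ q k, DerivBound (q + k) w r g c →
      DerivBound k w r (iterDefect φ r g j)
        (c * defectConst (N * L) q * ((1 + L) / 2 ^ q) ^ j) := by
  have hE : ∀ q, 1 ≤ defectConst (N * L) q := one_le_defectConst (by positivity)
  induction j with
  | zero =>
    intro q k h
    refine (h.of_le (Nat.le_add_left k q)).mono_const hr hw ?_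
    simpa using le_mul_of_one_le_right hc (hE q)
  | succ j ih =>
    intro q k h
    obtain ⟨h1, h2⟩ := hφ.iterDefect_smooth hr hg hs j
    have ht : 0 < r / 2 ^ (j + 1) := by positivity
    have htr : r / 2 ^ (j + 1) ≤ r := div_le_self hr.le (one_le_pow₀ (by norm_num))
    cases q with
    | zero =>
      refine ((ih 0 k h).convDefect hφ ht htr h1 h2 ?_ hwL).mono_const hr hw (le_of_eq ?_)
      · have := hE 0; positivity
      · simp [pow_succ]; ring
    | succ q =>
      have hE' := zero_le_one.trans (hE q)
      have h3 := ih q (k + 1) (by rwa [show q + (k + 1) = q + 1 + k by ring])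
      refine (h3.convDefect_gain hφ ht htr h1 h2 (by positivity) hw hL hwL).mono_const hr hw ?_
      rw [defectConst, div_div_cancel_left' hr.ne']
      have e1 : (N * L * (2 ^ (j + 1))⁻¹ * (c * defectConst (N * L) q * ((1 + L) / 2 ^ q) ^ j) : ℝ)
          = (N * L) * (c * defectConst (N * L) q * (1 + L) ^ j * ((2 ^ q) ^ j * 2 ^ (j + 1))⁻¹) := by
        rw [div_pow]; field_simp
      have e2 : (c * ((1 + N * L) * 2 ^ q * defectConst (N * L) q) *
          ((1 + L) / 2 ^ (q + 1)) ^ (j + 1) : ℝ) = ((1 + N * L) * (1 + L)) *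
          (c * defectConst (N * L) q * (1 + L) ^ j * ((2 ^ q) ^ j * 2 ^ (j + 1))⁻¹) := by
        rw [div_pow, pow_succ (1 + L), pow_succ 2 q, mul_pow, pow_succ (2 ^ q)]; field_simp
      rw [e1, e2]
      have hNL : 0 ≤ N * L := by positivity
      refine mul_le_mul_of_nonneg_right ?_ (by positivity)
      nlinarith

lemma GoodPhi.integral_mul_eq_sum (hφ : GoodPhi φ) (hr : 0 < r) (hg : ContDiff ℝ (⊤ : ℕ∞) g)
    (hs : HasCompactSupport g) {v : RN N → ℂ} (hv : Continuous v) (hvs : HasCompactSupport v)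
    (J : ℕ) :
    ∫ y, g y * v y = (∑ j ∈ Finset.range J,
      ∫ y, iterDefect φ r g j y * convAt φ (r / 2 ^ (j + 1)) v y) +
        ∫ y, iterDefect φ r g J y * v y := by
  induction J with
  | zero => simp [iterDefect]
  | succ J ih =>
    obtain ⟨h1, h2⟩ := hφ.iterDefect_smooth hr hg hs J
    have ht : 0 < r / 2 ^ (J + 1) := by positivity
    rw [ih, Finset.sum_range_succ, add_assoc, ← hφ.integral_convAt_mul h1.continuous h2 hv hvs,
      ← integral_add]
    · congr 2
      funext y
      simp only [iterDefect, convDefect]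
      ring
    · exact ((hφ.convAt_continuous ht h1.continuous h2).mul hv).integrable_of_hasCompactSupport
        hvs.mul_left
    · obtain ⟨h3, h4⟩ := hφ.iterDefect_smooth hr hg hs (J + 1)
      exact (h3.continuous.mul hv).integrable_of_hasCompactSupport hvs.mul_left

end Conv

/-! ### The Hardy–Littlewood maximal function -/

section HardyLittlewood

/-- The uncentered Hardy–Littlewood maximal function, normalised by powers of the radius. -/
def hlMax (h : RN N → ℝ≥0∞) (x : RN N) : ℝ≥0∞ :=
  ⨆ (c : RN N) (R : ℝ) (_ : 0 < R),
    (ball c R).indicator (fun _ => (ENNReal.ofReal (R ^ N))⁻¹ * ∫⁻ z in ball c R, h z) x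

variable {h : RN N → ℝ≥0∞}

lemma measurable_hlMax : Measurable (hlMax h) := by
  refine LowerSemicontinuous.measurable ?_
  unfold hlMax
  exact lowerSemicontinuous_iSup fun c => lowerSemicontinuous_iSup fun R =>
    lowerSemicontinuous_iSup fun _ => isOpen_ball.lowerSemicontinuous_indicator zero_le

lemma setLIntegral_ball_le_hlMax {x c : RN N} {R : ℝ} (hR : 0 < R) (hx : x ∈ ball c R) :
    ∫⁻ z in ball c R, h z ≤ ENNReal.ofReal (R ^ N) * hlMax h x := by
  have hR' : ENNReal.ofReal (R ^ N) ≠ 0 := by simpa using by positivity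
  have h1 : (ENNReal.ofReal (R ^ N))⁻¹ * ∫⁻ z in ball c R, h z ≤ hlMax h x := by
    refine le_trans (le_of_eq ?_) (le_iSup_of_le c (le_iSup_of_le R (le_iSup_of_le hR le_rfl)))
    rw [indicator_of_mem hx]
  calc ∫⁻ z in ball c R, h z
      = ENNReal.ofReal (R ^ N) * ((ENNReal.ofReal (R ^ N))⁻¹ * ∫⁻ z in ball c R, h z) := by
        rw [← mul_assoc, ENNReal.mul_inv_cancel hR' ENNReal.ofReal_ne_top, one_mul]
    _ ≤ _ := by gcongr

lemma hlMax_le {x : RN N} {A : ℝ≥0∞}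
    (hA : ∀ c R, 0 < R → x ∈ ball c R → ∫⁻ z in ball c R, h z ≤ ENNReal.ofReal (R ^ N) * A) :
    hlMax h x ≤ A := by
  refine iSup_le fun c => iSup_le fun R => iSup_le fun hR => ?_
  by_cases hx : x ∈ ball c R
  · rw [indicator_of_mem hx, mul_comm, ← div_eq_mul_inv]
    exact ENNReal.div_le_of_le_mul (by rw [mul_comm]; exact hA c R hR hx)
  · simp [indicator_of_notMem hx]

/-- The volume of the unit ball. -/
def unitVol (N : ℕ) : ℝ≥0∞ := volume (ball (0 : RN N) 1)

lemma unitVol_ne_top : unitVol N ≠ ⊤ := measure_ball_lt_top.ne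

lemma unitVol_ne_zero : unitVol N ≠ 0 := (measure_ball_pos _ _ one_pos).ne'

lemma volume_closedBall_eq (x : RN N) {r : ℝ} (hr : 0 ≤ r) :
    volume (closedBall x r) = ENNReal.ofReal (r ^ N) * unitVol N := by
  rw [Measure.addHaar_closedBall _ _ hr]
  simp [unitVol]

lemma hlMax_const_le (A : ℝ≥0∞) (x : RN N) : hlMax (fun _ => A) x ≤ unitVol N * A := by
  refine hlMax_le fun c R hR _ => ?_
  rw [setLIntegral_const, mul_comm A, ← mul_assoc]
  gcongr
  exact (measure_mono ball_subset_closedBall).trans (volume_closedBall_eq c hR.le).le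

lemma hlMax_mono {h' : RN N → ℝ≥0∞} (hh : ∀ z, h z ≤ h' z) (x : RN N) :
    hlMax h x ≤ hlMax h' x :=
  hlMax_le fun _ _ hR hx => (lintegral_mono hh).trans (setLIntegral_ball_le_hlMax hR hx)

lemma hlMax_add_le {h' : RN N → ℝ≥0∞} (hm : Measurable h) (x : RN N) :
    hlMax (fun z => h z + h' z) x ≤ hlMax h x + hlMax h' x := by
  refine hlMax_le fun c R hR hx => ?_
  rw [lintegral_add_left hm, mul_add]
  exact add_le_add (setLIntegral_ball_le_hlMax hR hx) (setLIntegral_ball_le_hlMax hR hx)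

/-- The weak type `(1,1)` estimate for the maximal function. -/
lemma hlMax_weak_type (hN : N ≠ 0) {l : ℝ≥0∞} (hl0 : l ≠ 0) (hl : l ≠ ⊤) :
    l * volume {x | l < hlMax h x} ≤ ENNReal.ofReal (4 ^ N) * unitVol N * ∫⁻ z, h z := by
  by_cases hI : ∫⁻ z, h z = ⊤
  · rw [hI, ENNReal.mul_top]
    · exact le_top
    · exact mul_ne_zero (by simp) unitVol_ne_zero
  have hex : ∀ x : {x | l < hlMax h x}, ∃ c : RN N, ∃ R : ℝ, 0 < R ∧ (x : RN N) ∈ ball c R ∧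
      l * ENNReal.ofReal (R ^ N) ≤ ∫⁻ z in ball c R, h z := by
    rintro ⟨x, hx⟩
    by_contra! hcon
    refine absurd (show hlMax h x ≤ l from hlMax_le fun c R hR hxc => ?_) (not_le.2 hx)
    rw [mul_comm]
    exact (hcon c R hR hxc).le
  choose c R hR hc hcR using hex
  have hRb : ∀ x, R x ≤ max 1 ((∫⁻ z, h z) / l).toReal := by
    intro x
    by_contra! hcon
    obtain ⟨h1, h2⟩ := max_lt_iff.1 hcon
    have h3 : R x ≤ R x ^ N := le_self_pow₀ h1.le hN
    have h4 : l * ENNReal.ofReal (R x ^ N) ≤ ∫⁻ z, h z :=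
      (hcR x).trans (setLIntegral_le_lintegral _ _)
    have h5 : ENNReal.ofReal (R x ^ N) ≤ (∫⁻ z, h z) / l := by
      rw [ENNReal.le_div_iff_mul_le (Or.inl hl0) (Or.inl hl), mul_comm]; exact h4
    have h6 := (ENNReal.ofReal_le_iff_le_toReal (ENNReal.div_ne_top hI hl0)).1 h5
    linarith
  obtain ⟨u, -, hdis, hcov⟩ := Vitali.exists_disjoint_subfamily_covering_enlargement_closedBall
    univ c R _ (fun x _ => hRb x) 4 (by norm_num)
  have hcount : u.Countable := hdis.countable_of_nonempty_interior fun x _ =>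
    ⟨c x, ball_subset_interior_closedBall (mem_ball_self (hR x))⟩
  have hsub : {x | l < hlMax h x} ⊆ ⋃ b ∈ u, closedBall (c b) (4 * R b) := by
    intro x hx
    obtain ⟨b, hb, hb'⟩ := hcov ⟨x, hx⟩ (mem_univ _)
    exact mem_biUnion hb (hb' (ball_subset_closedBall (hc ⟨x, hx⟩)))
  calc l * volume {x | l < hlMax h x}
      ≤ l * ∑' b : u, volume (closedBall (c b) (4 * R b)) := by
        gcongr
        exact (measure_mono hsub).trans (measure_biUnion_le _ hcount _)
    _ = ∑' b : u, ENNReal.ofReal (4 ^ N) * unitVol N * (l * ENNReal.ofReal (R b ^ N)) := by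
        rw [← ENNReal.tsum_mul_left]
        congr 1
        funext b
        rw [volume_closedBall_eq _ (by have := hR b; positivity), mul_pow,
          ENNReal.ofReal_mul (by positivity)]
        ring
    _ ≤ ∑' b : u, ENNReal.ofReal (4 ^ N) * unitVol N * ∫⁻ z in closedBall (c b) (R b), h z := by
        refine ENNReal.tsum_le_tsum fun b => ?_
        gcongr
        exact (hcR b).trans (lintegral_mono_set ball_subset_closedBall)
    _ = ENNReal.ofReal (4 ^ N) * unitVol N * ∫⁻ z in ⋃ b ∈ u, closedBall (c b) (R b), h z := by
        rw [ENNReal.tsum_mul_left, lintegral_biUnion hcount (fun _ _ => measurableSet_closedBall)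
          hdis]
    _ ≤ _ := mul_le_mul_right (setLIntegral_le_lintegral _ _) _

/-- The constant of the strong type estimate. -/
def hlConst (N : ℕ) (q : ℝ) : ℝ≥0∞ :=
  ENNReal.ofReal q * (2 * (ENNReal.ofReal (4 ^ N) * unitVol N) *
    ENNReal.ofReal ((2 * (unitVol N).toReal) ^ (q - 1) / (q - 1)))

lemma hlConst_ne_top {q : ℝ} : hlConst N q ≠ ⊤ := by
  unfold hlConst
  have := unitVol_ne_top (N := N)
  finiteness

lemma hlMax_lt_volume_le (hN : N ≠ 0) (hm : Measurable h) {l : ℝ} (hl : 0 < l) :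
    volume {x | ENNReal.ofReal l < hlMax h x} ≤ ENNReal.ofReal l⁻¹ *
      (2 * (ENNReal.ofReal (4 ^ N) * unitVol N) *
        ∫⁻ z, {z | ENNReal.ofReal l < 2 * unitVol N * h z}.indicator h z) := by
  set s := {z | ENNReal.ofReal l < 2 * unitVol N * h z} with hs
  have hsm : MeasurableSet s := measurableSet_lt measurable_const (hm.const_mul _)
  have hl2 : ENNReal.ofReal (l / 2) ≠ 0 := by simpa using by positivity
  have hsub : {x | ENNReal.ofReal l < hlMax h x} ⊆
      {x | ENNReal.ofReal (l / 2) < hlMax (s.indicator h) x} := by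
    intro x hx
    by_contra hcon
    simp only [mem_ofPred_eq, not_lt] at hx hcon
    have h1 : hlMax h x ≤ hlMax (s.indicator h) x + hlMax
        (fun _ => ENNReal.ofReal (l / 2) * (unitVol N)⁻¹) x := by
      refine (hlMax_mono (fun z => ?_) x).trans (hlMax_add_le (hm.indicator hsm) x)
      by_cases hz : z ∈ s
      · rw [indicator_of_mem hz]; exact le_self_add
      · rw [indicator_of_notMem hz, zero_add, ← div_eq_mul_inv,
          ENNReal.le_div_iff_mul_le (Or.inl unitVol_ne_zero) (Or.inl unitVol_ne_top)]
        simp only [hs, mem_ofPred_eq, not_lt] at hz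
        rw [ENNReal.ofReal_div_of_pos two_pos, ENNReal.le_div_iff_mul_le (by simp) (by simp)]
        refine le_trans (le_of_eq ?_) hz
        simp
        ring
    have h2 := hlMax_const_le (N := N) (ENNReal.ofReal (l / 2) * (unitVol N)⁻¹) x
    rw [mul_left_comm, ENNReal.mul_inv_cancel unitVol_ne_zero unitVol_ne_top, mul_one] at h2
    have h3 : hlMax h x ≤ ENNReal.ofReal l := by
      calc hlMax h x ≤ ENNReal.ofReal (l / 2) + ENNReal.ofReal (l / 2) :=
            h1.trans (add_le_add hcon h2)
        _ = ENNReal.ofReal l := by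
            rw [← ENNReal.ofReal_add (by positivity) (by positivity), add_halves]
    exact absurd hx (not_lt.2 h3)
  have h4 := hlMax_weak_type (h := s.indicator h) hN hl2 ENNReal.ofReal_ne_top
  have h5 : ENNReal.ofReal l⁻¹ * 2 * ENNReal.ofReal (l / 2) = 1 := by
    rw [show (2 : ℝ≥0∞) = ENNReal.ofReal 2 by simp, ← ENNReal.ofReal_mul (by positivity),
      ← ENNReal.ofReal_mul (by positivity)]
    rw [show l⁻¹ * 2 * (l / 2) = 1 by field_simp, ENNReal.ofReal_one]
  calc volume {x | ENNReal.ofReal l < hlMax h x}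
      ≤ volume {x | ENNReal.ofReal (l / 2) < hlMax (s.indicator h) x} := measure_mono hsub
    _ = ENNReal.ofReal l⁻¹ * 2 * (ENNReal.ofReal (l / 2) *
        volume {x | ENNReal.ofReal (l / 2) < hlMax (s.indicator h) x}) := by
        rw [← mul_assoc, h5, one_mul]
    _ ≤ ENNReal.ofReal l⁻¹ * 2 * (ENNReal.ofReal (4 ^ N) * unitVol N *
        ∫⁻ z, s.indicator h z) := by gcongr
    _ = _ := by ring

/-- The strong type `(q,q)` estimate for the maximal function of a bounded function. -/
lemma lintegral_hlMax_rpow_le (hN : N ≠ 0) (hm : Measurable h) {B : ℝ≥0∞} (hB : B ≠ ⊤)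
    (hhB : ∀ z, h z ≤ B) {q : ℝ} (hq : 1 < q) :
    ∫⁻ x, hlMax h x ^ q ≤ hlConst N q * ∫⁻ z, h z ^ q := by
  have hfin : ∀ x, hlMax h x ≠ ⊤ := fun x => ne_top_of_le_ne_top
    (ENNReal.mul_ne_top unitVol_ne_top hB) ((hlMax_mono hhB x).trans (hlMax_const_le B x))
  have hhfin : ∀ z, h z ≠ ⊤ := fun z => ne_top_of_le_ne_top hB (hhB z)
  have e1 : ∫⁻ x, hlMax h x ^ q = ∫⁻ x, ENNReal.ofReal ((hlMax h x).toReal ^ q) := by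
    refine lintegral_congr fun x => ?_
    rw [← ENNReal.ofReal_rpow_of_nonneg ENNReal.toReal_nonneg (by linarith),
      ENNReal.ofReal_toReal (hfin x)]
  rw [e1, lintegral_rpow_eq_lintegral_meas_lt_mul volume (Eventually.of_forall fun x =>
    ENNReal.toReal_nonneg) measurable_hlMax.ennreal_toReal.aemeasurable (by linarith)]
  set K : ℝ≥0∞ := 2 * (ENNReal.ofReal (4 ^ N) * unitVol N) with hK
  have e2 : ∀ l ∈ Ioi (0 : ℝ), volume {x | l < (hlMax h x).toReal} * ENNReal.ofReal (l ^ (q - 1))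
      ≤ K * ∫⁻ z, {z | ENNReal.ofReal l < 2 * unitVol N * h z}.indicator
        (fun z => ENNReal.ofReal (l ^ (q - 2)) * h z) z := by
    intro l hl
    have hl0 : 0 < l := hl
    have h1 : {x | l < (hlMax h x).toReal} = {x | ENNReal.ofReal l < hlMax h x} := by
      ext x
      exact (ENNReal.ofReal_lt_iff_lt_toReal hl0.le (hfin x)).symm
    rw [h1]
    have h2 := hlMax_lt_volume_le hN hm hl0
    have h3 : ENNReal.ofReal l⁻¹ * ENNReal.ofReal (l ^ (q - 1)) = ENNReal.ofReal (l ^ (q - 2)) := by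
      rw [← ENNReal.ofReal_mul (by positivity), ← Real.rpow_neg_one, ← Real.rpow_add hl0]
      congr 2; ring
    have hsm : MeasurableSet {z | ENNReal.ofReal l < 2 * unitVol N * h z} :=
      measurableSet_lt measurable_const (hm.const_mul _)
    calc _ ≤ ENNReal.ofReal l⁻¹ * (K *
        ∫⁻ z, {z | ENNReal.ofReal l < 2 * unitVol N * h z}.indicator h z) *
          ENNReal.ofReal (l ^ (q - 1)) := by gcongr
      _ = K * (ENNReal.ofReal (l ^ (q - 2)) *
        ∫⁻ z, {z | ENNReal.ofReal l < 2 * unitVol N * h z}.indicator h z) := by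
        rw [← h3]; ring
      _ = _ := by
        rw [← lintegral_const_mul _ (hm.indicator hsm)]
        congr 2
        funext z
        simp only [indicator]
        split_ifs <;> simp
  have hjm : Measurable fun y : ℝ × RN N =>
      {z | ENNReal.ofReal y.1 < 2 * unitVol N * h z}.indicator
        (fun z => ENNReal.ofReal (y.1 ^ (q - 2)) * h z) y.2 := by
    have : (fun y : ℝ × RN N => {z | ENNReal.ofReal y.1 < 2 * unitVol N * h z}.indicator
        (fun z => ENNReal.ofReal (y.1 ^ (q - 2)) * h z) y.2) =
        {y : ℝ × RN N | ENNReal.ofReal y.1 < 2 * unitVol N * h y.2}.indicator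
        (fun y => ENNReal.ofReal (y.1 ^ (q - 2)) * h y.2) := by
      funext y
      simp [indicator]
    rw [this]
    refine Measurable.indicator ?_ (measurableSet_lt ?_ ?_)
    · fun_prop
    · fun_prop
    · fun_prop
  have e3 : ∀ z, ∫⁻ l in Ioi (0 : ℝ), {z | ENNReal.ofReal l < 2 * unitVol N * h z}.indicator
        (fun z => ENNReal.ofReal (l ^ (q - 2)) * h z) z ≤
        ENNReal.ofReal ((2 * (unitVol N).toReal) ^ (q - 1) / (q - 1)) * h z ^ q := by
    intro z
    set T : ℝ := 2 * (unitVol N).toReal * (h z).toReal with hT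
    have hT0 : 0 ≤ T := by positivity
    have hTe : 2 * unitVol N * h z = ENNReal.ofReal T := by
      rw [hT, ENNReal.ofReal_mul (by positivity), ENNReal.ofReal_mul (by positivity),
        ENNReal.ofReal_toReal unitVol_ne_top, ENNReal.ofReal_toReal (hhfin z)]
      simp
    have hint : IntervalIntegrable (fun l : ℝ => l ^ (q - 2)) volume 0 T :=
      intervalIntegral.intervalIntegrable_rpow' (by linarith)
    have h1 : ∫⁻ l in Ioc 0 T, ENNReal.ofReal (l ^ (q - 2)) =
        ENNReal.ofReal (T ^ (q - 1) / (q - 1)) := by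
      rw [← ofReal_integral_eq_lintegral_ofReal]
      · rw [← intervalIntegral.integral_of_le hT0, integral_rpow (Or.inl (by linarith)),
          Real.zero_rpow (by linarith)]
        congr 1
        rw [show q - 2 + 1 = q - 1 by ring, sub_zero]
      · exact (intervalIntegrable_iff_integrableOn_Ioc_of_le hT0).1 hint
      · exact (ae_restrict_iff' measurableSet_Ioc).2 (Eventually.of_forall fun l hl =>
          Real.rpow_nonneg hl.1.le _)
    calc _ ≤ ∫⁻ l in Ioi (0 : ℝ), (Ioc 0 T).indicator
          (fun l => ENNReal.ofReal (l ^ (q - 2)) * h z) l := by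
          refine setLIntegral_mono' measurableSet_Ioi fun l hl => ?_
          by_cases hlT : z ∈ {z | ENNReal.ofReal l < 2 * unitVol N * h z}
          · rw [indicator_of_mem hlT, indicator_of_mem]
            rw [mem_ofPred_eq, hTe, ENNReal.ofReal_lt_ofReal_iff_of_nonneg (le_of_lt hl)] at hlT
            exact ⟨hl, hlT.le⟩
          · rw [indicator_of_notMem hlT]
            exact zero_le
      _ ≤ ∫⁻ l, (Ioc 0 T).indicator (fun l => ENNReal.ofReal (l ^ (q - 2)) * h z) l :=
          setLIntegral_le_lintegral _ _
      _ = ENNReal.ofReal (T ^ (q - 1) / (q - 1)) * h z := by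
          rw [lintegral_indicator measurableSet_Ioc, lintegral_mul_const _ (by fun_prop), h1]
      _ = _ := by
          have h2 : h z ^ q = h z ^ (q - 1) * h z := by
            rw [← ENNReal.rpow_one (h z), ← ENNReal.rpow_mul, ← ENNReal.rpow_mul,
              ← ENNReal.rpow_add_of_nonneg] <;> first | linarith | skip
            congr 1; ring
          rw [h2, hT, Real.mul_rpow (by positivity) (by positivity), mul_div_right_comm,
            ENNReal.ofReal_mul (by have : 0 < q - 1 := by linarith
                                   positivity),
            ← ENNReal.ofReal_rpow_of_nonneg (by positivity) (by linarith : 0 ≤ q - 1),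
            ENNReal.ofReal_toReal (hhfin z), mul_assoc]
  calc _ ≤ ENNReal.ofReal q * ∫⁻ l in Ioi (0 : ℝ), K *
        ∫⁻ z, {z | ENNReal.ofReal l < 2 * unitVol N * h z}.indicator
        (fun z => ENNReal.ofReal (l ^ (q - 2)) * h z) z := by
        exact mul_le_mul_right (setLIntegral_mono' measurableSet_Ioi e2) _
    _ = ENNReal.ofReal q * (K * ∫⁻ z, ∫⁻ l in Ioi (0 : ℝ),
        {z | ENNReal.ofReal l < 2 * unitVol N * h z}.indicator
        (fun z => ENNReal.ofReal (l ^ (q - 2)) * h z) z) := by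
        rw [lintegral_const_mul' _ _ (by have := unitVol_ne_top (N := N); rw [hK]; finiteness),
          lintegral_lintegral_swap hjm.aemeasurable]
    _ ≤ ENNReal.ofReal q * (K * ∫⁻ z,
        ENNReal.ofReal ((2 * (unitVol N).toReal) ^ (q - 1) / (q - 1)) * h z ^ q) := by
        gcongr with z
        exact e3 z
    _ = _ := by
        rw [lintegral_const_mul' _ _ ENNReal.ofReal_ne_top, hlConst]
        ring

/-- The weight `r^{-N} (1 + ‖z - y₀‖ / r)^{-M}`. -/
def wt (M : ℕ) (r : ℝ) (y₀ z : RN N) : ℝ := ((1 + ‖z - y₀‖ / r) ^ M)⁻¹ / r ^ N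

lemma wt_pos {M : ℕ} {r : ℝ} (hr : 0 < r) (y₀ z : RN N) : 0 < wt M r y₀ z := by
  unfold wt; positivity

lemma continuous_wt {M : ℕ} {r : ℝ} (hr : 0 < r) (y₀ : RN N) : Continuous (wt M r y₀) := by
  unfold wt
  refine (Continuous.inv₀ (by fun_prop) fun z => ?_).div_const _
  positivity

/-- Integration against the weight is controlled by the maximal function. -/
lemma lintegral_wt_mul_le (hm : Measurable h) {r : ℝ} (hr : 0 < r) (x y₀ : RN N) :
    ∫⁻ z, ENNReal.ofReal (wt (N + 1) r y₀ z) * h z ≤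
      ENNReal.ofReal (2 ^ (N + 2) * (1 + ‖x - y₀‖ / r) ^ N) * hlMax h x := by
  set d : ℝ := 1 + ‖x - y₀‖ / r with hd
  have hd1 : 1 ≤ d := by rw [hd]; linarith [show 0 ≤ ‖x - y₀‖ / r by positivity]
  have hpt : ∀ z, ENNReal.ofReal (wt (N + 1) r y₀ z) * h z ≤ ∑' k : ℕ,
      ENNReal.ofReal (((2 ^ k) ^ (N + 1))⁻¹ / r ^ N) *
        (ball y₀ (2 ^ (k + 1) * r)).indicator h z := by
    intro z
    obtain ⟨k, hk1, hk2⟩ := exists_nat_pow_near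
      (show (1 : ℝ) ≤ 1 + ‖z - y₀‖ / r by linarith [show 0 ≤ ‖z - y₀‖ / r by positivity])
      one_lt_two
    refine le_trans ?_ (ENNReal.le_tsum k)
    rw [indicator_of_mem]
    · unfold wt
      gcongr
    · rw [mem_ball, dist_eq_norm]
      have : ‖z - y₀‖ / r < 2 ^ (k + 1) := by linarith
      rwa [div_lt_iff₀ hr] at this
  calc _ ≤ ∫⁻ z, ∑' k : ℕ, ENNReal.ofReal (((2 ^ k) ^ (N + 1))⁻¹ / r ^ N) *
        (ball y₀ (2 ^ (k + 1) * r)).indicator h z := lintegral_mono hpt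
    _ = ∑' k : ℕ, ENNReal.ofReal (((2 ^ k) ^ (N + 1))⁻¹ / r ^ N) *
        ∫⁻ z in ball y₀ (2 ^ (k + 1) * r), h z := by
        rw [lintegral_tsum fun k => ((hm.indicator measurableSet_ball).const_mul _).aemeasurable]
        congr 1
        funext k
        rw [lintegral_const_mul _ (hm.indicator measurableSet_ball),
          lintegral_indicator measurableSet_ball]
    _ ≤ ∑' k : ℕ, ENNReal.ofReal (((2 ^ k) ^ (N + 1))⁻¹ / r ^ N) *
        (ENNReal.ofReal ((2 ^ (k + 1) * r * d) ^ N) * hlMax h x) := by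
        refine ENNReal.tsum_le_tsum fun k => ?_
        gcongr
        refine le_trans (lintegral_mono_set (ball_subset_ball ?_))
          (setLIntegral_ball_le_hlMax (c := y₀) (by positivity) ?_)
        · exact le_mul_of_one_le_right (by positivity) hd1
        · rw [mem_ball, dist_eq_norm]
          have h1 : ‖x - y₀‖ = r * (‖x - y₀‖ / r) := by field_simp
          have h2 : (1 : ℝ) ≤ 2 ^ (k + 1) := one_le_pow₀ (by norm_num)
          calc ‖x - y₀‖ = r * (‖x - y₀‖ / r) := h1
            _ < r * d := by gcongr; linarith
            _ ≤ _ := by nlinarith [show 0 < r * d by positivity]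
    _ = ∑' k : ℕ, ENNReal.ofReal (2 ^ N * d ^ N) * hlMax h x * (2⁻¹) ^ k := by
        congr 1
        funext k
        rw [← mul_assoc, ← ENNReal.ofReal_mul (by positivity), show (2⁻¹ : ℝ≥0∞) ^ k =
          ENNReal.ofReal ((2 ^ k)⁻¹) by
            rw [ENNReal.ofReal_inv_of_pos (by positivity), ENNReal.ofReal_pow (by positivity)]
            simp [ENNReal.inv_pow], mul_right_comm _ (hlMax h x),
          ← ENNReal.ofReal_mul (by positivity)]
        congr 2
        rw [mul_pow, mul_pow]
        field_simp
        ring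
    _ = ENNReal.ofReal (2 ^ N * d ^ N) * hlMax h x * 2 := by
        rw [ENNReal.tsum_mul_left, ENNReal.tsum_geometric]
        simp
    _ ≤ _ := by
        rw [mul_right_comm]
        gcongr
        rw [show (2 : ℝ≥0∞) = ENNReal.ofReal 2 by simp, ← ENNReal.ofReal_mul (by positivity)]
        apply ENNReal.ofReal_le_ofReal
        have : 0 ≤ (2 : ℝ) ^ N * d ^ N := by positivity
        rw [pow_add]
        nlinarith

lemma lintegral_wt_le {r : ℝ} (hr : 0 < r) (y₀ : RN N) :
    ∫⁻ z, ENNReal.ofReal (wt (N + 1) r y₀ z) ≤ ENNReal.ofReal (2 ^ (N + 2)) * unitVol N := by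
  have h1 := lintegral_wt_mul_le (h := fun _ => 1) measurable_const hr y₀ y₀
  simp only [mul_one, sub_self, norm_zero, zero_div, add_zero, one_pow] at h1
  refine h1.trans ?_
  gcongr
  simpa using hlMax_const_le (N := N) 1 y₀

end HardyLittlewood

/-! ### The fundamental estimate for test functions -/

section Core

variable {φ : RN N → ℝ} {k M : ℕ} {r c : ℝ} {y₀ : RN N} {f ψ v : RN N → ℂ}

lemma DerivBound.mono_on {w w' : RN N → ℝ} {c' : ℝ} (hr : 0 < r)
    (hw' : ∀ y, 0 ≤ c' * w' y) (hww : ∀ y ∈ tsupport f, c * w y ≤ c' * w' y)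
    (h : DerivBound k w r f c) : DerivBound k w' r f c' := by
  have base : ∀ {f : RN N → ℂ} {c c' : ℝ}, (∀ y, 0 ≤ c' * w' y) →
      (∀ y ∈ tsupport f, c * w y ≤ c' * w' y) → (∀ y, ‖f y‖ ≤ c * w y) →
      ∀ y, ‖f y‖ ≤ c' * w' y := by
    intro f c c' hw' hww h y
    by_cases hy : y ∈ tsupport f
    · exact (h y).trans (hww y hy)
    · rw [image_eq_zero_of_notMem_tsupport hy, norm_zero]
      exact hw' y
  induction k generalizing f c c' with
  | zero => exact base hw' hww h
  | succ k ih =>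
    refine ⟨base hw' hww h.1, fun i => ih (fun y => ?_) (fun y hy => ?_) (h.2 i)⟩
    · rw [div_mul_eq_mul_div]
      exact div_nonneg (hw' y) hr.le
    · rw [div_mul_eq_mul_div, div_mul_eq_mul_div]
      exact div_le_div_of_nonneg_right (hww y (tsupport_pd_subset f i hy)) hr.le

lemma wt_sub_le (hr : 0 < r) (y₀ y z : RN N) (hz : ‖z‖ ≤ r) :
    wt M r y₀ (y - z) ≤ 2 ^ M * wt M r y₀ y := by
  have h1 : 1 + ‖y - y₀‖ / r ≤ 2 * (1 + ‖y - z - y₀‖ / r) := by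
    have h2 : ‖y - y₀‖ ≤ ‖y - z - y₀‖ + ‖z‖ := by
      have := norm_add_le (y - z - y₀) z
      rwa [show y - z - y₀ + z = y - y₀ by abel] at this
    have h3 : ‖y - y₀‖ / r ≤ ‖y - z - y₀‖ / r + 1 := by
      rw [div_add_one hr.ne']
      exact div_le_div_of_nonneg_right (h2.trans (by linarith)) hr.le
    have : 0 ≤ ‖y - z - y₀‖ / r := by positivity
    linarith
  unfold wt
  rw [mul_div_assoc']
  refine div_le_div_of_nonneg_right ?_ (by positivity)
  rw [inv_le_comm₀ (by positivity) (by positivity), mul_inv, inv_inv, inv_mul_le_iff₀ (by positivity),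
    ← mul_pow]
  gcongr

lemma wt_add_mul (hr : 0 < r) (M' : ℕ) (y₀ z : RN N) :
    wt (M + M') r y₀ z * (1 + ‖z - y₀‖ / r) ^ M = wt M' r y₀ z := by
  unfold wt
  have : 0 < 1 + ‖z - y₀‖ / r := by positivity
  rw [pow_add]
  field_simp

lemma exists_derivBound_wt (hf : ContDiff ℝ (⊤ : ℕ∞) f) (hs : HasCompactSupport f) (k M : ℕ) :
    ∃ c, 0 ≤ c ∧ DerivBound k (wt M 1 0) 1 f c := by
  obtain ⟨c, hc, h⟩ := DerivBound.of_hasCompactSupport hf hs k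
  obtain ⟨R, hR⟩ := hs.isCompact.isBounded.exists_norm_le
  have hR' : 0 ≤ max R 0 := le_max_right _ _
  refine ⟨c * (1 + max R 0) ^ M, by positivity, h.mono_on one_pos (fun y => ?_) fun y hy => ?_⟩
  · exact mul_nonneg (by positivity) (wt_pos one_pos _ _).le
  · rw [mul_assoc]
    refine mul_le_mul_of_nonneg_left ?_ hc
    have h1 : ‖y‖ ≤ max R 0 := (hR y hy).trans (le_max_left _ _)
    simp only [wt, sub_zero, div_one, one_pow]
    rw [← div_eq_mul_inv, one_le_div (by positivity)]
    gcongr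

lemma DerivBound.dilate (hf : ContDiff ℝ (⊤ : ℕ∞) f) (h : DerivBound k (wt M 1 0) 1 f c)
    {t : ℝ} (ht : 0 < t) (ε : ℝ) (hε : |ε| = 1) (y₀ : RN N) :
    DerivBound k (wt M t y₀) t (fun y => (((t ^ N)⁻¹ : ℝ) : ℂ) * f ((ε * t⁻¹) • (y - y₀))) c := by
  have hs : ContDiff ℝ (⊤ : ℕ∞) (fun y : RN N => (ε * t⁻¹) • (y - y₀)) :=
    (contDiff_id.sub contDiff_const).const_smul _
  refine ((h.comp_smul_sub hf ht ε hε y₀).const_mul (hf.comp hs) _).mono ht fun y => le_of_eq ?_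
  rw [Complex.norm_real, Real.norm_of_nonneg (by positivity)]
  simp only [wt, sub_zero, div_one, one_pow, norm_smul, norm_mul, Real.norm_eq_abs, hε, one_mul,
    abs_inv, abs_of_pos ht]
  rw [inv_mul_eq_div t]
  ring

lemma GoodPhi.exists_derivBound_dil (hφ : GoodPhi φ) (k M : ℕ) :
    ∃ c, 0 ≤ c ∧ ∀ t, 0 < t → ∀ y₀ : RN N,
      DerivBound k (wt M t y₀) t (fun y => (dil φ t (y₀ - y) : ℂ)) c := by
  have h1 : ContDiff ℝ (⊤ : ℕ∞) fun y => (φ y : ℂ) :=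
    Complex.ofRealCLM.contDiff.comp hφ.smooth
  have h2 : HasCompactSupport fun y => (φ y : ℂ) :=
    hφ.hasCompactSupport.comp_left (g := fun x : ℝ => (x : ℂ)) (by simp)
  obtain ⟨c, hc, h⟩ := exists_derivBound_wt h1 h2 k M
  refine ⟨c, hc, fun t ht y₀ => ?_⟩
  convert h.dilate h1 ht (-1) (by simp) y₀ using 2 with y
  simp only [dil]
  push_cast
  rw [show t⁻¹ • (y₀ - y) = (-1 * t⁻¹) • (y - y₀) by
    rw [neg_one_mul, neg_smul, ← smul_neg, neg_sub]]
  rw [div_eq_inv_mul]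

lemma GoodPhi.dil_sub_smooth (hφ : GoodPhi φ) (t : ℝ) (y₀ : RN N) :
    ContDiff ℝ (⊤ : ℕ∞) fun y => (dil φ t (y₀ - y) : ℂ) :=
  Complex.ofRealCLM.contDiff.comp ((hφ.dil_smooth t).comp (contDiff_const.sub contDiff_id))

lemma GoodPhi.dil_sub_hasCompactSupport (hφ : GoodPhi φ) {t : ℝ} (ht : 0 < t) (y₀ : RN N) :
    HasCompactSupport fun y => (dil φ t (y₀ - y) : ℂ) :=
  HasCompactSupport.of_support_subset_isCompact (isCompact_closedBall y₀ t) fun z hz => by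
    have h : dil φ t (y₀ - z) ≠ 0 := fun h => hz (by simp [h])
    simpa [dist_eq_norm, norm_sub_rev] using hφ.norm_le_of_dil_ne_zero ht h

lemma convAt_eq_integral_mul (φ : RN N → ℝ) (t : ℝ) (v : RN N → ℂ) (y : RN N) :
    convAt φ t v y = ∫ z, (dil φ t (y - z) : ℂ) * v z := by
  simp [convAt]

/-- The number of derivatives controlled by the test functions. -/
def testOrder (N M : ℕ) : ℕ := M + N + 1 + M + 2

/-- The decay exponent of the test functions. -/
def testDecay (N M : ℕ) : ℕ := M + (N + 1)

/-- `ψ` is a test function of size `c` and scale `r` around `y₀`. -/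
structure IsTest (M : ℕ) (r : ℝ) (y₀ : RN N) (ψ : RN N → ℂ) (c : ℝ) : Prop where
  smooth : ContDiff ℝ (⊤ : ℕ∞) ψ
  compact : HasCompactSupport ψ
  nonneg : 0 ≤ c
  bound : DerivBound (testOrder N M) (wt (testDecay N M) r y₀) r ψ c

/-- The constant in the fundamental estimate. -/
def coreConst (N M : ℕ) : ℝ := defectConst (N * 2 ^ testDecay N M) (testOrder N M)

lemma one_le_coreConst : 1 ≤ coreConst N M := one_le_defectConst (by positivity) _

lemma IsTest.norm_iterDefect_le (hφ : GoodPhi φ) (h : IsTest M r y₀ ψ c) (hr : 0 < r) (j : ℕ)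
    (y : RN N) : ‖iterDefect φ r ψ j y‖ ≤
      c * coreConst N M * ((2 ^ (j * M))⁻¹ * 2⁻¹ ^ j) * wt (testDecay N M) r y₀ y := by
  have hw : ∀ y, 0 ≤ wt (testDecay N M) r y₀ y := fun y => (wt_pos hr _ _).le
  have h1 := DerivBound.iterDefect hφ hr h.smooth h.compact h.nonneg hw (L := 2 ^ testDecay N M)
    (by positivity) (fun y z hz => wt_sub_le hr y₀ y z hz) j (testOrder N M) 0 h.bound
  refine (h1.norm_le y).trans (mul_le_mul_of_nonneg_right ?_ (hw y))
  have hc := h.nonneg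
  have hE := (zero_le_one.trans (one_le_coreConst (N := N) (M := M)))
  rw [coreConst] at hE ⊢
  refine mul_le_mul_of_nonneg_left ?_ (by positivity)
  rw [mul_comm j M, pow_mul, ← inv_pow, ← mul_pow]
  refine pow_le_pow_left₀ (by positivity) ?_ j
  rw [div_le_iff₀ (by positivity), testOrder, testDecay]
  have h2 : (1 : ℝ) ≤ 2 ^ (M + (N + 1)) := one_le_pow₀ (by norm_num)
  have h3 : ((2 : ℝ) ^ M)⁻¹ * 2⁻¹ * 2 ^ (M + N + 1 + M + 2) = 2 * 2 ^ (M + (N + 1)) := by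
    rw [show M + N + 1 + M + 2 = M + (N + 1) + M + 1 + 1 by ring, pow_succ, pow_succ,
      pow_add _ _ M]
    field_simp
  rw [h3]
  linarith

lemma IsTest.ofReal_norm_integral_le (hφ : GoodPhi φ) (h : IsTest M r y₀ ψ c) (hr : 0 < r)
    (hv : Continuous v) (hvs : HasCompactSupport v) {H : RN N → ℝ≥0∞}
    (hH : ∀ j z, ENNReal.ofReal ‖convAt φ (r / 2 ^ (j + 1)) v z‖ ≤
      ENNReal.ofReal (2 ^ (j * M)) * H z) :
    ENNReal.ofReal ‖∫ y, ψ y * v y‖ ≤ ENNReal.ofReal (c * coreConst N M * 2) *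
      ∫⁻ z, ENNReal.ofReal (wt (testDecay N M) r y₀ z) * H z := by
  set I := ∫⁻ z, ENNReal.ofReal (wt (testDecay N M) r y₀ z) * H z
  set I' := ∫⁻ z, ENNReal.ofReal (wt (testDecay N M) r y₀ z * ‖v z‖)
  have hc := h.nonneg
  have hE := (zero_le_one.trans (one_le_coreConst (N := N) (M := M)))
  have hI' : I' ≠ ⊤ := by
    have : Integrable fun z => wt (testDecay N M) r y₀ z * ‖v z‖ :=
      ((continuous_wt hr y₀).mul hv.norm).integrable_of_hasCompactSupport hvs.norm.mul_left
    exact this.lintegral_lt_top.ne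
  have key : ∀ J : ℕ, ENNReal.ofReal ‖∫ y, ψ y * v y‖ ≤
      ENNReal.ofReal (c * coreConst N M * 2) * I +
        ENNReal.ofReal (c * coreConst N M * 2⁻¹ ^ J) * I' := by
    intro J
    rw [hφ.integral_mul_eq_sum hr h.smooth h.compact hv hvs J]
    have h1 : ∀ j, ENNReal.ofReal
        ‖∫ y, iterDefect φ r ψ j y * convAt φ (r / 2 ^ (j + 1)) v y‖ ≤
        ENNReal.ofReal (c * coreConst N M * 2⁻¹ ^ j) * I := by
      intro j
      rw [ofReal_norm, ← lintegral_const_mul' _ _ ENNReal.ofReal_ne_top]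
      refine (enorm_integral_le_lintegral_enorm _).trans (lintegral_mono fun z => ?_)
      rw [enorm_mul, ← ofReal_norm, ← ofReal_norm]
      calc _ ≤ ENNReal.ofReal (c * coreConst N M * ((2 ^ (j * M))⁻¹ * 2⁻¹ ^ j) *
            wt (testDecay N M) r y₀ z) * (ENNReal.ofReal (2 ^ (j * M)) * H z) := by
            gcongr
            · exact h.norm_iterDefect_le hφ hr j z
            · exact hH j z
        _ = _ := by
            have hwt := (wt_pos (M := testDecay N M) hr y₀ z).le
            rw [← mul_assoc (ENNReal.ofReal _) (ENNReal.ofReal _),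
              ← mul_assoc (ENNReal.ofReal _) (ENNReal.ofReal _),
              ← ENNReal.ofReal_mul (mul_nonneg (by positivity) hwt),
              ← ENNReal.ofReal_mul (by positivity)]
            congr 2
            field_simp
    have h2 : ENNReal.ofReal ‖∫ y, iterDefect φ r ψ J y * v y‖ ≤
        ENNReal.ofReal (c * coreConst N M * 2⁻¹ ^ J) * I' := by
      rw [ofReal_norm, ← lintegral_const_mul' _ _ ENNReal.ofReal_ne_top]
      refine (enorm_integral_le_lintegral_enorm _).trans (lintegral_mono fun z => ?_)
      rw [← ofReal_norm, norm_mul, ← ENNReal.ofReal_mul (by positivity), ← mul_assoc]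
      refine ENNReal.ofReal_le_ofReal (mul_le_mul_of_nonneg_right ?_ (norm_nonneg _))
      refine (h.norm_iterDefect_le hφ hr J z).trans
        (mul_le_mul_of_nonneg_right ?_ (wt_pos hr _ _).le)
      refine mul_le_mul_of_nonneg_left (mul_le_of_le_one_left (by positivity) ?_) (by positivity)
      exact inv_le_one_of_one_le₀ (one_le_pow₀ (by norm_num))
    have h3 : ∑ j ∈ Finset.range J, ENNReal.ofReal (c * coreConst N M * 2⁻¹ ^ j) * I ≤
        ENNReal.ofReal (c * coreConst N M * 2) * I := by
      rw [← Finset.sum_mul, ← ENNReal.ofReal_sum_of_nonneg (fun _ _ => by positivity),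
        ← Finset.mul_sum]
      gcongr
      rw [geom_sum_eq (by norm_num)]
      have : (0 : ℝ) ≤ 2⁻¹ ^ J := by positivity
      rw [div_le_iff_of_neg (by norm_num)]
      norm_num
    calc _ ≤ ENNReal.ofReal ((∑ j ∈ Finset.range J,
          ‖∫ y, iterDefect φ r ψ j y * convAt φ (r / 2 ^ (j + 1)) v y‖) +
            ‖∫ y, iterDefect φ r ψ J y * v y‖) :=
          ENNReal.ofReal_le_ofReal ((norm_add_le _ _).trans
            (add_le_add_left (norm_sum_le _ _) _))
      _ ≤ (∑ j ∈ Finset.range J, ENNReal.ofReal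
          ‖∫ y, iterDefect φ r ψ j y * convAt φ (r / 2 ^ (j + 1)) v y‖) +
            ENNReal.ofReal ‖∫ y, iterDefect φ r ψ J y * v y‖ := by
          rw [ENNReal.ofReal_add (Finset.sum_nonneg fun _ _ => norm_nonneg _) (norm_nonneg _),
            ENNReal.ofReal_sum_of_nonneg fun _ _ => norm_nonneg _]
      _ ≤ _ := add_le_add ((Finset.sum_le_sum fun j _ => h1 j).trans h3) h2
  have hlim : Tendsto (fun J : ℕ => ENNReal.ofReal (c * coreConst N M * 2) * I +
      ENNReal.ofReal (c * coreConst N M * 2⁻¹ ^ J) * I') atTop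
      (𝓝 (ENNReal.ofReal (c * coreConst N M * 2) * I + ENNReal.ofReal 0 * I')) := by
    refine tendsto_const_nhds.add (ENNReal.Tendsto.mul_const (ENNReal.tendsto_ofReal ?_)
      (Or.inr hI'))
    have h4 := (tendsto_pow_atTop_nhds_zero_of_lt_one (r := (2⁻¹ : ℝ)) (by norm_num)
      (by norm_num)).const_mul (c * coreConst N M)
    rwa [mul_zero] at h4
  simpa using ge_of_tendsto' hlim key

/-! ### The Peetre maximal function -/

/-- The Peetre maximal function at scales below `ρ`. -/
def peetre (φ : RN N → ℝ) (M : ℕ) (ρ : ℝ) (v : RN N → ℂ) (x : RN N) : ℝ≥0∞ :=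
  ⨆ s ∈ Ioo (0 : ℝ) ρ, ⨆ y, ENNReal.ofReal (‖convAt φ s v y‖ / (1 + ‖x - y‖ / s) ^ M)

/-- The radial maximal function at scales below `ρ`. -/
def radMax (φ : RN N → ℝ) (ρ : ℝ) (v : RN N → ℂ) (x : RN N) : ℝ≥0∞ :=
  ⨆ s ∈ Ioo (0 : ℝ) ρ, ENNReal.ofReal ‖convAt φ s v x‖

variable {ρ : ℝ}

lemma le_peetre {s : ℝ} (hs : s ∈ Ioo 0 ρ) (x y : RN N) :
    ENNReal.ofReal ‖convAt φ s v y‖ ≤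
      ENNReal.ofReal ((1 + ‖x - y‖ / s) ^ M) * peetre φ M ρ v x := by
  have hs0 : 0 < s := hs.1
  have h : ENNReal.ofReal (‖convAt φ s v y‖ / (1 + ‖x - y‖ / s) ^ M) ≤ peetre φ M ρ v x :=
    le_iSup₂_of_le s hs (le_iSup_of_le y le_rfl)
  calc ENNReal.ofReal ‖convAt φ s v y‖ = ENNReal.ofReal ((1 + ‖x - y‖ / s) ^ M) *
        ENNReal.ofReal (‖convAt φ s v y‖ / (1 + ‖x - y‖ / s) ^ M) := by
        rw [← ENNReal.ofReal_mul (by positivity)]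
        congr 1
        field_simp
    _ ≤ _ := by gcongr

lemma le_radMax {s : ℝ} (hs : s ∈ Ioo 0 ρ) (x : RN N) :
    ENNReal.ofReal ‖convAt φ s v x‖ ≤ radMax φ ρ v x :=
  le_iSup₂_of_le (f := fun s (_ : s ∈ Ioo 0 ρ) => ENNReal.ofReal ‖convAt φ s v x‖) s hs le_rfl

lemma peetre_le {A : ℝ≥0∞} {x : RN N}
    (hA : ∀ s ∈ Ioo 0 ρ, ∀ y, ENNReal.ofReal ‖convAt φ s v y‖ ≤
      ENNReal.ofReal ((1 + ‖x - y‖ / s) ^ M) * A) : peetre φ M ρ v x ≤ A := by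
  refine iSup₂_le fun s hs => iSup_le fun y => ?_
  have hs0 : 0 < s := hs.1
  have h1 : 0 < (1 + ‖x - y‖ / s) ^ M := by positivity
  rw [ENNReal.ofReal_div_of_pos h1]
  exact ENNReal.div_le_of_le_mul (by rw [mul_comm]; exact hA s hs y)

lemma GoodPhi.exists_radMax_le (hφ : GoodPhi φ) (hv : Continuous v) (hvs : HasCompactSupport v) :
    ∃ B : ℝ≥0∞, B ≠ ⊤ ∧ (∀ x, radMax φ ρ v x ≤ B) ∧ ∀ x, peetre φ M ρ v x ≤ B := by
  obtain ⟨A, hA⟩ := hv.bounded_above_of_compact_support hvs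
  have h : ∀ s ∈ Ioo 0 ρ, ∀ y, ENNReal.ofReal ‖convAt φ s v y‖ ≤ ENNReal.ofReal A :=
    fun s hs y => ENNReal.ofReal_le_ofReal (hφ.norm_convAt_le hs.1 fun z _ => hA _)
  refine ⟨ENNReal.ofReal A, ENNReal.ofReal_ne_top, fun x => iSup₂_le fun s hs => h s hs x,
    fun x => peetre_le fun s hs y => (h s hs y).trans ?_⟩
  refine le_mul_of_one_le_left zero_le ?_
  have hs0 : 0 < s := hs.1
  rw [← ENNReal.ofReal_one]
  exact ENNReal.ofReal_le_ofReal (one_le_pow₀ (by linarith [show 0 ≤ ‖x - y‖ / s by positivity]))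

lemma GoodPhi.measurable_radMax (hφ : GoodPhi φ) (hv : Continuous v)
    (hvs : HasCompactSupport v) : Measurable (radMax φ ρ v) := by
  refine LowerSemicontinuous.measurable ?_
  unfold radMax
  refine lowerSemicontinuous_biSup fun s hs => ?_
  exact (ENNReal.continuous_ofReal.comp
    (hφ.convAt_continuous hs.1 hv hvs).norm).lowerSemicontinuous

lemma peetre_factor {s : ℝ} (hs : 0 < s) (j M : ℕ) (x y z : RN N) :
    (1 + ‖x - z‖ / (s / 2 ^ (j + 1))) ^ M ≤
      2 ^ (j * M) * (2 ^ M * ((1 + ‖x - y‖ / s) ^ M * (1 + ‖z - y‖ / s) ^ M)) := by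
  rw [pow_mul, ← mul_pow, ← mul_pow, ← mul_pow]
  refine pow_le_pow_left₀ (by positivity) ?_ M
  have h0 : ‖x - z‖ ≤ ‖x - y‖ + ‖z - y‖ := by
    have := norm_sub_le (x - y) (z - y)
    rwa [sub_sub_sub_cancel_right] at this
  set a := ‖x - y‖ / s with ha
  set b := ‖z - y‖ / s with hb
  have ha0 : 0 ≤ a := by positivity
  have hb0 : 0 ≤ b := by positivity
  have h1 : ‖x - z‖ / (s / 2 ^ (j + 1)) ≤ 2 ^ (j + 1) * (a + b) := by
    rw [div_div_eq_mul_div, mul_comm, mul_div_assoc]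
    gcongr
    rw [ha, hb, ← add_div]
    gcongr
  have h2 : (1 : ℝ) ≤ 2 ^ (j + 1) := one_le_pow₀ (by norm_num)
  have h3 : (2 : ℝ) ^ j * (2 * ((1 + a) * (1 + b))) = 2 ^ (j + 1) * ((1 + a) * (1 + b)) := by ring
  rw [h3]
  nlinarith [mul_nonneg ha0 hb0, mul_nonneg (zero_le_one.trans h2) (mul_nonneg ha0 hb0)]

lemma le_peetre_dyadic {s : ℝ} (hs : 0 < s) (hsρ : s ≤ ρ) (j : ℕ) (x y z : RN N) :
    ENNReal.ofReal ‖convAt φ (s / 2 ^ (j + 1)) v z‖ ≤ ENNReal.ofReal (2 ^ (j * M)) *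
      (ENNReal.ofReal (2 ^ M * (1 + ‖x - y‖ / s) ^ M) * (ENNReal.ofReal ((1 + ‖z - y‖ / s) ^ M) *
        peetre φ M ρ v x)) := by
  have h : s / 2 ^ (j + 1) ∈ Ioo 0 ρ :=
    ⟨by positivity, (div_lt_self hs (one_lt_pow₀ (by norm_num) (by simp))).trans_le hsρ⟩
  refine (le_peetre (M := M) h x z).trans ?_
  rw [← mul_assoc, ← mul_assoc, ← ENNReal.ofReal_mul (by positivity),
    ← ENNReal.ofReal_mul (by positivity)]
  gcongr
  refine (peetre_factor hs j M x y z).trans (le_of_eq ?_)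
  ring

/-- The constant in the pointwise estimate for test functions. -/
def testConst (N M : ℕ) : ℝ :=
  coreConst N M * 2 * 2 ^ M * 2 ^ (N + 2) * (unitVol N).toReal

lemma testConst_nonneg : 0 ≤ testConst N M := by
  have hE := (zero_le_one.trans (one_le_coreConst (N := N) (M := M)))
  unfold testConst
  positivity

/-- Pairing with a test function is controlled by the Peetre maximal function. -/
lemma IsTest.le_peetre (hφ : GoodPhi φ) (h : IsTest M r y₀ ψ c) (hr : 0 < r) (hrρ : r ≤ ρ)
    (hv : Continuous v) (hvs : HasCompactSupport v) (x : RN N) :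
    ENNReal.ofReal ‖∫ y, ψ y * v y‖ ≤
      ENNReal.ofReal (testConst N M * c * (1 + ‖x - y₀‖ / r) ^ M) * peetre φ M ρ v x := by
  have hc := h.nonneg
  have hE := (zero_le_one.trans (one_le_coreConst (N := N) (M := M)))
  refine (h.ofReal_norm_integral_le hφ hr hv hvs fun j z =>
    le_peetre_dyadic hr hrρ j x y₀ z).trans ?_
  have h1 : ∀ z, ENNReal.ofReal (wt (testDecay N M) r y₀ z) *
      (ENNReal.ofReal (2 ^ M * (1 + ‖x - y₀‖ / r) ^ M) *
        (ENNReal.ofReal ((1 + ‖z - y₀‖ / r) ^ M) * peetre φ M ρ v x)) =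
      ENNReal.ofReal (2 ^ M * (1 + ‖x - y₀‖ / r) ^ M) * peetre φ M ρ v x *
        ENNReal.ofReal (wt (N + 1) r y₀ z) := by
    intro z
    rw [← wt_add_mul (M := M) hr (N + 1) y₀ z, ENNReal.ofReal_mul (wt_pos hr _ _).le, testDecay]
    ring
  simp only [h1]
  rw [lintegral_const_mul _ (continuous_wt hr y₀).measurable.ennreal_ofReal]
  calc _ ≤ ENNReal.ofReal (c * coreConst N M * 2) * (ENNReal.ofReal (2 ^ M * (1 + ‖x - y₀‖ / r) ^ M)
        * peetre φ M ρ v x * (ENNReal.ofReal (2 ^ (N + 2)) * unitVol N)) := by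
        gcongr
        exact lintegral_wt_le hr y₀
    _ = ENNReal.ofReal (c * coreConst N M * 2) * ENNReal.ofReal (2 ^ M * (1 + ‖x - y₀‖ / r) ^ M)
        * ENNReal.ofReal (2 ^ (N + 2)) * ENNReal.ofReal (unitVol N).toReal *
          peetre φ M ρ v x := by
        rw [ENNReal.ofReal_toReal unitVol_ne_top]
        ring
    _ = _ := by
        rw [← ENNReal.ofReal_mul (by positivity), ← ENNReal.ofReal_mul (by positivity),
          ← ENNReal.ofReal_mul (by positivity)]
        congr 2
        rw [testConst]
        ring

lemma GoodPhi.exists_isTest_dil (hφ : GoodPhi φ) (M : ℕ) :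
    ∃ c, ∀ t, 0 < t → ∀ y₀ : RN N, IsTest M t y₀ (fun y => (dil φ t (y₀ - y) : ℂ)) c := by
  obtain ⟨c, hc, h⟩ := hφ.exists_derivBound_dil (testOrder N M) (testDecay N M)
  exact ⟨c, fun t ht y₀ => ⟨hφ.dil_sub_smooth t y₀, hφ.dil_sub_hasCompactSupport ht y₀, hc,
    h t ht y₀⟩⟩

/-- The Peetre maximal function is controlled by the radial one in `L^p`. -/
lemma GoodPhi.lintegral_peetre_le (hφ : GoodPhi φ) (hN : N ≠ 0) (hM : N < M) {p : ℝ}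
    (hp : 0 < p) (hpM : N < p * M) :
    ∃ C : ℝ≥0∞, C ≠ ⊤ ∧ ∀ (ρ : ℝ) (v : RN N → ℂ), Continuous v → HasCompactSupport v →
      ∫⁻ x, peetre φ M ρ v x ^ p ≤ C * ∫⁻ x, radMax φ ρ v x ^ p := by
  obtain ⟨c, hc⟩ := hφ.exists_isTest_dil M
  have hN0 : (0 : ℝ) < N := by positivity
  have hM0 : (0 : ℝ) < M := by exact_mod_cast hN.bot_lt.trans hM
  set θ : ℝ := N / M with hθ
  have hθ0 : 0 < θ := by positivity
  have hθ1 : θ < 1 := by rw [hθ, div_lt_one hM0]; exact_mod_cast hM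
  have hc0 : 0 ≤ c := (hc 1 one_pos 0).nonneg
  have hE := (zero_le_one.trans (one_le_coreConst (N := N) (M := M)))
  set D : ℝ := c * coreConst N M * 2 * 2 ^ M * 2 ^ (N + 2) with hD
  have hD0 : 0 ≤ D := by positivity
  have hq : 1 < p / θ := by
    rw [hθ, div_div_eq_mul_div, one_lt_div hN0]; exact hpM
  refine ⟨ENNReal.ofReal D ^ (p / θ) * hlConst N (p / θ), ?_, fun ρ v hv hvs => ?_⟩
  · have := hlConst_ne_top (N := N) (q := p / θ)
    have h1 : 0 ≤ p / θ := by positivity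
    finiteness
  obtain ⟨B, hB, hBr, hBp⟩ := hφ.exists_radMax_le (M := M) (ρ := ρ) hv hvs
  have hmeas : Measurable fun z => radMax φ ρ v z ^ θ :=
    (hφ.measurable_radMax hv hvs).pow_const θ
  have key : ∀ x, peetre φ M ρ v x ≤ ENNReal.ofReal D * hlMax (fun z => radMax φ ρ v z ^ θ) x *
      peetre φ M ρ v x ^ (1 - θ) := by
    intro x
    refine peetre_le fun s hs y => ?_
    have hs0 : 0 < s := hs.1
    set P := peetre φ M ρ v x
    set a : ℝ := 1 + ‖x - y‖ / s with ha
    have ha1 : 1 ≤ a := by linarith [show 0 ≤ ‖x - y‖ / s by positivity]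
    have ha0 : 0 < a := by linarith
    rw [convAt_eq_integral_mul]
    have hH : ∀ j z, ENNReal.ofReal ‖convAt φ (s / 2 ^ (j + 1)) v z‖ ≤
        ENNReal.ofReal (2 ^ (j * M)) * (ENNReal.ofReal ((1 + ‖z - y‖ / s) ^ M) *
          (radMax φ ρ v z ^ θ * (ENNReal.ofReal (2 ^ M * a ^ ((M : ℝ) - N)) * P ^ (1 - θ)))) := by
      intro j z
      set b : ℝ := 1 + ‖z - y‖ / s with hb
      have hb1 : 1 ≤ b := by linarith [show 0 ≤ ‖z - y‖ / s by positivity]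
      have hb0 : 0 < b := by linarith
      have h1 := le_peetre_dyadic (φ := φ) (v := v) (M := M) hs0 hs.2.le j x y z
      have h2 : ENNReal.ofReal ‖convAt φ (s / 2 ^ (j + 1)) v z‖ ≤ radMax φ ρ v z := by
        refine le_radMax ⟨by positivity, ?_⟩ z
        exact (div_lt_self hs0 (one_lt_pow₀ (by norm_num) (by simp))).trans hs.2
      have h3 : ENNReal.ofReal ‖convAt φ (s / 2 ^ (j + 1)) v z‖ =
          ENNReal.ofReal ‖convAt φ (s / 2 ^ (j + 1)) v z‖ ^ θ *
          ENNReal.ofReal ‖convAt φ (s / 2 ^ (j + 1)) v z‖ ^ (1 - θ) := by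
        rw [← ENNReal.rpow_add_of_nonneg _ _ hθ0.le (by linarith), add_sub_cancel, ENNReal.rpow_one]
      have h4 : ∀ e : ℝ, 1 ≤ e → ENNReal.ofReal e ^ (1 - θ) ≤ ENNReal.ofReal e := by
        intro e he
        have : (1 : ℝ≥0∞) ≤ ENNReal.ofReal e := by rw [← ENNReal.ofReal_one]; gcongr
        calc _ ≤ ENNReal.ofReal e ^ (1 : ℝ) := ENNReal.rpow_le_rpow_of_exponent_le this (by linarith)
          _ = _ := ENNReal.rpow_one _
      have h5 : ENNReal.ofReal (a ^ M) ^ (1 - θ) = ENNReal.ofReal (a ^ ((M : ℝ) - N)) := by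
        rw [ENNReal.ofReal_rpow_of_nonneg (by positivity) (by linarith), ← Real.rpow_natCast,
          ← Real.rpow_mul ha0.le]
        congr 2
        rw [hθ]
        field_simp
      rw [h3]
      calc _ ≤ radMax φ ρ v z ^ θ * (ENNReal.ofReal (2 ^ (j * M)) * (ENNReal.ofReal (2 ^ M * a ^ M) *
            (ENNReal.ofReal (b ^ M) * P))) ^ (1 - θ) := by
            gcongr
        _ = radMax φ ρ v z ^ θ * (ENNReal.ofReal (2 ^ (j * M)) ^ (1 - θ) *
            (ENNReal.ofReal (2 ^ M) ^ (1 - θ) * ENNReal.ofReal (a ^ M) ^ (1 - θ) *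
            (ENNReal.ofReal (b ^ M) ^ (1 - θ) * P ^ (1 - θ)))) := by
            have h6 : 0 ≤ 1 - θ := by linarith
            rw [ENNReal.mul_rpow_of_nonneg _ _ h6, ENNReal.mul_rpow_of_nonneg _ _ h6,
              ENNReal.mul_rpow_of_nonneg _ _ h6, ENNReal.ofReal_mul (by positivity),
              ENNReal.mul_rpow_of_nonneg _ _ h6]
        _ ≤ radMax φ ρ v z ^ θ * (ENNReal.ofReal (2 ^ (j * M)) *
            (ENNReal.ofReal (2 ^ M) * ENNReal.ofReal (a ^ ((M : ℝ) - N)) *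
            (ENNReal.ofReal (b ^ M) * P ^ (1 - θ)))) := by
            rw [h5]
            gcongr
            · exact h4 _ (one_le_pow₀ (by norm_num))
            · exact h4 _ (one_le_pow₀ (by norm_num))
            · exact h4 _ (one_le_pow₀ hb1)
        _ = _ := by
            rw [ENNReal.ofReal_mul (by positivity)]
            ring
    refine ((hc s hs0 y).ofReal_norm_integral_le hφ hs0 hv hvs hH).trans ?_
    have h1 : ∀ z, ENNReal.ofReal (wt (testDecay N M) s y z) *
        (ENNReal.ofReal ((1 + ‖z - y‖ / s) ^ M) *
          (radMax φ ρ v z ^ θ * (ENNReal.ofReal (2 ^ M * a ^ ((M : ℝ) - N)) * P ^ (1 - θ)))) =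
        ENNReal.ofReal (2 ^ M * a ^ ((M : ℝ) - N)) * P ^ (1 - θ) *
        (ENNReal.ofReal (wt (N + 1) s y z) * radMax φ ρ v z ^ θ) := by
      intro z
      rw [← wt_add_mul (M := M) hs0 (N + 1) y z, ENNReal.ofReal_mul (wt_pos hs0 _ _).le, testDecay]
      ring
    simp only [h1]
    have hmeas' : Measurable fun z => ENNReal.ofReal (wt (N + 1) s y z) * radMax φ ρ v z ^ θ :=
      (continuous_wt hs0 y).measurable.ennreal_ofReal.mul hmeas
    rw [lintegral_const_mul _ hmeas']
    calc _ ≤ ENNReal.ofReal (c * coreConst N M * 2) * (ENNReal.ofReal (2 ^ M * a ^ ((M : ℝ) - N)) *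
          P ^ (1 - θ) * (ENNReal.ofReal (2 ^ (N + 2) * a ^ N) *
            hlMax (fun z => radMax φ ρ v z ^ θ) x)) := by
          gcongr
          exact lintegral_wt_mul_le hmeas hs0 x y
      _ = ENNReal.ofReal (c * coreConst N M * 2) * ENNReal.ofReal (2 ^ M * a ^ ((M : ℝ) - N)) *
          ENNReal.ofReal (2 ^ (N + 2) * a ^ N) * (hlMax (fun z => radMax φ ρ v z ^ θ) x *
            P ^ (1 - θ)) := by ring
      _ = ENNReal.ofReal (a ^ M) * ENNReal.ofReal D * (hlMax (fun z => radMax φ ρ v z ^ θ) x *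
            P ^ (1 - θ)) := by
          rw [← ENNReal.ofReal_mul (by positivity), ← ENNReal.ofReal_mul (by positivity),
            ← ENNReal.ofReal_mul (by positivity)]
          congr 2
          have h7 : a ^ M = a ^ ((M : ℝ) - N) * a ^ N := by
            rw [← Real.rpow_natCast a N, ← Real.rpow_add ha0, sub_add_cancel, Real.rpow_natCast]
          rw [h7, hD]
          ring
      _ = _ := by ring
  have key2 : ∀ x, peetre φ M ρ v x ^ θ ≤
      ENNReal.ofReal D * hlMax (fun z => radMax φ ρ v z ^ θ) x := by
    intro x
    have hfin : peetre φ M ρ v x ≠ ⊤ := ne_top_of_le_ne_top hB (hBp x)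
    by_cases h0 : peetre φ M ρ v x = 0
    · rw [h0, ENNReal.zero_rpow_of_pos hθ0]; exact zero_le
    have h1 : peetre φ M ρ v x ^ (1 - θ) ≠ 0 := by
      simp [h0, hfin]
    have h2 : peetre φ M ρ v x ^ (1 - θ) ≠ ⊤ := by
      simp [h0, hfin]
    refine (ENNReal.mul_le_mul_iff_left h1 h2).1 ?_
    rw [← ENNReal.rpow_add_of_nonneg _ _ hθ0.le (by linarith), add_sub_cancel, ENNReal.rpow_one]
    exact key x
  have hBθ : B ^ θ ≠ ⊤ := ENNReal.rpow_ne_top_of_nonneg hθ0.le hB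
  calc ∫⁻ x, peetre φ M ρ v x ^ p
      ≤ ∫⁻ x, ENNReal.ofReal D ^ (p / θ) *
        hlMax (fun z => radMax φ ρ v z ^ θ) x ^ (p / θ) := by
        refine lintegral_mono fun x => ?_
        rw [← ENNReal.mul_rpow_of_nonneg _ _ (by positivity)]
        calc peetre φ M ρ v x ^ p = (peetre φ M ρ v x ^ θ) ^ (p / θ) := by
              rw [← ENNReal.rpow_mul]; congr 1; field_simp
          _ ≤ _ := ENNReal.rpow_le_rpow (key2 x) (by positivity)
    _ ≤ ENNReal.ofReal D ^ (p / θ) * (hlConst N (p / θ) *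
        ∫⁻ x, (radMax φ ρ v x ^ θ) ^ (p / θ)) := by
        rw [lintegral_const_mul' _ _ (by finiteness)]
        gcongr
        exact lintegral_hlMax_rpow_le hN hmeas hBθ
          (fun z => ENNReal.rpow_le_rpow (hBr z) hθ0.le) hq
    _ = _ := by
        rw [mul_assoc]
        congr 3
        funext x
        rw [← ENNReal.rpow_mul]
        congr 1
        field_simp

end Core

/-! ### Convolution of Schwartz functions -/

section SchwartzConvolution

open scoped FourierTransform SchwartzMap LineDeriv

/-- The convolution of two complex-valued Schwartz functions. -/
def sconv (κ f : 𝓢(RN N, ℂ)) : 𝓢(RN N, ℂ) :=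
  SchwartzMap.convolution (ContinuousLinearMap.mul ℂ ℂ) κ f

lemma sconv_apply (κ f : 𝓢(RN N, ℂ)) (y : RN N) : sconv κ f y = ∫ z, κ z * f (y - z) := by
  rw [sconv, SchwartzMap.convolution_apply]
  rfl

lemma fourier_sconv_apply (κ f : 𝓢(RN N, ℂ)) (ξ : RN N) :
    𝓕 (sconv κ f) ξ = 𝓕 κ ξ * 𝓕 f ξ := by
  rw [sconv, SchwartzMap.fourier_convolution, SchwartzMap.pairing_apply_apply]
  rfl

lemma pd_schwartz (i : Fin N) (f : 𝓢(RN N, ℂ)) :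
    pd i (f : RN N → ℂ) = ∂_{(EuclideanSpace.single i (1 : ℝ) : RN N)} f := rfl

lemma hasTemperateGrowth_inner_single (i : Fin N) :
    (fun z : RN N => inner ℝ z (EuclideanSpace.single i (1 : ℝ))).HasTemperateGrowth :=
  ((innerSL ℝ).flip (EuclideanSpace.single i (1 : ℝ))).hasTemperateGrowth

lemma fourier_pd_apply (i : Fin N) (f : 𝓢(RN N, ℂ)) (z : RN N) :
    𝓕 (∂_{(EuclideanSpace.single i (1 : ℝ) : RN N)} f) z
      = 2 * Real.pi * Complex.I * (z i : ℂ) * 𝓕 f z := by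
  rw [SchwartzMap.fourier_lineDerivOp_eq, smul_apply,
    SchwartzMap.smulLeftCLM_apply_apply (hasTemperateGrowth_inner_single i)]
  simp [EuclideanSpace.inner_single_right, mul_assoc]

lemma pd_fourier_apply (i : Fin N) (f g : 𝓢(RN N, ℂ))
    (hg : ∀ ξ, g ξ = -(2 * Real.pi * Complex.I) * (ξ i : ℂ) * f ξ) :
    pd i (𝓕 f : 𝓢(RN N, ℂ)) = (𝓕 g : 𝓢(RN N, ℂ)) := by
  rw [pd_schwartz, SchwartzMap.lineDerivOp_fourier_eq]
  congr 2
  ext ξ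
  rw [hg, smul_apply,
    SchwartzMap.smulLeftCLM_apply_apply (hasTemperateGrowth_inner_single i)]
  simp [EuclideanSpace.inner_single_right, mul_assoc]

lemma lineDeriv_sconv (i : Fin N) (κ f : 𝓢(RN N, ℂ)) :
    ∂_{(EuclideanSpace.single i (1 : ℝ) : RN N)} (sconv κ f)
      = sconv κ (∂_{(EuclideanSpace.single i (1 : ℝ) : RN N)} f) := by
  have h : 𝓕 (∂_{(EuclideanSpace.single i (1 : ℝ) : RN N)} (sconv κ f))
      = 𝓕 (sconv κ (∂_{(EuclideanSpace.single i (1 : ℝ) : RN N)} f)) := by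
    ext ξ
    rw [fourier_pd_apply, fourier_sconv_apply, fourier_sconv_apply, fourier_pd_apply]
    ring
  simpa using congrArg (fun g : 𝓢(RN N, ℂ) => 𝓕⁻ g) h

lemma fourierInv_fourier_neg (T : 𝓢(RN N, ℂ)) (ξ : RN N) : 𝓕 (𝓕 T) (-ξ) = T ξ := by
  have h : 𝓕⁻ (𝓕 T) ξ = T ξ := by simp
  rw [← h, SchwartzMap.fourierInv_apply_eq]
  rfl

lemma integral_sconv_mul (T ψ w : 𝓢(RN N, ℂ)) :
    ∫ y, sconv (𝓕 T) ψ y * w y = ∫ ξ, T ξ * 𝓕⁻ ψ ξ * 𝓕 w ξ := by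
  have h := SchwartzMap.integral_fourierInv_mul_eq (sconv (𝓕 T) ψ) (𝓕 w)
  have h' : 𝓕⁻ (𝓕 w) = w := by simp
  rw [h'] at h
  rw [← h]
  refine integral_congr_ae (Eventually.of_forall fun ξ => ?_)
  have e : ∀ g : 𝓢(RN N, ℂ), 𝓕⁻ g ξ = 𝓕 g (-ξ) := fun g => by
    rw [SchwartzMap.fourierInv_apply_eq]
    rfl
  simp only [e]
  rw [fourier_sconv_apply, fourierInv_fourier_neg]

lemma integral_mul_eq_fourier (ψ w : 𝓢(RN N, ℂ)) :
    ∫ y, ψ y * w y = ∫ ξ, 𝓕⁻ ψ ξ * 𝓕 w ξ := by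
  have h := SchwartzMap.integral_fourierInv_mul_eq ψ (𝓕 w)
  have h' : 𝓕⁻ (𝓕 w) = w := by simp
  rw [h'] at h
  exact h.symm

lemma integrable_wt {r : ℝ} (hr : 0 < r) (y₀ : RN N) : Integrable (wt (N + 1) r y₀) := by
  refine ⟨(continuous_wt hr y₀).aestronglyMeasurable, ?_⟩
  rw [hasFiniteIntegral_iff_ofReal (Eventually.of_forall fun z => (wt_pos hr y₀ z).le)]
  exact (lintegral_wt_le hr y₀).trans_lt
    (ENNReal.mul_lt_top ENNReal.ofReal_lt_top unitVol_ne_top.lt_top)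

lemma integral_wt_le {r : ℝ} (hr : 0 < r) (y₀ : RN N) :
    ∫ z, wt (N + 1) r y₀ z ≤ 2 ^ (N + 2) * (unitVol N).toReal := by
  rw [integral_eq_lintegral_of_nonneg_ae (Eventually.of_forall fun z => (wt_pos hr y₀ z).le)
    (continuous_wt hr y₀).aestronglyMeasurable]
  refine (ENNReal.toReal_mono (ENNReal.mul_ne_top ENNReal.ofReal_ne_top unitVol_ne_top)
    (lintegral_wt_le hr y₀)).trans ?_
  rw [ENNReal.toReal_mul, ENNReal.toReal_ofReal (by positivity)]

lemma wt_mul_wt_sub_le {M : ℕ} {t r : ℝ} (ht : 0 < t) (htr : t ≤ r) (y₁ y₂ y z : RN N) :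
    wt (M + (N + 1)) t y₂ z * wt M r y₁ (y - z) ≤ wt (N + 1) t y₂ z * wt M r (y₁ + y₂) y := by
  have hr := ht.trans_le htr
  rw [← wt_add_mul (M := M) ht (N + 1) y₂ z, mul_assoc]
  refine mul_le_mul_of_nonneg_left ?_ (wt_pos ht y₂ z).le
  have key : 1 + ‖y - (y₁ + y₂)‖ / r ≤ (1 + ‖z - y₂‖ / t) * (1 + ‖y - z - y₁‖ / r) := by
    have h1 : ‖y - (y₁ + y₂)‖ ≤ ‖z - y₂‖ + ‖y - z - y₁‖ := by
      have : y - (y₁ + y₂) = (z - y₂) + (y - z - y₁) := by abel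
      rw [this]; exact norm_add_le _ _
    have h2 : ‖z - y₂‖ / r ≤ ‖z - y₂‖ / t := by gcongr
    have h3 : 0 ≤ ‖z - y₂‖ / t * (‖y - z - y₁‖ / r) := by positivity
    have h4 : ‖y - (y₁ + y₂)‖ / r ≤ ‖z - y₂‖ / r + ‖y - z - y₁‖ / r := by
      rw [← add_div]; gcongr
    nlinarith
  unfold wt
  rw [← mul_div_assoc]
  refine div_le_div_of_nonneg_right ?_ (by positivity)
  rw [← div_eq_mul_inv, inv_eq_one_div, div_le_div_iff₀ (by positivity) (by positivity), one_mul,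
    ← mul_pow]
  exact pow_le_pow_left₀ (by positivity) key M

/-- Total mass bound for the weights `wt (N + 1)`. -/
def massConst (N : ℕ) : ℝ := 2 ^ (N + 2) * (unitVol N).toReal

lemma massConst_nonneg : 0 ≤ massConst N := by unfold massConst; positivity

lemma DerivBound.sconv {k M : ℕ} {t r c c' : ℝ} {y₁ y₂ : RN N} (κ f : 𝓢(RN N, ℂ))
    (ht : 0 < t) (htr : t ≤ r) (hc' : 0 ≤ c') (hκ : ∀ z, ‖κ z‖ ≤ c' * wt (M + (N + 1)) t y₂ z)
    (h : DerivBound k (wt M r y₁) r f c) :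
    DerivBound k (wt M r (y₁ + y₂)) r (_root_.sconv κ f) (c * c' * massConst N) := by
  have base : ∀ {f : 𝓢(RN N, ℂ)} {c : ℝ}, (∀ y, ‖f y‖ ≤ c * wt M r y₁ y) → ∀ y,
      ‖_root_.sconv κ f y‖ ≤ c * c' * massConst N * wt M r (y₁ + y₂) y := by
    intro f c hf y
    have hr := ht.trans_le htr
    have hc : 0 ≤ c := nonneg_of_mul_nonneg_left ((norm_nonneg _).trans (hf 0)) (wt_pos hr _ _)
    rw [sconv_apply]
    have hb : ∀ z, ‖κ z * f (y - z)‖ ≤ c * c' * wt M r (y₁ + y₂) y * wt (N + 1) t y₂ z := by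
      intro z
      rw [norm_mul]
      calc ‖κ z‖ * ‖f (y - z)‖
          ≤ (c' * wt (M + (N + 1)) t y₂ z) * (c * wt M r y₁ (y - z)) :=
            mul_le_mul (hκ z) (hf _) (norm_nonneg _) (mul_nonneg hc' (wt_pos ht _ _).le)
        _ = c * c' * (wt (M + (N + 1)) t y₂ z * wt M r y₁ (y - z)) := by ring
        _ ≤ c * c' * (wt (N + 1) t y₂ z * wt M r (y₁ + y₂) y) :=
            mul_le_mul_of_nonneg_left (wt_mul_wt_sub_le ht htr _ _ _ _) (mul_nonneg hc hc')
        _ = _ := by ring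
    refine (norm_integral_le_of_norm_le ((integrable_wt ht y₂).const_mul _)
      (Eventually.of_forall hb)).trans ?_
    rw [integral_const_mul]
    have := integral_wt_le (N := N) ht y₂
    calc c * c' * wt M r (y₁ + y₂) y * ∫ z, wt (N + 1) t y₂ z
        ≤ c * c' * wt M r (y₁ + y₂) y * massConst N :=
          mul_le_mul_of_nonneg_left this
            (mul_nonneg (mul_nonneg hc hc') (wt_pos hr _ _).le)
      _ = _ := by ring
  induction k generalizing f c with
  | zero => exact base h
  | succ k ih =>
    refine ⟨base h.1, fun i => ?_⟩
    have := ih (∂_{(EuclideanSpace.single i (1 : ℝ) : RN N)} f) (h.2 i)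
    rw [← lineDeriv_sconv] at this
    rw [pd_schwartz]
    convert! this using 1
    ring

end SchwartzConvolution

/-! ### Smooth families of compactly supported symbols -/

section SymbolFamilies

open scoped FourierTransform SchwartzMap LineDeriv

/-- A smooth compactly supported family of symbols `Θ y ξ`, parametrised by `y`. -/
structure SymFam (Θ : RN N → RN N → ℂ) : Prop where
  smooth : ContDiff ℝ (⊤ : ℕ∞) (fun q : RN N × RN N => Θ q.1 q.2)
  compact : HasCompactSupport (fun q : RN N × RN N => Θ q.1 q.2)

namespace SymFam

variable {Θ : RN N → RN N → ℂ}

lemma smooth_slice (h : SymFam Θ) (y : RN N) : ContDiff ℝ (⊤ : ℕ∞) (Θ y) :=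
  h.smooth.comp (contDiff_const.prodMk contDiff_id)

lemma exists_compact (h : SymFam Θ) :
    ∃ S : Set (RN N), IsCompact S ∧ ∀ y, ∀ ξ ∉ S, Θ y ξ = 0 := by
  refine ⟨Prod.snd '' tsupport (fun q : RN N × RN N => Θ q.1 q.2),
    h.compact.isCompact.image continuous_snd, fun y ξ hξ => ?_⟩
  by_contra hne
  exact hξ ⟨(y, ξ), subset_tsupport _ hne, rfl⟩

lemma compact_slice (h : SymFam Θ) (y : RN N) : HasCompactSupport (Θ y) := by
  obtain ⟨S, hS, h0⟩ := h.exists_compact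
  exact HasCompactSupport.intro hS fun ξ hξ => h0 y ξ hξ

/-- The members of a family of symbols, as Schwartz functions. -/
def schw (h : SymFam Θ) (y : RN N) : 𝓢(RN N, ℂ) :=
  (h.compact_slice y).toSchwartzMap (h.smooth_slice y)

lemma schw_apply (h : SymFam Θ) (y ξ : RN N) : h.schw y ξ = Θ y ξ := rfl

lemma pd (h : SymFam Θ) (i : Fin N) : SymFam fun y => pd i (Θ y) := by
  constructor
  · have h1 : ContDiff ℝ (⊤ : ℕ∞) (fun q : RN N × RN N => fderiv ℝ (Θ q.1) q.2) := by
      refine ContDiff.fderiv (m := (⊤ : ℕ∞)) (n := (⊤ : ℕ∞)) (f := fun q : RN N × RN N => Θ q.1) ?_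
        contDiff_snd le_rfl
      exact h.smooth.comp (contDiff_fst.fst.prodMk contDiff_snd)
    exact h1.clm_apply contDiff_const
  · refine h.compact.mono' ?_
    intro q hq
    by_contra hne
    refine hq ?_
    have h2 : (fun q : RN N × RN N => Θ q.1 q.2) =ᶠ[𝓝 q] 0 := notMem_tsupport_iff_eventuallyEq.1 hne
    have h3 : Θ q.1 =ᶠ[𝓝 q.2] 0 := by
      have hc : Tendsto (fun ξ : RN N => (q.1, ξ)) (𝓝 q.2) (𝓝 q) :=
        (Continuous.prodMk continuous_const continuous_id).tendsto' _ _ rfl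
      exact hc.eventually h2
    show fderiv ℝ (Θ q.1) q.2 _ = 0
    rw [h3.fderiv_eq]
    simp

lemma coord_mul (h : SymFam Θ) (c : ℂ) (i : Fin N) :
    SymFam fun y ξ => c * (ξ i : ℂ) * Θ y ξ := by
  constructor
  · refine ContDiff.mul (contDiff_const.mul ?_) h.smooth
    exact Complex.ofRealCLM.contDiff.comp
      ((EuclideanSpace.proj (𝕜 := ℝ) i).contDiff.comp contDiff_snd)
  · exact h.compact.mul_left

lemma exists_bound (h : SymFam Θ) : ∃ C, 0 ≤ C ∧ ∀ y z, ‖𝓕 (h.schw y) z‖ ≤ C := by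
  obtain ⟨S, hS, h0⟩ := h.exists_compact
  obtain ⟨B, hB⟩ := h.smooth.continuous.bounded_above_of_compact_support h.compact
  have hB0 : 0 ≤ B := (norm_nonneg _).trans (hB 0)
  refine ⟨B * (volume S).toReal, by positivity, fun y z => ?_⟩
  rw [SchwartzMap.fourier_coe, Real.fourier_eq]
  have hint : Integrable (S.indicator fun _ : RN N => B) :=
    (integrable_indicator_iff hS.measurableSet).2
      (integrableOn_const (hS.measure_lt_top.ne))
  refine (norm_integral_le_of_norm_le hint (Eventually.of_forall fun v => ?_)).trans ?_
  · rw [Circle.norm_smul]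
    by_cases hv : v ∈ S
    · rw [indicator_of_mem hv]; exact hB (y, v)
    · rw [indicator_of_notMem hv, h.schw_apply, h0 y v hv, norm_zero]
  · rw [integral_indicator hS.measurableSet, setIntegral_const, smul_eq_mul, mul_comm]
    rfl

lemma exists_decay (h : SymFam Θ) (M : ℕ) :
    ∃ C, 0 ≤ C ∧ ∀ y z, (1 + ‖z‖) ^ M * ‖𝓕 (h.schw y) z‖ ≤ C := by
  induction M generalizing Θ with
  | zero => simpa using h.exists_bound
  | succ M ih =>
    obtain ⟨C, hC0, hC⟩ := ih h
    choose D hD0 hD using fun i => ih (h.pd i)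
    refine ⟨C + ∑ i, D i, add_nonneg hC0 (Finset.sum_nonneg fun i _ => hD0 i), fun y z => ?_⟩
    have e : ∀ i, ‖𝓕 ((h.pd i).schw y) z‖ = 2 * Real.pi * ‖z i‖ * ‖𝓕 (h.schw y) z‖ := by
      intro i
      have : (h.pd i).schw y = ∂_{(EuclideanSpace.single i (1 : ℝ) : RN N)} (h.schw y) := rfl
      rw [this, fourier_pd_apply]
      simp [abs_of_pos Real.pi_pos]
    have hz : ‖z‖ ≤ ∑ i, ‖z i‖ := by
      have hz' : z = ∑ i, z i • (EuclideanSpace.single i (1 : ℝ) : RN N) := by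
        ext j; simp [Pi.single_apply]
      calc ‖z‖ = ‖∑ i, z i • (EuclideanSpace.single i (1 : ℝ) : RN N)‖ := by rw [← hz']
        _ ≤ ∑ i, ‖z i • (EuclideanSpace.single i (1 : ℝ) : RN N)‖ := norm_sum_le _ _
        _ = _ := by simp [norm_smul]
    have hpi : 1 ≤ 2 * Real.pi := by linarith [Real.pi_gt_three]
    calc (1 + ‖z‖) ^ (M + 1) * ‖𝓕 (h.schw y) z‖
        = (1 + ‖z‖) ^ M * ‖𝓕 (h.schw y) z‖ + (1 + ‖z‖) ^ M * (‖z‖ * ‖𝓕 (h.schw y) z‖) := by ring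
      _ ≤ C + (1 + ‖z‖) ^ M * ∑ i, ‖𝓕 ((h.pd i).schw y) z‖ := by
          refine add_le_add (hC y z) (mul_le_mul_of_nonneg_left ?_ (by positivity))
          refine (mul_le_mul_of_nonneg_right hz (norm_nonneg _)).trans ?_
          rw [Finset.sum_mul]
          refine Finset.sum_le_sum fun i _ => ?_
          rw [e i, mul_assoc (2 * Real.pi)]
          exact le_mul_of_one_le_left (by positivity) hpi
      _ ≤ C + ∑ i, D i := by
          rw [Finset.mul_sum]
          gcongr with i
          exact hD i y z

lemma exists_derivBound (h : SymFam Θ) (k M : ℕ) :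
    ∃ C, 0 ≤ C ∧ ∀ y, DerivBound k (wt M 1 0) 1 (𝓕 (h.schw y) : 𝓢(RN N, ℂ)) C := by
  have base : ∀ {Θ : RN N → RN N → ℂ} (h : SymFam Θ), ∃ C, 0 ≤ C ∧ ∀ y z,
      ‖𝓕 (h.schw y) z‖ ≤ C * wt M 1 0 z := by
    intro Θ h
    obtain ⟨C, hC0, hC⟩ := h.exists_decay M
    refine ⟨C, hC0, fun y z => ?_⟩
    have hp : 0 < (1 + ‖z‖) ^ M := by positivity
    simp only [wt, sub_zero, div_one, one_pow]
    rw [← div_eq_mul_inv, le_div_iff₀ hp, mul_comm]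
    exact hC y z
  induction k generalizing Θ with
  | zero => exact base h
  | succ k ih =>
    obtain ⟨C, hC0, hC⟩ := base h
    choose D hD0 hD using fun i => ih (h.coord_mul (-(2 * Real.pi * Complex.I)) i)
    have hw : ∀ z : RN N, 0 ≤ wt M 1 0 z := fun z => (wt_pos one_pos 0 z).le
    have hs : 0 ≤ ∑ i, D i := Finset.sum_nonneg fun i _ => hD0 i
    refine ⟨C + ∑ i, D i, add_nonneg hC0 hs, fun y => ⟨fun z => ?_, fun i => ?_⟩⟩
    · exact (hC y z).trans (mul_le_mul_of_nonneg_right (by linarith) (hw z))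
    · rw [div_one, pd_fourier_apply i _
        ((h.coord_mul (-(2 * Real.pi * Complex.I)) i).schw y) fun ξ => rfl]
      refine (hD i y).mono_const one_pos hw ?_
      have := Finset.single_le_sum (f := D) (fun j _ => hD0 j) (Finset.mem_univ i)
      linarith

end SymFam

end SymbolFamilies

/-! ### A reproducing formula through the Fourier transform -/

section Reproducing

open scoped FourierTransform SchwartzMap LineDeriv

/-- A smooth step function, equal to `0` on `(-∞, 1]` and to `1` on `[2, ∞)`. -/
def stepFn (t : ℝ) : ℝ := Real.smoothTransition (t - 1)

lemma contDiff_stepFn : ContDiff ℝ (⊤ : ℕ∞) stepFn :=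
  Real.smoothTransition.contDiff.comp (contDiff_id.sub contDiff_const)

lemma deriv_stepFn_nonneg (t : ℝ) : 0 ≤ deriv stepFn t :=
  Monotone.deriv_nonneg fun _ _ h => Real.smoothTransition.monotone (by linarith)

lemma deriv_stepFn_of_lt {t : ℝ} (ht : t < 1) : deriv stepFn t = 0 := by
  have : stepFn =ᶠ[𝓝 t] fun _ => 0 := by
    filter_upwards [Iio_mem_nhds ht] with s hs
    exact Real.smoothTransition.zero_of_nonpos (by linarith [mem_Iio.1 hs])
  rw [this.deriv_eq, deriv_const]

lemma deriv_stepFn_of_gt {t : ℝ} (ht : 2 < t) : deriv stepFn t = 0 := by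
  have : stepFn =ᶠ[𝓝 t] fun _ => 1 := by
    filter_upwards [Ioi_mem_nhds ht] with s hs
    exact Real.smoothTransition.one_of_one_le (by linarith [mem_Ioi.1 hs])
  rw [this.deriv_eq, deriv_const]

/-- A radial cutoff, supported in an annulus, with `∫ radCut (s ξ) ds / s = 1` for `ξ ≠ 0`. -/
def radCut (ξ : RN N) : ℝ := 2 * ‖ξ‖ ^ 2 * deriv stepFn (‖ξ‖ ^ 2)

lemma contDiff_radCut : ContDiff ℝ (⊤ : ℕ∞) (radCut : RN N → ℝ) := by
  have h : ContDiff ℝ (⊤ : ℕ∞) (deriv stepFn) :=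
    (contDiff_infty_iff_deriv.1 contDiff_stepFn).2
  exact (contDiff_const.mul (contDiff_norm_sq ℝ)).mul (h.comp (contDiff_norm_sq ℝ))

lemma radCut_nonneg (ξ : RN N) : 0 ≤ radCut ξ :=
  mul_nonneg (by positivity) (deriv_stepFn_nonneg _)

lemma radCut_of_norm_lt {ξ : RN N} (h : ‖ξ‖ < 1) : radCut ξ = 0 := by
  rw [radCut, deriv_stepFn_of_lt (by nlinarith [norm_nonneg ξ]), mul_zero]

lemma radCut_of_lt_norm {ξ : RN N} (h : 2 < ‖ξ‖) : radCut ξ = 0 := by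
  rw [radCut, deriv_stepFn_of_gt (by nlinarith), mul_zero]

lemma radCut_integral {ξ : RN N} (hξ : ξ ≠ 0) :
    IntegrableOn (fun s : ℝ => s⁻¹ * radCut (s • ξ)) (Ioi 0) ∧
      ∫ s in Ioi (0 : ℝ), s⁻¹ * radCut (s • ξ) = 1 := by
  have hn : 0 < ‖ξ‖ := norm_pos_iff.2 hξ
  have hd : ∀ s ∈ Ioi (0 : ℝ), HasDerivAt (fun s : ℝ => stepFn (s ^ 2 * ‖ξ‖ ^ 2))
      (s⁻¹ * radCut (s • ξ)) s := by
    intro s hs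
    have h1 : HasDerivAt stepFn (deriv stepFn (s ^ 2 * ‖ξ‖ ^ 2)) (s ^ 2 * ‖ξ‖ ^ 2) :=
      (contDiff_stepFn.differentiable (by simp) _).hasDerivAt
    have h2 : HasDerivAt (fun s : ℝ => s ^ 2 * ‖ξ‖ ^ 2) (2 * s * ‖ξ‖ ^ 2) s := by
      simpa using (hasDerivAt_pow 2 s).mul_const (‖ξ‖ ^ 2)
    refine (h1.comp s h2).congr_deriv ?_
    have hs0 : s ≠ 0 := (mem_Ioi.1 hs).ne'
    rw [radCut, norm_smul, mul_pow, Real.norm_eq_abs, sq_abs]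
    field_simp
  have hc : ContinuousWithinAt (fun s : ℝ => stepFn (s ^ 2 * ‖ξ‖ ^ 2)) (Ici 0) 0 :=
    (contDiff_stepFn.continuous.comp (by fun_prop)).continuousWithinAt
  have hpos : ∀ s ∈ Ioi (0 : ℝ), 0 ≤ s⁻¹ * radCut (s • ξ) := fun s hs =>
    mul_nonneg (inv_nonneg.2 (mem_Ioi.1 hs).le) (radCut_nonneg _)
  have hl : Tendsto (fun s : ℝ => stepFn (s ^ 2 * ‖ξ‖ ^ 2)) atTop (𝓝 1) := by
    refine tendsto_const_nhds.congr' ?_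
    have : Tendsto (fun s : ℝ => s ^ 2 * ‖ξ‖ ^ 2) atTop atTop :=
      (tendsto_pow_atTop (by norm_num)).atTop_mul_const (by positivity)
    filter_upwards [this.eventually_ge_atTop 2] with s hs
    exact (Real.smoothTransition.one_of_one_le (by linarith)).symm
  refine ⟨integrableOn_Ioi_deriv_of_nonneg hc hd hpos hl, ?_⟩
  rw [integral_Ioi_of_hasDerivAt_of_nonneg hc hd hpos hl]
  simp [stepFn, Real.smoothTransition.zero_of_nonpos]

lemma enorm_integral_mul_le_of_symbol (hN : N ≠ 0) {ι : Type*} [Fintype ι]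
    (ψ F : 𝓢(RN N, ℂ)) (w : ι → 𝓢(RN N, ℂ)) (T : ℝ → ι → 𝓢(RN N, ℂ))
    (hT : ∀ s, 0 < s → ∀ ξ : RN N, ξ ≠ 0 →
      ∑ j, T s j ξ * 𝓕 (w j) ξ = ((s⁻¹ * radCut (s • ξ) : ℝ) : ℂ) * 𝓕 F ξ) :
    ENNReal.ofReal ‖∫ y, ψ y * F y‖ ≤
      ∫⁻ s in Ioi (0 : ℝ), ENNReal.ofReal ‖∑ j, ∫ y, sconv (𝓕 (T s j)) ψ y * w j y‖ := by
  have : Nonempty (Fin N) := ⟨⟨0, Nat.pos_of_ne_zero hN⟩⟩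
  have : Nontrivial (RN N) := inferInstance
  have hae : ∀ᵐ ξ : RN N, ξ ≠ 0 := by
    simp [ae_iff]
  set G : RN N → ℂ := fun ξ => 𝓕⁻ ψ ξ * 𝓕 F ξ with hG
  have hGi : Integrable G := by
    have := (SchwartzMap.pairing (ContinuousLinearMap.mul ℂ ℂ) (𝓕⁻ ψ) (𝓕 F)).integrable
      (μ := volume)
    refine this.congr (Eventually.of_forall fun ξ => ?_)
    rw [SchwartzMap.pairing_apply_apply]
    rfl
  set K : RN N → ℝ → ℂ := fun ξ s => ((s⁻¹ * radCut (s • ξ) : ℝ) : ℂ) * G ξ with hK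
  have hKm : AEStronglyMeasurable (fun q : RN N × ℝ => K q.1 q.2)
      ((volume : Measure (RN N)).prod (volume.restrict (Ioi (0 : ℝ)))) := by
    have h1 : Measurable fun q : RN N × ℝ => ((q.2⁻¹ * radCut (q.2 • q.1) : ℝ) : ℂ) := by
      refine Complex.measurable_ofReal.comp (measurable_snd.inv.mul ?_)
      exact contDiff_radCut.continuous.measurable.comp (measurable_snd.smul measurable_fst)
    have h2 : Continuous G := (𝓕⁻ ψ).continuous.mul (𝓕 F).continuous
    exact (h1.mul (h2.measurable.comp measurable_fst)).aestronglyMeasurable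
  have hsec : ∀ ξ : RN N, ξ ≠ 0 → Integrable (K ξ) (volume.restrict (Ioi (0 : ℝ))) ∧
      ∫ s in Ioi (0 : ℝ), K ξ s = G ξ ∧ ∫ s in Ioi (0 : ℝ), ‖K ξ s‖ = ‖G ξ‖ := by
    intro ξ hξ
    obtain ⟨h1, h2⟩ := radCut_integral hξ
    refine ⟨(h1.integrable.ofReal).mul_const _, ?_, ?_⟩
    · simp only [hK]
      rw [integral_mul_const, integral_complex_ofReal, h2, Complex.ofReal_one, one_mul]
    · have : ∀ s ∈ Ioi (0 : ℝ), ‖K ξ s‖ = s⁻¹ * radCut (s • ξ) * ‖G ξ‖ := by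
        intro s hs
        simp only [hK]
        rw [norm_mul, Complex.norm_real, Real.norm_of_nonneg
          (mul_nonneg (inv_nonneg.2 (mem_Ioi.1 hs).le) (radCut_nonneg _))]
      rw [setIntegral_congr_fun measurableSet_Ioi this, integral_mul_const, h2, one_mul]
  have hKi : Integrable (fun q : RN N × ℝ => K q.1 q.2)
      ((volume : Measure (RN N)).prod (volume.restrict (Ioi (0 : ℝ)))) := by
    rw [integrable_prod_iff hKm]
    refine ⟨hae.mono fun ξ hξ => (hsec ξ hξ).1, hGi.norm.congr (hae.mono fun ξ hξ => ?_)⟩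
    exact (hsec ξ hξ).2.2.symm
  have e1 : ∫ y, ψ y * F y = ∫ s in Ioi (0 : ℝ), ∫ ξ, K ξ s := by
    rw [integral_mul_eq_fourier, ← integral_integral_swap hKi]
    exact integral_congr_ae (hae.mono fun ξ hξ => (hsec ξ hξ).2.1.symm)
  have e2 : ∀ s ∈ Ioi (0 : ℝ), ∫ ξ, K ξ s = ∑ j, ∫ y, sconv (𝓕 (T s j)) ψ y * w j y := by
    intro s hs
    simp only [integral_sconv_mul]
    rw [← integral_finsetSum]
    · refine integral_congr_ae (hae.mono fun ξ hξ => ?_)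
      simp only [hK, hG]
      calc ((s⁻¹ * radCut (s • ξ) : ℝ) : ℂ) * (𝓕⁻ ψ ξ * 𝓕 F ξ)
          = 𝓕⁻ ψ ξ * (((s⁻¹ * radCut (s • ξ) : ℝ) : ℂ) * 𝓕 F ξ) := by ring
        _ = ∑ j, T s j ξ * 𝓕⁻ ψ ξ * 𝓕 (w j) ξ := by
            rw [← hT s hs ξ hξ, Finset.mul_sum]
            exact Finset.sum_congr rfl fun j _ => by ring
    · intro j _
      have := (SchwartzMap.pairing (ContinuousLinearMap.mul ℂ ℂ) (SchwartzMap.pairing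
        (ContinuousLinearMap.mul ℂ ℂ) (T s j) (𝓕⁻ ψ)) (𝓕 (w j))).integrable (μ := volume)
      refine this.congr (Eventually.of_forall fun ξ => ?_)
      rw [SchwartzMap.pairing_apply_apply, SchwartzMap.pairing_apply_apply]
      rfl
  rw [e1, ofReal_norm]
  refine (enorm_integral_le_lintegral_enorm _).trans (le_of_eq ?_)
  refine setLIntegral_congr_fun measurableSet_Ioi fun s hs => ?_
  rw [e2 s hs, ofReal_norm]

lemma fourier_smul_arg {s : ℝ} (hs : 0 < s) (T Θ : 𝓢(RN N, ℂ)) (hT : ∀ ξ, T ξ = Θ (s • ξ))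
    (z : RN N) : 𝓕 T z = (((s ^ N)⁻¹ : ℝ) : ℂ) * 𝓕 Θ (s⁻¹ • z) := by
  rw [SchwartzMap.fourier_coe, SchwartzMap.fourier_coe, Real.fourier_eq, Real.fourier_eq]
  have h := Measure.integral_comp_smul (volume : Measure (RN N))
    (fun v => Real.fourierChar (-inner ℝ v (s⁻¹ • z)) • Θ v) s
  rw [finrank_euclideanSpace_fin, abs_of_pos (by positivity), Complex.real_smul] at h
  rw [← h]
  refine integral_congr_ae (Eventually.of_forall fun v => ?_)
  simp only [hT, inner_smul_left, inner_smul_right]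
  congr 3
  simp [hs.ne']

lemma SymFam.exists_derivBound_sconv {Θ : RN N → RN N → ℂ} (h : SymFam Θ) {φ : RN N → ℝ}
    (hφ : GoodPhi φ) (k M : ℕ) :
    ∃ C, 0 ≤ C ∧ ∀ (y y₀ : RN N) (s s₀ : ℝ), 0 < s → 0 < s₀ → ∀ T ψ : 𝓢(RN N, ℂ),
      (∀ ξ, T ξ = Θ y (s • ξ)) → (∀ z, ψ z = (dil φ s₀ (y₀ - z) : ℂ)) →
      DerivBound k (wt M (max s s₀) y₀) (max s s₀) (sconv (𝓕 T) ψ) C := by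
  obtain ⟨c, hc0, hc⟩ := h.exists_derivBound k M
  obtain ⟨c', hc0', hc'⟩ := h.exists_derivBound 0 (M + (N + 1))
  obtain ⟨d, hd0, hd⟩ := hφ.exists_derivBound_dil k M
  obtain ⟨d', hd0', hd'⟩ := hφ.exists_derivBound_dil 0 (M + (N + 1))
  have hm : 0 ≤ massConst N := massConst_nonneg
  refine ⟨d * c' * massConst N + c * d' * massConst N, by positivity,
    fun y y₀ s s₀ hs hs₀ T ψ hT hψ => ?_⟩
  have hTf : (𝓕 T : 𝓢(RN N, ℂ))
      = fun z => (((s ^ N)⁻¹ : ℝ) : ℂ) * 𝓕 (h.schw y) ((1 * s⁻¹) • (z - 0)) := by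
    funext z
    rw [fourier_smul_arg hs T (h.schw y) fun ξ => hT ξ, sub_zero, one_mul]
  have hψf : (ψ : RN N → ℂ) = fun z => (dil φ s₀ (y₀ - z) : ℂ) := funext hψ
  have hTb : ∀ {k M c}, DerivBound k (wt M 1 0) 1 (𝓕 (h.schw y) : 𝓢(RN N, ℂ)) c →
      DerivBound k (wt M s 0) s (𝓕 T : 𝓢(RN N, ℂ)) c := by
    intro k M c hb
    rw [hTf]
    exact hb.dilate ((𝓕 (h.schw y)).smooth _) hs 1 (by simp) 0
  have hw : ∀ z : RN N, 0 ≤ wt M (max s s₀) y₀ z := fun z =>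
    (wt_pos (hs.trans_le (le_max_left _ _)) _ _).le
  have hpos : 0 < max s s₀ := hs.trans_le (le_max_left _ _)
  rcases le_total s s₀ with hss | hss
  · rw [max_eq_right hss] at hw hpos ⊢
    have h1 : ∀ z, ‖𝓕 T z‖ ≤ c' * wt (M + (N + 1)) s 0 z := fun z => (hTb (hc' y)).norm_le z
    have h2 : DerivBound k (wt M s₀ y₀) s₀ ψ d := hψf ▸ hd s₀ hs₀ y₀
    have := h2.sconv (𝓕 T) ψ hs hss hc0' h1
    rw [add_zero] at this
    exact this.mono_const hpos hw (le_add_of_nonneg_right (by positivity))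
  · rw [max_eq_left hss] at hw hpos ⊢
    have h1 : ∀ z, ‖ψ z‖ ≤ d' * wt (M + (N + 1)) s₀ y₀ z := fun z => by
      rw [hψf]; exact (hd' s₀ hs₀ y₀).norm_le z
    have := (hTb (hc y)).sconv ψ (𝓕 T) hs₀ hss hd0' h1
    rw [zero_add] at this
    have hcomm : sconv ψ (𝓕 T) = sconv (𝓕 T) ψ := by
      have : 𝓕 (sconv ψ (𝓕 T)) = 𝓕 (sconv (𝓕 T) ψ) := by
        ext ξ
        rw [fourier_sconv_apply, fourier_sconv_apply, mul_comm]
      simpa using congrArg (fun g : 𝓢(RN N, ℂ) => 𝓕⁻ g) this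
    rw [hcomm] at this
    exact this.mono_const hpos hw (le_add_of_nonneg_left (by positivity))

end Reproducing

/-! ### Elliptic symbols -/

section EllipticSymbols

open scoped FourierTransform SchwartzMap LineDeriv Matrix

/-- The Fourier multiplier `2 π i ξ_i` of the partial derivative `∂_i`. -/
def fmul (ξ : RN N) (i : Fin N) : ℂ := 2 * Real.pi * Complex.I * (ξ i : ℂ)

lemma fmul_smul (s : ℝ) (ξ : RN N) (i : Fin N) : fmul (s • ξ) i = s * fmul ξ i := by
  simp only [fmul, PiLp.smul_apply, smul_eq_mul, Complex.ofReal_mul]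
  ring

lemma contDiff_fmul (i : Fin N) : ContDiff ℝ (⊤ : ℕ∞) fun ξ : RN N => fmul ξ i :=
  contDiff_const.mul (Complex.ofRealCLM.contDiff.comp (EuclideanSpace.proj (𝕜 := ℝ) i).contDiff)

/-- Iterated partial derivatives of a Schwartz function. -/
def schwPd (f : 𝓢(RN N, ℂ)) : List (Fin N) → 𝓢(RN N, ℂ)
  | [] => f
  | i :: I => ∂_{(EuclideanSpace.single i (1 : ℝ) : RN N)} (schwPd f I)

lemma coe_schwPd (f : 𝓢(RN N, ℂ)) (I : List (Fin N)) : (schwPd f I : RN N → ℂ) = pdList I f := by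
  induction I with
  | nil => rfl
  | cons i I ih =>
    rw [schwPd, ← pd_schwartz, ih]
    rfl

lemma fourier_schwPd (f : 𝓢(RN N, ℂ)) (I : List (Fin N)) (ξ : RN N) :
    𝓕 (schwPd f I) ξ = (I.map (fmul ξ)).prod * 𝓕 f ξ := by
  induction I with
  | nil => simp [schwPd]
  | cons i I ih =>
    rw [schwPd, fourier_pd_apply, ih, List.map_cons, List.prod_cons, fmul]
    ring

lemma symFam_div {P Q : RN N × RN N → ℂ} (hP : ContDiff ℝ (⊤ : ℕ∞) P)
    (hQ : ContDiff ℝ (⊤ : ℕ∞) Q) {χ : RN N → ℝ} (hχ : ContDiff ℝ (⊤ : ℕ∞) χ)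
    (hχs : HasCompactSupport χ) (h0 : ∀ y ∈ tsupport χ, ∀ ξ ≠ 0, Q (y, ξ) ≠ 0) :
    SymFam fun y ξ => (χ y * radCut ξ : ℝ) * (P (y, ξ) / Q (y, ξ)) := by
  have hc : ContDiff ℝ (⊤ : ℕ∞) fun q : RN N × RN N => ((χ q.1 * radCut q.2 : ℝ) : ℂ) :=
    Complex.ofRealCLM.contDiff.comp
      ((hχ.comp contDiff_fst).mul (contDiff_radCut.comp contDiff_snd))
  constructor
  · rw [contDiff_iff_contDiffAt]
    rintro ⟨y, ξ⟩
    by_cases hy : y ∈ tsupport χ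
    · by_cases hξ : ξ = 0
      · refine (contDiffAt_const (c := (0 : ℂ))).congr_of_eventuallyEq ?_
        have : ∀ᶠ q : RN N × RN N in 𝓝 (y, ξ), ‖q.2‖ < 1 :=
          (continuous_snd.norm.tendsto (y, ξ)).eventually_lt_const (by simp [hξ])
        filter_upwards [this] with q hq
        simp [radCut_of_norm_lt hq]
      · have hne := h0 y hy ξ hξ
        simp only [div_eq_mul_inv]
        exact hc.contDiffAt.mul (hP.contDiffAt.mul (hQ.contDiffAt.inv hne))
    · refine (contDiffAt_const (c := (0 : ℂ))).congr_of_eventuallyEq ?_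
      have h1 : χ =ᶠ[𝓝 y] 0 := notMem_tsupport_iff_eventuallyEq.1 hy
      have h2 : ∀ᶠ q : RN N × RN N in 𝓝 (y, ξ), χ q.1 = 0 :=
        (continuous_fst.tendsto (y, ξ)).eventually h1
      filter_upwards [h2] with q hq
      simp [hq]
  · refine HasCompactSupport.intro (hχs.isCompact.prod (isCompact_closedBall (0 : RN N) 2)) ?_
    rintro ⟨y, ξ⟩ hq
    rw [Set.mem_prod, not_and_or] at hq
    rcases hq with hq | hq
    · simp [image_eq_zero_of_notMem_tsupport hq]
    · have : 2 < ‖ξ‖ := by simpa using hq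
      simp [radCut_of_lt_norm this]

variable {m n₁ n₂ : ℕ}

/-- The Fourier symbol of the principal part of an operator with coefficients `b`. -/
def fsym (b : (Fin N → ℕ) → RN N → Matrix (Fin n₂) (Fin n₁) ℂ) (m : ℕ) (q : RN N × RN N) :
    Matrix (Fin n₂) (Fin n₁) ℂ :=
  ∑ α ∈ idxEq N m, (∏ i, fmul q.2 i ^ α i) • b α q.1

variable {b : (Fin N → ℕ) → RN N → Matrix (Fin n₂) (Fin n₁) ℂ}

lemma mOrder_eq_of_mem {α : Fin N → ℕ} (h : α ∈ idxEq N m) : mOrder α = m :=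
  (Finset.mem_filter.1 h).2

lemma fsym_smul (s : ℝ) (y ξ : RN N) : fsym b m (y, s • ξ) = (s : ℂ) ^ m • fsym b m (y, ξ) := by
  simp only [fsym, Finset.smul_sum]
  refine Finset.sum_congr rfl fun α hα => ?_
  rw [smul_smul]
  congr 1
  simp only [fmul_smul, mul_pow]
  rw [Finset.prod_mul_distrib, Finset.prod_pow_eq_pow_sum, ← mOrder_eq_of_mem hα]
  rfl

lemma fsym_eq (y ξ : RN N) : fsym b m (y, ξ) = (2 * Real.pi * Complex.I) ^ m •
    ∑ α ∈ idxEq N m, (∏ i, ((ξ i : ℝ) : ℂ) ^ α i) • b α y := by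
  simp only [fsym, Finset.smul_sum]
  refine Finset.sum_congr rfl fun α hα => ?_
  rw [smul_smul]
  congr 1
  simp only [fmul, mul_pow]
  simp only [← mul_pow]
  simp only [mul_pow _ (((ξ _ : ℝ)) : ℂ)]
  rw [Finset.prod_mul_distrib, Finset.prod_pow_eq_pow_sum, ← mOrder_eq_of_mem hα]
  rfl

lemma contDiff_fsym (hb : ∀ α ∈ idxEq N m, ∀ i j, ContDiff ℝ (⊤ : ℕ∞) fun x => b α x i j)
    (i : Fin n₂) (j : Fin n₁) : ContDiff ℝ (⊤ : ℕ∞) fun q => fsym b m q i j := by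
  simp only [fsym, Matrix.sum_apply, Matrix.smul_apply, smul_eq_mul]
  refine ContDiff.sum fun α hα => ContDiff.mul ?_ ((hb α hα i j).comp contDiff_fst)
  exact contDiff_prod fun i _ => ((contDiff_fmul i).comp contDiff_snd).pow _

open scoped ComplexOrder in
lemma Elliptic.det_ne_zero {W : Set (RN N)} (h : Elliptic b m W) {y ξ : RN N} (hy : y ∈ W)
    (hξ : ξ ≠ 0) : ((fsym b m (y, ξ))ᴴ * fsym b m (y, ξ)).det ≠ 0 := by
  intro hdet
  obtain ⟨v, hv, hv0⟩ := Matrix.exists_mulVec_eq_zero_iff.2 hdet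
  rw [Matrix.conjTranspose_mul_self_mulVec_eq_zero, fsym_eq, Matrix.smul_mulVec,
    smul_eq_zero_iff_right (pow_ne_zero _ (by simp [Real.pi_ne_zero]))] at hv0
  exact hv (h y hy ξ hξ (by simpa using hv0))

lemma contDiff_matrix_det {E : Type*} [NormedAddCommGroup E] [NormedSpace ℝ E] {n : ℕ}
    {A : E → Matrix (Fin n) (Fin n) ℂ} (hA : ∀ i j, ContDiff ℝ (⊤ : ℕ∞) fun q => A q i j) :
    ContDiff ℝ (⊤ : ℕ∞) fun q => (A q).det := by
  simp only [Matrix.det_apply']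
  exact ContDiff.sum fun σ _ => contDiff_const.mul (contDiff_prod fun i _ => hA _ _)

lemma contDiff_matrix_adjugate {E : Type*} [NormedAddCommGroup E] [NormedSpace ℝ E] {n : ℕ}
    {A : E → Matrix (Fin n) (Fin n) ℂ} (hA : ∀ i j, ContDiff ℝ (⊤ : ℕ∞) fun q => A q i j)
    (i j : Fin n) : ContDiff ℝ (⊤ : ℕ∞) fun q => (A q).adjugate i j := by
  simp only [Matrix.adjugate_apply]
  refine contDiff_matrix_det fun k l => ?_
  simp only [Matrix.updateRow_apply]
  split_ifs
  · exact contDiff_const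
  · exact hA k l

lemma contDiff_matrix_mul {E : Type*} [NormedAddCommGroup E] [NormedSpace ℝ E] {n k l : ℕ}
    {A : E → Matrix (Fin n) (Fin k) ℂ} {B : E → Matrix (Fin k) (Fin l) ℂ}
    (hA : ∀ i j, ContDiff ℝ (⊤ : ℕ∞) fun q => A q i j)
    (hB : ∀ i j, ContDiff ℝ (⊤ : ℕ∞) fun q => B q i j) (i : Fin n) (j : Fin l) :
    ContDiff ℝ (⊤ : ℕ∞) fun q => (A q * B q) i j := by
  simp only [Matrix.mul_apply]
  exact ContDiff.sum fun a _ => (hA i a).mul (hB a j)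

lemma Elliptic.exists_symbol {W : Set (RN N)} (hell : Elliptic b m W)
    (hb : ∀ α ∈ idxEq N m, ∀ i j, ContDiff ℝ (⊤ : ℕ∞) fun x => b α x i j)
    {χ : RN N → ℝ} (hχ : ContDiff ℝ (⊤ : ℕ∞) χ) (hχs : HasCompactSupport χ)
    (hχW : tsupport χ ⊆ W) (I : List (Fin N)) (hI : I.length + 1 = m) (l : Fin n₁) :
    ∃ Θ : Fin n₂ → RN N → RN N → ℂ, (∀ k, SymFam (Θ k)) ∧ ∀ y, χ y = 1 → ∀ s : ℝ, 0 < s →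
      ∀ ξ : RN N, ξ ≠ 0 → ∀ v : Fin n₁ → ℂ,
        ∑ k, Θ k y (s • ξ) * (fsym b m (y, ξ) *ᵥ v) k
          = ((s⁻¹ * radCut (s • ξ) : ℝ) : ℂ) * ((I.map (fmul ξ)).prod * v l) := by
  set S : RN N × RN N → Matrix (Fin n₂) (Fin n₁) ℂ := fsym b m with hS
  have hSc : ∀ i j, ContDiff ℝ (⊤ : ℕ∞) fun q => S q i j := contDiff_fsym hb
  have hSh : ∀ i j, ContDiff ℝ (⊤ : ℕ∞) fun q => (S q)ᴴ i j := fun i j => by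
    simp only [Matrix.conjTranspose_apply]
    exact Complex.conjCLE.contDiff.comp (hSc j i)
  set G : RN N × RN N → Matrix (Fin n₁) (Fin n₂) ℂ :=
    fun q => ((S q)ᴴ * S q).adjugate * (S q)ᴴ with hG
  have hGc : ∀ i j, ContDiff ℝ (⊤ : ℕ∞) fun q => G q i j :=
    contDiff_matrix_mul (contDiff_matrix_adjugate (contDiff_matrix_mul hSh hSc)) hSh
  have hGS : ∀ q, G q * S q = ((S q)ᴴ * S q).det • (1 : Matrix (Fin n₁) (Fin n₁) ℂ) := fun q => by
    rw [hG, Matrix.mul_assoc, Matrix.adjugate_mul]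
  have hIc : ContDiff ℝ (⊤ : ℕ∞) fun q : RN N × RN N => (I.map (fmul q.2)).prod := by
    clear hI
    induction I with
    | nil => exact contDiff_const
    | cons i I ih =>
      simp only [List.map_cons, List.prod_cons]
      exact ((contDiff_fmul i).comp contDiff_snd).mul ih
  refine ⟨fun k y ξ => (χ y * radCut ξ : ℝ) * (((I.map (fmul ξ)).prod * G (y, ξ) l k)
    / ((S (y, ξ))ᴴ * S (y, ξ)).det), fun k => ?_, ?_⟩
  · exact symFam_div (P := fun q => (I.map (fmul q.2)).prod * G q l k)
      (Q := fun q => ((S q)ᴴ * S q).det) (hIc.mul (hGc l k))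
      (contDiff_matrix_det (contDiff_matrix_mul hSh hSc)) hχ hχs
      fun y hy ξ hξ => hell.det_ne_zero (hχW hy) hξ
  · intro y hy s hs ξ hξ v
    have hyW : y ∈ W := hχW (subset_tsupport _ (by simp [hy]))
    have hsξ : s • ξ ≠ 0 := smul_ne_zero hs.ne' hξ
    have hdet := hell.det_ne_zero hyW hsξ
    have hsc : (s : ℂ) ≠ 0 := by exact_mod_cast hs.ne'
    have hSv : S (y, ξ) *ᵥ v = ((s : ℂ) ^ m)⁻¹ • (S (y, s • ξ) *ᵥ v) := by
      rw [hS, fsym_smul, Matrix.smul_mulVec, smul_smul,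
        inv_mul_cancel₀ (pow_ne_zero _ hsc), one_smul]
    have hGv : ∑ k, G (y, s • ξ) l k * (S (y, s • ξ) *ᵥ v) k
        = ((S (y, s • ξ))ᴴ * S (y, s • ξ)).det * v l := by
      have : (G (y, s • ξ) *ᵥ (S (y, s • ξ) *ᵥ v)) l
          = ((S (y, s • ξ))ᴴ * S (y, s • ξ)).det * v l := by
        rw [Matrix.mulVec_mulVec, hGS, Matrix.smul_mulVec, Matrix.one_mulVec]
        rfl
      rw [← this]
      rfl
    have hIs : (I.map (fmul (s • ξ))).prod = (s : ℂ) ^ I.length * (I.map (fmul ξ)).prod := by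
      clear hI hIc
      induction I with
      | nil => simp
      | cons i I ih =>
        simp only [List.map_cons, List.prod_cons, List.length_cons, fmul_smul, ih]
        ring
    rw [hSv]
    simp only [Pi.smul_apply, smul_eq_mul, hy, one_mul]
    set D := ((S (y, s • ξ))ᴴ * S (y, s • ξ)).det with hD
    calc ∑ k, (radCut (s • ξ) : ℂ) * ((I.map (fmul (s • ξ))).prod * G (y, s • ξ) l k / D)
          * (((s : ℂ) ^ m)⁻¹ * (S (y, s • ξ) *ᵥ v) k)
        = (radCut (s • ξ) : ℂ) * (I.map (fmul (s • ξ))).prod / D * ((s : ℂ) ^ m)⁻¹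
          * ∑ k, G (y, s • ξ) l k * (S (y, s • ξ) *ᵥ v) k := by
          rw [Finset.mul_sum]
          refine Finset.sum_congr rfl fun k _ => ?_
          ring
      _ = _ := by
          rw [hGv, hIs, ← hI, pow_succ]
          push_cast
          field_simp

/-- The `k`-th component of the principal part with coefficients frozen at `y`. -/
def frozen (b : (Fin N → ℕ) → RN N → Matrix (Fin n₂) (Fin n₁) ℂ) (m : ℕ) (y : RN N)
    (U : Fin n₁ → RN N → ℂ) (k : Fin n₂) : RN N → ℂ :=
  fun x => ∑ α ∈ idxEq N m, ∑ l, b α y k l * pdList (multiList α) (U l) x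

lemma Elliptic.exists_reproducing (hN : N ≠ 0) {φ : RN N → ℝ} (hφ : GoodPhi φ) {W : Set (RN N)}
    (hell : Elliptic b m W)
    (hb : ∀ α ∈ idxEq N m, ∀ i j, ContDiff ℝ (⊤ : ℕ∞) fun x => b α x i j)
    {χ : RN N → ℝ} (hχ : ContDiff ℝ (⊤ : ℕ∞) χ) (hχs : HasCompactSupport χ)
    (hχW : tsupport χ ⊆ W) (I : List (Fin N)) (hI : I.length + 1 = m) (l : Fin n₁) (k M : ℕ) :
    ∃ C, 0 ≤ C ∧ ∀ y₀, χ y₀ = 1 → ∀ s₀, 0 < s₀ → ∃ g : ℝ → Fin n₂ → RN N → ℂ,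
      (∀ s, 0 < s → ∀ j, ContDiff ℝ (⊤ : ℕ∞) (g s j) ∧
        DerivBound k (wt M (max s s₀) y₀) (max s s₀) (g s j) C) ∧
      ∀ U : Fin n₁ → RN N → ℂ, (∀ i, ContDiff ℝ (⊤ : ℕ∞) (U i)) → (∀ i, HasCompactSupport (U i)) →
        ENNReal.ofReal ‖convAt φ s₀ (pdList I (U l)) y₀‖ ≤ ∫⁻ s in Ioi (0 : ℝ),
          ENNReal.ofReal ‖∑ j, ∫ y, g s j y * frozen b m y₀ U j y‖ := by
  obtain ⟨Θ, hΘ, hrep⟩ := hell.exists_symbol hb hχ hχs hχW I hI l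
  choose c hc0 hc using fun j => (hΘ j).exists_derivBound_sconv hφ k M
  have hcs : ∀ j, c j ≤ ∑ j, c j := fun j =>
    Finset.single_le_sum (fun i _ => hc0 i) (Finset.mem_univ j)
  refine ⟨∑ j, c j, Finset.sum_nonneg fun j _ => hc0 j, fun y₀ hy₀ s₀ hs₀ => ?_⟩
  have hT : ∀ s : ℝ, ∀ j, ∃ T : 𝓢(RN N, ℂ), 0 < s → ∀ ξ, T ξ = Θ j y₀ (s • ξ) := by
    intro s j
    by_cases hs : 0 < s
    · have h1 : HasCompactSupport fun ξ => Θ j y₀ (s • ξ) :=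
        ((hΘ j).compact_slice y₀).comp_smul hs.ne'
      have h2 : ContDiff ℝ (⊤ : ℕ∞) fun ξ => Θ j y₀ (s • ξ) :=
        ((hΘ j).smooth_slice y₀).comp (contDiff_const_smul s)
      exact ⟨h1.toSchwartzMap h2, fun _ _ => rfl⟩
    · exact ⟨0, fun h => absurd h hs⟩
  choose T hT using hT
  set ψ : 𝓢(RN N, ℂ) :=
    (hφ.dil_sub_hasCompactSupport hs₀ y₀).toSchwartzMap (hφ.dil_sub_smooth s₀ y₀) with hψ
  have hψa : ∀ z, ψ z = (dil φ s₀ (y₀ - z) : ℂ) := fun z => rfl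
  refine ⟨fun s j => sconv (𝓕 (T s j)) ψ, fun s hs j => ⟨SchwartzMap.smooth _ _, ?_⟩, ?_⟩
  · exact (hc j y₀ y₀ s s₀ hs hs₀ (T s j) ψ (hT s j hs) hψa).mono_const
      (hs.trans_le (le_max_left _ _)) (fun z => (wt_pos (hs.trans_le (le_max_left _ _)) _ _).le)
      (hcs j)
  · intro U hU hUs
    set f : Fin n₁ → 𝓢(RN N, ℂ) := fun i => (hUs i).toSchwartzMap (hU i) with hf
    have hfU : ∀ i, (f i : RN N → ℂ) = U i := fun i => rfl
    set w : Fin n₂ → 𝓢(RN N, ℂ) := fun j =>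
      ∑ α ∈ idxEq N m, ∑ l, b α y₀ j l • schwPd (f l) (multiList α) with hw
    have hwf : ∀ j x, w j x = frozen b m y₀ U j x := by
      intro j x
      simp only [hw, frozen, sum_apply, smul_apply, coe_schwPd, hfU, smul_eq_mul]
    have hFw : ∀ j ξ, 𝓕 (w j) ξ = (fsym b m (y₀, ξ) *ᵥ fun i => 𝓕 (f i) ξ) j := by
      intro j ξ
      have e1 : 𝓕 (w j) = ∑ α ∈ idxEq N m, ∑ l, b α y₀ j l • 𝓕 (schwPd (f l) (multiList α)) := by
        change FourierTransform.fourierCLM ℂ 𝓢(RN N, ℂ) (w j) = _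
        simp only [hw, map_sum, map_smul]
        rfl
      rw [e1]
      simp only [sum_apply, smul_apply, smul_eq_mul, fourier_schwPd, prod_map_multiList,
        fsym, Matrix.mulVec, dotProduct, Matrix.sum_apply, Matrix.smul_apply, Finset.sum_mul]
      rw [Finset.sum_comm]
      exact Finset.sum_congr rfl fun _ _ => Finset.sum_congr rfl fun _ _ => by ring
    have hmain := enorm_integral_mul_le_of_symbol hN ψ (schwPd (f l) I) w T
      fun s hs ξ hξ => by
        simp only [hT s _ hs, hFw, fourier_schwPd]
        exact hrep y₀ hy₀ s hs ξ hξ _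
    rw [convAt_eq_integral_mul]
    simp only [coe_schwPd, hfU, hψa, hwf] at hmain
    exact hmain

end EllipticSymbols

/-! ### Frozen coefficients and test functions -/

section Freezing

variable {m n₁ n₂ k M : ℕ} {φ : RN N → ℝ} {r c B ρ : ℝ} {y₀ : RN N} {f G v : RN N → ℂ}
  {b : (Fin N → ℕ) → RN N → Matrix (Fin n₂) (Fin n₁) ℂ}

/-- Integration by parts against a compactly supported function. -/
lemma integral_mul_pd (hf : ContDiff ℝ (⊤ : ℕ∞) f) (hfs : HasCompactSupport f)
    (hv : ContDiff ℝ (⊤ : ℕ∞) v) (i : Fin N) :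
    ∫ y, f y * pd i v y = -∫ y, pd i f y * v y := by
  have h1 : Continuous (pd i f) := (hf.pd i).continuous
  have h2 : Continuous (pd i v) := (hv.pd i).continuous
  refine integral_mul_fderiv_eq_neg_fderiv_mul_of_integrable ?_ ?_ ?_
    (fun y _ => hf.differentiable (by simp) y) (fun y _ => hv.differentiable (by simp) y)
  · exact (h1.mul hv.continuous).integrable_of_hasCompactSupport (hfs.pd i).mul_right
  · exact (hf.continuous.mul h2).integrable_of_hasCompactSupport hfs.mul_right
  · exact (hf.continuous.mul hv.continuous).integrable_of_hasCompactSupport hfs.mul_right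

lemma wt_succ_le (hr : 0 < r) (y₀ y : RN N) : wt (M + 1) r y₀ y ≤ wt M r y₀ y := by
  rw [add_comm, ← wt_add_mul (M := 1) hr M y₀ y]
  refine le_mul_of_one_le_right (wt_pos hr _ _).le (one_le_pow₀ ?_)
  have : 0 ≤ ‖y - y₀‖ / r := by positivity
  linarith

/-- The increments of a function with bounded derivatives gain a factor `r` on the scale `r`. -/
lemma DerivBound.sub_apply (hr : 0 < r) (hr1 : r ≤ 1) (hB : 0 ≤ B) (hf : ContDiff ℝ (⊤ : ℕ∞) f)
    (h : DerivBound (k + 1) (fun _ => 1) 1 f B) (y₀ : RN N) :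
    DerivBound k (fun y => 1 + ‖y - y₀‖ / r) r (fun y => f y₀ - f y) ((N + 1) * B * r) := by
  have h0 : ∀ y, 0 ≤ ‖y - y₀‖ / r := fun y => by positivity
  have hval : ∀ y, ‖f y₀ - f y‖ ≤ (N + 1) * B * r * (1 + ‖y - y₀‖ / r) := by
    intro y
    have h1 := norm_sub_le_of_pd hf hB convex_univ
      (fun x _ i => by simpa using (h.2 i).norm_le x) (mem_univ y₀) (mem_univ y)
    rw [norm_sub_rev]
    have h2 : (N + 1) * B * r * (‖y - y₀‖ / r) = (N + 1) * B * ‖y - y₀‖ := by field_simp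
    have h3 : 0 ≤ (N + 1) * B * r := by positivity
    have h4 : 0 ≤ B * ‖y - y₀‖ := by positivity
    rw [mul_add, h2]
    linarith
  cases k with
  | zero => exact hval
  | succ k =>
    refine ⟨hval, fun i => ?_⟩
    have h1 : pd i (fun y => f y₀ - f y) = fun y => (-1) * pd i f y := by
      rw [pd_sub contDiff_const hf]
      funext y
      simp [pd]
    rw [h1]
    have h2 := ((h.2 i).of_succ.mono_radius hr hr1 (by positivity) (fun _ => zero_le_one)).const_mul
      (hf.pd i) (-1)
    refine h2.mono hr fun y => ?_
    have h3 : (N + 1) * B * r / r = (N + 1) * B := by field_simp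
    rw [h3]
    simp only [norm_neg, norm_one, one_mul, div_one, mul_one]
    have h4 : 0 ≤ (N + 1) * B * (‖y - y₀‖ / r) := mul_nonneg (by positivity) (h0 y)
    have h5 : 0 ≤ N * B := by positivity
    linarith

lemma IsTest.of_derivBound (hr : 0 < r) (hc : 0 ≤ c) (hG : ContDiff ℝ (⊤ : ℕ∞) G)
    (hGs : HasCompactSupport G)
    (h : DerivBound (testOrder N M + 1) (wt (testDecay N M + 1) r y₀) r G c) :
    IsTest M r y₀ G c :=
  ⟨hG, hGs, hc, h.of_succ.mono hr fun y => mul_le_mul_of_nonneg_left (wt_succ_le hr y₀ y) hc⟩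

lemma IsTest.mul_coeff (hr : 0 < r) (hr1 : r ≤ 1) (hB : 0 ≤ B) (hf : ContDiff ℝ (⊤ : ℕ∞) f)
    (hfB : DerivBound (testOrder N M) (fun _ => 1) 1 f B) (h : IsTest M r y₀ G c) :
    IsTest M r y₀ (fun y => f y * G y) (2 ^ testOrder N M * (B * c)) := by
  have hc := h.nonneg
  refine ⟨hf.mul h.smooth, h.compact.mul_left, by positivity, ?_⟩
  simpa only [one_mul] using (hfB.mono_radius hr hr1 hB fun _ => zero_le_one).mul hr hf h.smooth hB
    h.nonneg (fun _ => zero_le_one) (fun y => (wt_pos hr _ _).le) h.bound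

lemma IsTest.pd_sub_mul (hr : 0 < r) (hr1 : r ≤ 1) (hB : 0 ≤ B) (hf : ContDiff ℝ (⊤ : ℕ∞) f)
    (hfB : DerivBound (testOrder N M + 2) (fun _ => 1) 1 f B) (hc : 0 ≤ c)
    (hG : ContDiff ℝ (⊤ : ℕ∞) G) (hGs : HasCompactSupport G)
    (h : DerivBound (testOrder N M + 1) (wt (testDecay N M + 1) r y₀) r G c) (i : Fin N) :
    IsTest M r y₀ (pd i fun y => (f y₀ - f y) * G y)
      (2 ^ (testOrder N M + 1) * ((N + 1) * B * c)) := by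
  have hs : ContDiff ℝ (⊤ : ℕ∞) fun y => (f y₀ - f y) * G y := (contDiff_const.sub hf).mul hG
  have h1 := (hfB.sub_apply hr hr1 hB hf y₀).mul hr (contDiff_const.sub hf) hG (by positivity) hc
    (fun y => by positivity) (fun y => (wt_pos hr _ _).le) h
  refine ⟨hs.pd i, HasCompactSupport.pd hGs.mul_left i, by positivity, ?_⟩
  refine (h1.2 i).mono hr fun y => ?_
  refine le_of_eq ?_
  rw [← wt_add_mul (M := 1) hr (testDecay N M) y₀ y, pow_one, add_comm 1 (testDecay N M)]
  field_simp

/-- All coefficients are smooth with bounded derivatives. -/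
structure TameCoeff (b : (Fin N → ℕ) → RN N → Matrix (Fin n₂) (Fin n₁) ℂ) (m : ℕ) : Prop where
  smooth : ∀ α ∈ idxLe N m, ∀ i j, ContDiff ℝ (⊤ : ℕ∞) fun x => b α x i j
  bound : ∀ k, ∀ α ∈ idxLe N m, ∀ i j, ∃ c, 0 ≤ c ∧
    DerivBound k (fun _ => 1) 1 (fun x => b α x i j) c

lemma TameCoeff.exists_bound (hb : TameCoeff b m) (k : ℕ) : ∃ B, 0 ≤ B ∧
    ∀ α ∈ idxLe N m, ∀ i j, DerivBound k (fun _ => 1) 1 (fun x => b α x i j) B := by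
  choose c hc0 hc using fun q : ↥(idxLe N m) × Fin n₂ × Fin n₁ => hb.bound k q.1 q.1.2 q.2.1 q.2.2
  refine ⟨∑ q, c q, Finset.sum_nonneg fun q _ => hc0 q, fun α hα i j => ?_⟩
  exact (hc (⟨α, hα⟩, i, j)).mono_const one_pos (fun _ => zero_le_one)
    (Finset.single_le_sum (fun q _ => hc0 q) (Finset.mem_univ _))

lemma mem_idxLe {α : Fin N → ℕ} : α ∈ idxLe N m ↔ mOrder α ≤ m := by
  simp only [idxLe, Finset.mem_filter, Fintype.mem_piFinset, Finset.mem_range]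
  refine ⟨fun h => h.2, fun h => ⟨fun i => ?_, h⟩⟩
  have : α i ≤ mOrder α := Finset.single_le_sum (fun j _ => Nat.zero_le (α j)) (Finset.mem_univ i)
  omega

lemma mem_idxEq {α : Fin N → ℕ} : α ∈ idxEq N m ↔ mOrder α = m := by
  simp only [idxEq, Finset.mem_filter, Fintype.mem_piFinset, Finset.mem_range]
  refine ⟨fun h => h.2, fun h => ⟨fun i => ?_, h⟩⟩
  have : α i ≤ mOrder α := Finset.single_le_sum (fun j _ => Nat.zero_le (α j)) (Finset.mem_univ i)
  omega

lemma idxEq_subset_idxLe : idxEq N m ⊆ idxLe N m := fun _ h => mem_idxLe.2 (mem_idxEq.1 h).le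

/-- The `k`-th component of the full operator. -/
def fullOp (b : (Fin N → ℕ) → RN N → Matrix (Fin n₂) (Fin n₁) ℂ) (m : ℕ)
    (U : Fin n₁ → RN N → ℂ) (k : Fin n₂) : RN N → ℂ :=
  fun x => ∑ α ∈ idxLe N m, ∑ l, b α x k l * pdList (multiList α) (U l) x

lemma ContDiff.fullOp (hb : TameCoeff b m) {U : Fin n₁ → RN N → ℂ}
    (hU : ∀ l, ContDiff ℝ (⊤ : ℕ∞) (U l)) (j : Fin n₂) :
    ContDiff ℝ (⊤ : ℕ∞) (fullOp b m U j) :=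
  ContDiff.sum fun α hα => ContDiff.sum fun l _ => (hb.smooth α hα j l).mul ((hU l).pdList _)

lemma hasCompactSupport_fullOp {U : Fin n₁ → RN N → ℂ}
    (hUs : ∀ l, HasCompactSupport (U l)) (j : Fin n₂) : HasCompactSupport (fullOp b m U j) := by
  refine HasCompactSupport.of_support_subset_isCompact
    (isCompact_iUnion fun l => (hUs l).isCompact) fun x hx => ?_
  by_contra h
  simp only [mem_iUnion, not_exists] at h
  refine hx (Finset.sum_eq_zero fun α _ => Finset.sum_eq_zero fun l _ => ?_)
  rw [image_eq_zero_of_notMem_tsupport fun h' => h l (tsupport_pdList_subset _ _ h'), mul_zero]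

/-- The lists of fewer than `m` directions. -/
def dirLists (N m : ℕ) : Finset (List (Fin N)) := (List.finite_length_lt (Fin N) m).toFinset

lemma mem_dirLists {I : List (Fin N)} : I ∈ dirLists N m ↔ I.length < m := by
  simp [dirLists]

/-- The sum of the Peetre maximal functions of the derivatives of order less than `m`. -/
def derivSum (φ : RN N → ℝ) (M m : ℕ) (ρ : ℝ) (U : Fin n₁ → RN N → ℂ) (x : RN N) : ℝ≥0∞ :=
  ∑ I ∈ dirLists N m, ∑ l, peetre φ M ρ (pdList I (U l)) x

lemma peetre_le_derivSum {U : Fin n₁ → RN N → ℂ} {I : List (Fin N)} (hI : I.length < m)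
    (l : Fin n₁) (x : RN N) : peetre φ M ρ (pdList I (U l)) x ≤ derivSum φ M m ρ U x :=
  (Finset.single_le_sum (f := fun l => peetre φ M ρ (pdList I (U l)) x) (fun _ _ => zero_le)
    (Finset.mem_univ l)).trans
  (Finset.single_le_sum (f := fun I => ∑ l, peetre φ M ρ (pdList I (U l)) x) (fun _ _ => zero_le)
    (mem_dirLists.2 hI))

lemma frozen_eq_fullOp_add (b : (Fin N → ℕ) → RN N → Matrix (Fin n₂) (Fin n₁) ℂ) (m : ℕ)
    (y₀ : RN N) (U : Fin n₁ → RN N → ℂ) (j : Fin n₂) (x : RN N) :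
    frozen b m y₀ U j x = fullOp b m U j x + ∑ α ∈ idxLe N m, ∑ l,
      ((if α ∈ idxEq N m then b α y₀ j l else 0) - b α x j l) *
        pdList (multiList α) (U l) x := by
  simp only [frozen, fullOp, ← Finset.sum_add_distrib]
  rw [← Finset.sum_subset idxEq_subset_idxLe (fun α _ hα => by simp [hα])]
  refine Finset.sum_congr rfl fun α hα => Finset.sum_congr rfl fun l _ => ?_
  rw [if_pos hα]
  ring

/-- The error made by freezing one coefficient. -/
lemma ofReal_norm_integral_freeze_le (hφ : GoodPhi φ) (hr : 0 < r) (hrρ : r ≤ ρ) (hr1 : r ≤ 1)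
    (hB : 0 ≤ B) (hf : ContDiff ℝ (⊤ : ℕ∞) f)
    (hfB : DerivBound (testOrder N M + 2) (fun _ => 1) 1 f B) (hc : 0 ≤ c)
    (hG : ContDiff ℝ (⊤ : ℕ∞) G) (hGs : HasCompactSupport G)
    (h : DerivBound (testOrder N M + 1) (wt (testDecay N M + 1) r y₀) r G c) (hm : 1 ≤ m)
    {U : Fin n₁ → RN N → ℂ} (hU : ∀ l, ContDiff ℝ (⊤ : ℕ∞) (U l))
    (hUs : ∀ l, HasCompactSupport (U l)) {α : Fin N → ℕ} (hα : α ∈ idxLe N m) (l : Fin n₁)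
    (x : RN N) :
    ENNReal.ofReal ‖∫ y, G y * (((if α ∈ idxEq N m then f y₀ else 0) - f y) *
      pdList (multiList α) (U l) y)‖ ≤
      ENNReal.ofReal (testConst N M * (2 ^ (testOrder N M + 1) * ((N + 1) * B * c)) *
        (1 + ‖x - y₀‖ / r) ^ M) * derivSum φ M m ρ U x := by
  have hT := testConst_nonneg (N := N) (M := M)
  by_cases hαm : α ∈ idxEq N m
  · have hlen : (multiList α).length = m := by rw [length_multiList, mem_idxEq.1 hαm]
    obtain ⟨i, I, hI⟩ : ∃ i I, multiList α = i :: I :=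
      List.exists_cons_of_length_pos (by omega)
    have hIl : I.length < m := by rw [hI] at hlen; simp at hlen; omega
    have hV := (hU l).pdList I
    have h1 : ∫ y, G y * (((if α ∈ idxEq N m then f y₀ else 0) - f y) *
        pdList (multiList α) (U l) y) =
        -∫ y, pd i (fun y => (f y₀ - f y) * G y) y * pdList I (U l) y := by
      rw [← integral_mul_pd ((contDiff_const.sub hf).mul hG) hGs.mul_left hV, hI]
      refine integral_congr_ae (ae_of_all _ fun y => ?_)
      simp only [hαm, if_true, pdList]
      ring
    rw [h1, norm_neg]
    exact ((IsTest.pd_sub_mul hr hr1 hB hf hfB hc hG hGs h i).le_peetre hφ hr hrρ hV.continuous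
      ((hUs l).pdList I) x).trans (mul_le_mul_right (peetre_le_derivSum hIl l x) _)
  · have hlen : (multiList α).length < m := by
      rw [length_multiList]
      exact lt_of_le_of_ne (mem_idxLe.1 hα) fun h => hαm (mem_idxEq.2 h)
    have hV := (hU l).pdList (multiList α)
    have h1 : ∫ y, G y * (((if α ∈ idxEq N m then f y₀ else 0) - f y) *
        pdList (multiList α) (U l) y) =
        -∫ y, (f y * G y) * pdList (multiList α) (U l) y := by
      rw [← integral_neg]
      refine integral_congr_ae (ae_of_all _ fun y => ?_)
      simp only [hαm, if_false]
      ring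
    rw [h1, norm_neg]
    refine (((IsTest.of_derivBound hr hc hG hGs h).mul_coeff hr hr1 hB hf
      (hfB.of_le (by omega))).le_peetre hφ hr hrρ hV.continuous ((hUs l).pdList _) x).trans ?_
    refine mul_le_mul' (ENNReal.ofReal_le_ofReal ?_) (peetre_le_derivSum hlen l x)
    have h2 : B * c ≤ (N + 1) * B * c := by
      have : 0 ≤ N * (B * c) := by positivity
      linarith
    gcongr
    · norm_num
    · omega

/-- Testing the frozen operator costs the full operator and lower order derivatives. -/
lemma TameCoeff.exists_frozen_le (hb : TameCoeff b m) (hm : 1 ≤ m) (hφ : GoodPhi φ) (M : ℕ) :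
    ∃ C, 0 ≤ C ∧ ∀ (r ρ c : ℝ) (y₀ : RN N) (G : RN N → ℂ), 0 < r → r ≤ ρ → r ≤ 1 → 0 ≤ c →
      ContDiff ℝ (⊤ : ℕ∞) G → HasCompactSupport G →
      DerivBound (testOrder N M + 1) (wt (testDecay N M + 1) r y₀) r G c →
      ∀ U : Fin n₁ → RN N → ℂ, (∀ l, ContDiff ℝ (⊤ : ℕ∞) (U l)) →
        (∀ l, HasCompactSupport (U l)) → ∀ j x,
        ENNReal.ofReal ‖∫ y, G y * frozen b m y₀ U j y‖ ≤
          ENNReal.ofReal (C * c * (1 + ‖x - y₀‖ / r) ^ M) *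
            (∑ i, peetre φ M ρ (fullOp b m U i) x + derivSum φ M m ρ U x) := by
  obtain ⟨B, hB, hbB⟩ := hb.exists_bound (testOrder N M + 2)
  have hT := testConst_nonneg (N := N) (M := M)
  set D : ℝ := 2 ^ (testOrder N M + 1) * ((N + 1) * B) with hD
  have hD0 : 0 ≤ D := by positivity
  refine ⟨testConst N M * (1 + ((idxLe N m).card * n₁ : ℕ) * D), by positivity, ?_⟩
  intro r ρ c y₀ G hr hrρ hr1 hc hG hGs hGb U hU hUs j x
  set S := ∑ i, peetre φ M ρ (fullOp b m U i) x + derivSum φ M m ρ U x with hS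
  set Q : ℝ := (1 + ‖x - y₀‖ / r) ^ M with hQ
  have hQ0 : 0 ≤ Q := by positivity
  have hF := ContDiff.fullOp hb hU j
  have hint1 : Integrable fun y => G y * fullOp b m U j y :=
    (hG.continuous.mul hF.continuous).integrable_of_hasCompactSupport hGs.mul_right
  have hint2 : ∀ α ∈ idxLe N m, ∀ l, Integrable fun y => G y *
      (((if α ∈ idxEq N m then b α y₀ j l else 0) - b α y j l) *
        pdList (multiList α) (U l) y) := fun α hα l =>
    (hG.continuous.mul ((continuous_const.sub (hb.smooth α hα j l).continuous).mul
      ((hU l).pdList _).continuous)).integrable_of_hasCompactSupport hGs.mul_right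
  have hdec : ∫ y, G y * frozen b m y₀ U j y = (∫ y, G y * fullOp b m U j y) +
      ∑ α ∈ idxLe N m, ∑ l, ∫ y, G y *
        (((if α ∈ idxEq N m then b α y₀ j l else 0) - b α y j l) *
          pdList (multiList α) (U l) y) := by
    simp only [frozen_eq_fullOp_add, mul_add, Finset.mul_sum]
    rw [integral_add hint1 (integrable_finsetSum _ fun α hα => integrable_finsetSum _ fun l _ =>
      hint2 α hα l), integral_finsetSum _ fun α hα => integrable_finsetSum _ fun l _ =>
      hint2 α hα l]
    congr 1
    exact Finset.sum_congr rfl fun α hα => integral_finsetSum _ fun l _ => hint2 α hα l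
  have h1 : ENNReal.ofReal ‖∫ y, G y * fullOp b m U j y‖ ≤
      ENNReal.ofReal (testConst N M * c * Q) * S := by
    refine ((IsTest.of_derivBound hr hc hG hGs hGb).le_peetre hφ hr hrρ hF.continuous
      (hasCompactSupport_fullOp hUs j) x).trans (mul_le_mul_right ?_ _)
    exact (Finset.single_le_sum (f := fun i => peetre φ M ρ (fullOp b m U i) x)
      (fun _ _ => zero_le) (Finset.mem_univ j)).trans le_self_add
  have h2 : ∀ α ∈ idxLe N m, ∀ l, ENNReal.ofReal ‖∫ y, G y *
      (((if α ∈ idxEq N m then b α y₀ j l else 0) - b α y j l) *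
        pdList (multiList α) (U l) y)‖ ≤ ENNReal.ofReal (testConst N M * D * c * Q) * S := by
    intro α hα l
    refine (ofReal_norm_integral_freeze_le hφ hr hrρ hr1 hB (hb.smooth α hα j l) (hbB α hα j l) hc
      hG hGs hGb hm hU hUs hα l x).trans (mul_le_mul' (le_of_eq ?_) le_add_self)
    congr 1
    rw [hD]
    ring
  rw [hdec, ofReal_norm]
  calc _ ≤ ENNReal.ofReal (testConst N M * c * Q) * S + ∑ α ∈ idxLe N m, ∑ _l : Fin n₁,
        ENNReal.ofReal (testConst N M * D * c * Q) * S := by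
        refine (enorm_add_le _ _).trans (add_le_add (by rwa [← ofReal_norm]) ?_)
        refine (enorm_sum_le _ _).trans (Finset.sum_le_sum fun α hα => ?_)
        refine (enorm_sum_le _ _).trans (Finset.sum_le_sum fun l _ => ?_)
        rw [← ofReal_norm]
        exact h2 α hα l
    _ = _ := by
        simp only [Finset.sum_const, Finset.card_univ, Fintype.card_fin, smul_smul]
        rw [← Nat.cast_smul_eq_nsmul ℝ≥0∞, smul_eq_mul, ← ENNReal.ofReal_natCast, ← _root_.mul_assoc,
          ← ENNReal.ofReal_mul (by positivity), ← add_mul, ← ENNReal.ofReal_add (by positivity)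
          (by positivity)]
        congr 2
        ring

end Freezing

/-! ### Absorption of lower order derivatives -/

section Absorption

variable {m n₁ n₂ k M : ℕ} {φ : RN N → ℝ} {r s s₀ ρ : ℝ} {x₀ y₀ : RN N}
  {b : (Fin N → ℕ) → RN N → Matrix (Fin n₂) (Fin n₁) ℂ}

/-- The weight of the scale `s` in the reproducing formula localized to a ball of radius `ρ`. -/
def scaleWt (ρ s : ℝ) : ℝ := 4 * ρ ^ 2 / (ρ + s) ^ 2

lemma lintegral_scaleWt (hρ : 0 < ρ) :
    ∫⁻ s in Ioi (0 : ℝ), ENNReal.ofReal (scaleWt ρ s) = ENNReal.ofReal (4 * ρ) := by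
  have hd : ∀ s ∈ Ici (0 : ℝ), HasDerivAt (fun s => -(4 * ρ ^ 2 * (ρ + s)⁻¹)) (scaleWt ρ s) s := by
    intro s hs
    have hs0 : (0 : ℝ) ≤ s := hs
    have h0 : ρ + s ≠ 0 := by positivity
    have h1 := ((((hasDerivAt_id s).const_add ρ).inv h0).const_mul (4 * ρ ^ 2)).neg
    refine h1.congr_deriv ?_
    simp only [scaleWt, id]
    field_simp
  have hpos : ∀ s ∈ Ioi (0 : ℝ), 0 ≤ scaleWt ρ s := fun s _ => by unfold scaleWt; positivity
  have hlim : Tendsto (fun s => -(4 * ρ ^ 2 * (ρ + s)⁻¹)) atTop (𝓝 0) := by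
    have h1 : Tendsto (fun s : ℝ => (ρ + s)⁻¹) atTop (𝓝 0) :=
      tendsto_inv_atTop_zero.comp (tendsto_atTop_add_const_left _ _ tendsto_id)
    simpa using (h1.const_mul (4 * ρ ^ 2)).neg
  have hint := integrableOn_Ioi_deriv_of_nonneg' hd hpos hlim
  have hval := integral_Ioi_of_hasDerivAt_of_nonneg' hd hpos hlim
  rw [← ofReal_integral_eq_lintegral_ofReal hint
    ((ae_restrict_iff' measurableSet_Ioi).2 (ae_of_all _ hpos)), hval]
  congr 1
  field_simp
  ring

/-- The convolution at small scales vanishes away from the support. -/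
lemma GoodPhi.convAt_eq_zero (hφ : GoodPhi φ) {v : RN N → ℂ} {t : ℝ} (ht : 0 < t) (htr : t ≤ s)
    (hv : tsupport v ⊆ ball x₀ r) {y : RN N} (hy : y ∉ ball x₀ (r + s)) : convAt φ t v y = 0 := by
  rw [convAt]
  refine integral_eq_zero_of_ae (ae_of_all _ fun z => ?_)
  by_contra h
  simp only [Pi.zero_apply, smul_eq_zero, not_or] at h
  have h1 := hφ.norm_le_of_dil_ne_zero ht h.1
  have h2 : z ∈ ball x₀ r := hv (subset_tsupport _ h.2)
  refine hy ?_
  rw [mem_ball, dist_eq_norm] at h2 ⊢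
  calc ‖y - x₀‖ = ‖(z - x₀) + (y - z)‖ := by congr 1; abel
    _ ≤ ‖z - x₀‖ + ‖y - z‖ := norm_add_le _ _
    _ < r + s := by linarith

/-- Passing from a large scale `s` to the scale `ρ` for functions supported at distance `4 ρ`. -/
lemma wt_le_scaleWt (hN : 2 ≤ N) (hρ : 0 < ρ) (hs : ρ ≤ s) {y : RN N} (hy : ‖y - y₀‖ ≤ 4 * ρ) :
    wt M s y₀ y ≤ 5 ^ M * scaleWt ρ s * wt M ρ y₀ y := by
  have hs0 : 0 < s := hρ.trans_le hs
  have h1 : wt M s y₀ y ≤ 1 / s ^ N := by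
    unfold wt
    gcongr
    refine inv_le_one_of_one_le₀ (one_le_pow₀ ?_)
    have : 0 ≤ ‖y - y₀‖ / s := by positivity
    linarith
  have h2 : ((5 : ℝ) ^ M)⁻¹ / ρ ^ N ≤ wt M ρ y₀ y := by
    unfold wt
    gcongr
    have : ‖y - y₀‖ / ρ ≤ 4 := by rwa [div_le_iff₀ hρ]
    linarith
  have h3 : ρ ^ N / s ^ N ≤ scaleWt ρ s := by
    have h4 : ρ ^ N / s ^ N ≤ (ρ / s) ^ 2 := by
      rw [← div_pow]
      exact pow_le_pow_of_le_one (by positivity) (by rwa [div_le_one hs0]) hN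
    refine h4.trans ?_
    rw [div_pow, scaleWt, div_le_div_iff₀ (by positivity) (by positivity)]
    have h5 : (ρ + s) ^ 2 ≤ (2 * s) ^ 2 := by gcongr; linarith
    nlinarith [sq_nonneg ρ]
  calc wt M s y₀ y ≤ 1 / s ^ N := h1
    _ = 5 ^ M * (ρ ^ N / s ^ N) * (((5 : ℝ) ^ M)⁻¹ / ρ ^ N) := by field_simp
    _ ≤ 5 ^ M * scaleWt ρ s * wt M ρ y₀ y := by
        have : 0 ≤ scaleWt ρ s := by unfold scaleWt; positivity
        gcongr

/-- A bump function equal to one on `ball x₀ ρ` and supported in `closedBall x₀ (2 ρ)`, with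
scale-invariant derivative bounds. -/
lemma exists_bump_family (N k : ℕ) : ∃ c : ℝ, 0 ≤ c ∧ ∀ (x₀ : RN N) (ρ : ℝ), 0 < ρ →
    ∃ χ : RN N → ℂ, ContDiff ℝ (⊤ : ℕ∞) χ ∧ (∀ x ∈ ball x₀ ρ, χ x = 1) ∧
      tsupport χ ⊆ closedBall x₀ (2 * ρ) ∧ DerivBound k (fun _ => 1) ρ χ c := by
  let β : ContDiffBump (0 : RN N) := ⟨1, 2, one_pos, one_lt_two⟩
  have hβ : ContDiff ℝ (⊤ : ℕ∞) fun x => (β x : ℂ) := Complex.ofRealCLM.contDiff.comp β.contDiff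
  have hβs : HasCompactSupport fun x => (β x : ℂ) :=
    β.hasCompactSupport.comp_left (g := fun r : ℝ => (r : ℂ)) (by simp)
  obtain ⟨c, hc, h⟩ := DerivBound.of_hasCompactSupport hβ hβs k
  refine ⟨c, hc, fun x₀ ρ hρ => ⟨fun y => (β ((1 * ρ⁻¹) • (y - x₀)) : ℂ), ?_, ?_, ?_, ?_⟩⟩
  · exact hβ.comp ((contDiff_id.sub contDiff_const).const_smul _)
  · intro x hx
    have h1 : (1 * ρ⁻¹) • (x - x₀) ∈ closedBall (0 : RN N) β.rIn := by
      rw [mem_closedBall_zero_iff, norm_smul, one_mul, norm_inv, Real.norm_of_nonneg hρ.le,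
        inv_mul_le_iff₀ hρ, ← dist_eq_norm]
      simpa [β] using (mem_ball.1 hx).le
    simp only [β.one_of_mem_closedBall h1, Complex.ofReal_one]
  · refine closure_minimal (fun x hx => ?_) isClosed_closedBall
    have h1 : β ((1 * ρ⁻¹) • (x - x₀)) ≠ 0 := fun h => hx (by simp only [h, Complex.ofReal_zero])
    have h2 : (1 * ρ⁻¹) • (x - x₀) ∈ ball (0 : RN N) β.rOut := by
      rw [← β.support_eq]
      exact h1
    rw [mem_ball_zero_iff, norm_smul, one_mul, norm_inv, Real.norm_of_nonneg hρ.le,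
      inv_mul_lt_iff₀ hρ, ← dist_eq_norm] at h2
    rw [mem_closedBall]
    have : dist x x₀ < ρ * 2 := h2
    linarith
  · exact h.comp_smul_sub hβ hρ 1 (by simp) x₀

lemma frozen_eq_zero {U : Fin n₁ → RN N → ℂ} {K : Set (RN N)} (hU : ∀ l, tsupport (U l) ⊆ K)
    (j : Fin n₂) {y : RN N} (hy : y ∉ K) : frozen b m y₀ U j y = 0 :=
  Finset.sum_eq_zero fun α _ => Finset.sum_eq_zero fun l _ => by
    rw [image_eq_zero_of_notMem_tsupport fun h => hy (hU l (tsupport_pdList_subset _ _ h)), mul_zero]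

lemma hasCompactSupport_of_tsupport_subset_ball {f : RN N → ℂ} (h : tsupport f ⊆ ball x₀ r) :
    HasCompactSupport f :=
  (isCompact_closedBall x₀ r).of_isClosed_subset (isClosed_tsupport f)
    (h.trans ball_subset_closedBall)

/-- The derivatives of order `m - 1` of functions supported in a ball of radius `ρ` gain a
factor `ρ` over the full operator. -/
lemma Elliptic.exists_peetre_le (hN : 2 ≤ N) (hφ : GoodPhi φ) {W : Set (RN N)}
    (hell : Elliptic b m W) (hb : TameCoeff b m) {ρ₀ : ℝ} (hρ₀ : 0 < ρ₀) (hρ₁ : ρ₀ ≤ 1)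
    (hW : closedBall x₀ (3 * ρ₀) ⊆ W) (M : ℕ) (I : List (Fin N)) (hI : I.length + 1 = m)
    (l : Fin n₁) :
    ∃ C, 0 ≤ C ∧ ∀ ρ, 0 < ρ → ρ ≤ ρ₀ → ∀ U : Fin n₁ → RN N → ℂ,
      (∀ l, ContDiff ℝ (⊤ : ℕ∞) (U l)) → (∀ l, tsupport (U l) ⊆ ball x₀ ρ) → ∀ x,
      peetre φ M ρ (pdList I (U l)) x ≤ ENNReal.ofReal (C * ρ) *
        (∑ i, peetre φ M ρ (fullOp b m U i) x + derivSum φ M m ρ U x) := by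
  let β : ContDiffBump x₀ := ⟨2 * ρ₀, 3 * ρ₀, by positivity, by linarith⟩
  obtain ⟨Cg, hCg, hg⟩ := hell.exists_reproducing (χ := β) (by omega) hφ
    (fun α hα => hb.smooth α (idxEq_subset_idxLe hα)) β.contDiff β.hasCompactSupport
    (by rw [β.tsupport_eq]; exact hW) I hI l (testOrder N M + 1) (testDecay N M + 1)
  obtain ⟨cχ, hcχ, hχ⟩ := exists_bump_family N (testOrder N M + 1)
  obtain ⟨Ct, hCt, hfr⟩ := hb.exists_frozen_le (by omega) hφ M
  set K : ℝ := 2 ^ (testOrder N M + 1) * (cχ * Cg) * 5 ^ (testDecay N M + 1) with hK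
  have hK0 : 0 ≤ K := by positivity
  refine ⟨n₂ * (Ct * K) * 4, by positivity, fun ρ hρ hρρ U hU hUs x => ?_⟩
  obtain ⟨χ, hχ1, hχ2, hχ3, hχ4⟩ := hχ x₀ ρ hρ
  have hUc := fun l => hasCompactSupport_of_tsupport_subset_ball (hUs l)
  set S := ∑ i, peetre φ M ρ (fullOp b m U i) x + derivSum φ M m ρ U x with hS
  refine peetre_le fun s₀ hs₀ y₀ => ?_
  by_cases hy₀ : y₀ ∈ ball x₀ (ρ + ρ)
  swap
  · rw [hφ.convAt_eq_zero hs₀.1 hs₀.2.le ((tsupport_pdList_subset _ I).trans (hUs l)) hy₀]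
    simp
  have hs₀0 : 0 < s₀ := hs₀.1
  have hβ1 : β y₀ = 1 := β.one_of_mem_closedBall (by
    rw [mem_closedBall]
    have h1 : dist y₀ x₀ < ρ + ρ := hy₀
    have h2 : β.rIn = 2 * ρ₀ := rfl
    linarith)
  obtain ⟨g, hg1, hg2⟩ := hg y₀ hβ1 s₀ hs₀0
  have hχc : HasCompactSupport χ :=
    (isCompact_closedBall x₀ (2 * ρ)).of_isClosed_subset (isClosed_tsupport χ) hχ3
  have hloc : ∀ s j, ∫ y, g s j y * frozen b m y₀ U j y =
      ∫ y, (χ y * g s j y) * frozen b m y₀ U j y := by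
    intro s j
    refine integral_congr_ae (ae_of_all _ fun y => ?_)
    by_cases hy : y ∈ ball x₀ ρ
    · simp [hχ2 y hy]
    · simp [frozen_eq_zero hUs j hy]
  set Q : ℝ := (1 + ‖x - y₀‖ / s₀) ^ M with hQ
  have hQ0 : 0 ≤ Q := by positivity
  have hterm : ∀ s ∈ Ioi (0 : ℝ), ∀ j, ENNReal.ofReal ‖∫ y, g s j y * frozen b m y₀ U j y‖ ≤
      ENNReal.ofReal (scaleWt ρ s) * (ENNReal.ofReal (Ct * K * Q) * S) := by
    intro s hs j
    have hs0 : 0 < s := hs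
    obtain ⟨hgs, hgb⟩ := hg1 s hs0 j
    have hwpos : 0 ≤ scaleWt ρ s := by unfold scaleWt; positivity
    obtain ⟨r, hr0, hrρ, hGb⟩ : ∃ r, s₀ ≤ r ∧ r ≤ ρ ∧ DerivBound (testOrder N M + 1)
        (wt (testDecay N M + 1) r y₀) r (fun y => χ y * g s j y) (K * scaleWt ρ s) := by
      have hone : ∀ y : RN N, (0 : ℝ) ≤ (fun _ => (1 : ℝ)) y := fun _ => zero_le_one
      rcases lt_or_ge s ρ with hsρ | hsρ
      · have hr : 0 < max s s₀ := lt_max_of_lt_left hs0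
        have hr' : max s s₀ ≤ ρ := max_le hsρ.le hs₀.2.le
        refine ⟨max s s₀, le_max_right _ _, hr', ?_⟩
        have h1 := (hχ4.mono_radius hr hr' hcχ hone).mul hr hχ1 hgs hcχ hCg hone
          (fun y => (wt_pos hr _ _).le) hgb
        simp only [one_mul] at h1
        refine h1.mono_const hr (fun y => (wt_pos hr _ _).le) ?_
        have h2 : 1 ≤ scaleWt ρ s := by
          rw [scaleWt, one_le_div (by positivity)]
          nlinarith
        rw [hK, _root_.mul_assoc]
        refine le_mul_of_one_le_right (by positivity) ?_
        exact one_le_mul_of_one_le_of_one_le (one_le_pow₀ (by norm_num)) h2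
      · have hmax : max s s₀ = s := max_eq_left (hs₀.2.le.trans hsρ)
        rw [hmax] at hgb
        refine ⟨ρ, hs₀.2.le, le_rfl, ?_⟩
        have h1 := hχ4.mul hρ hχ1 hgs hcχ hCg hone (fun y => (wt_pos hs0 _ _).le)
          (hgb.mono_radius hρ hsρ hCg fun y => (wt_pos hs0 _ _).le)
        simp only [one_mul] at h1
        refine h1.mono_on hρ (fun y => mul_nonneg (by positivity) (wt_pos hρ _ _).le) fun y hy => ?_
        have h2 : ‖y - y₀‖ ≤ 4 * ρ := by
          have h3 : dist y x₀ ≤ 2 * ρ := hχ3 (tsupport_mul_subset_left hy)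
          have h4 : dist y₀ x₀ < ρ + ρ := hy₀
          rw [← dist_eq_norm]
          linarith [dist_triangle_right y y₀ x₀]
        refine (mul_le_mul_of_nonneg_left (wt_le_scaleWt hN hρ hsρ h2) (by positivity)).trans
          (le_of_eq ?_)
        rw [hK]
        ring
    have hr : 0 < r := hs₀0.trans_le hr0
    rw [hloc]
    refine (hfr r ρ _ y₀ _ hr hrρ (hrρ.trans (hρρ.trans hρ₁)) (by positivity) (hχ1.mul hgs)
      hχc.mul_right hGb U hU hUc j x).trans ?_
    have h5 : (1 + ‖x - y₀‖ / r) ^ M ≤ Q := by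
      rw [hQ]
      gcongr
    calc _ ≤ ENNReal.ofReal (scaleWt ρ s * (Ct * K * Q)) * S := by
          refine mul_le_mul_left (ENNReal.ofReal_le_ofReal ?_) _
          calc Ct * (K * scaleWt ρ s) * (1 + ‖x - y₀‖ / r) ^ M
              ≤ Ct * (K * scaleWt ρ s) * Q := by gcongr
            _ = _ := by ring
      _ = _ := by rw [ENNReal.ofReal_mul hwpos, _root_.mul_assoc]
  refine (hg2 U hU hUc).trans ?_
  calc ∫⁻ s in Ioi (0 : ℝ), ENNReal.ofReal ‖∑ j, ∫ y, g s j y * frozen b m y₀ U j y‖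
      ≤ ∫⁻ s in Ioi (0 : ℝ), ENNReal.ofReal (scaleWt ρ s) *
          (n₂ * (ENNReal.ofReal (Ct * K * Q) * S)) := by
        refine setLIntegral_mono' measurableSet_Ioi fun s hs => ?_
        rw [ofReal_norm]
        refine (enorm_sum_le _ _).trans ?_
        calc _ ≤ ∑ _j : Fin n₂, ENNReal.ofReal (scaleWt ρ s) *
              (ENNReal.ofReal (Ct * K * Q) * S) := by
              refine Finset.sum_le_sum fun j _ => ?_
              rw [← ofReal_norm]
              exact hterm s hs j
          _ = _ := by
              simp only [Finset.sum_const, Finset.card_univ, Fintype.card_fin, nsmul_eq_mul]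
              ring
    _ = ENNReal.ofReal (4 * ρ) * (n₂ * (ENNReal.ofReal (Ct * K * Q) * S)) := by
        rw [lintegral_mul_const, lintegral_scaleWt hρ]
        unfold scaleWt
        fun_prop
    _ = ENNReal.ofReal (4 * ρ * (n₂ * (Ct * K * Q))) * S := by
        rw [ENNReal.ofReal_mul (p := 4 * ρ) (by positivity),
          ENNReal.ofReal_mul (p := (n₂ : ℝ)) (by positivity), ENNReal.ofReal_natCast]
        ring
    _ = ENNReal.ofReal (Q * (n₂ * (Ct * K) * 4 * ρ)) * S := by
        congr 2
        ring
    _ = _ := by rw [ENNReal.ofReal_mul hQ0, _root_.mul_assoc]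

end Absorption

/-! ### The lower order derivatives are controlled by the full operator -/

section LowerOrder

variable {m n₁ n₂ k M : ℕ} {φ : RN N → ℝ} {ρ : ℝ} {x₀ : RN N}
  {b : (Fin N → ℕ) → RN N → Matrix (Fin n₂) (Fin n₁) ℂ}

lemma DerivBound.const (a : ℂ) {c : ℝ} (hc : ‖a‖ ≤ c) (k : ℕ) :
    DerivBound (N := N) k (fun _ => 1) 1 (fun _ => a) c := by
  induction k generalizing a c with
  | zero => exact fun y => by simpa using hc
  | succ k ih =>
    refine ⟨fun y => by simpa using hc, fun i => ?_⟩
    have h : pd i (fun _ : RN N => a) = fun _ => 0 := by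
      funext y
      simp [pd]
    rw [h]
    exact ih 0 (by simpa using (norm_nonneg a).trans hc)

/-- The coefficients of the gradient. -/
def gradCoeff (N : ℕ) (α : Fin N → ℕ) (_ : RN N) : Matrix (Fin N) (Fin 1) ℂ :=
  Matrix.of fun k _ => if α = Pi.single k 1 then 1 else 0

lemma mOrder_single (k : Fin N) : mOrder (Pi.single k 1) = 1 := by
  simp [mOrder]

lemma tameCoeff_gradCoeff (N : ℕ) : TameCoeff (gradCoeff N) 1 :=
  ⟨fun _ _ _ _ => contDiff_const, fun k α _ i j =>
    ⟨1, zero_le_one, DerivBound.const (gradCoeff N α 0 i j) (by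
      simp only [gradCoeff, Matrix.of_apply]
      split_ifs <;> simp) k⟩⟩

lemma elliptic_gradCoeff (N : ℕ) (W : Set (RN N)) : Elliptic (gradCoeff N) 1 W := by
  intro x _ ξ hξ w w' hw
  obtain ⟨k, hk⟩ : ∃ k, ξ k ≠ 0 := by
    by_contra! h
    exact hξ (PiLp.ext h)
  have key : ∀ w : Fin 1 → ℂ, (∑ α ∈ idxEq N 1, (∏ i, ((ξ i : ℝ) : ℂ) ^ α i) •
      gradCoeff N α x).mulVec w k = ξ k * w 0 := by
    intro w
    rw [Matrix.mulVec, dotProduct, Fin.sum_univ_one, Matrix.sum_apply,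
      Finset.sum_eq_single (Pi.single k 1)]
    · rw [Matrix.smul_apply, Finset.prod_eq_single k]
      · simp [gradCoeff]
      · intro j _ hj
        simp [hj]
      · simp
    · intro α _ hα
      simp [gradCoeff, hα]
    · exact fun h => absurd (mem_idxEq.2 (mOrder_single k)) h
  have h1 := congrFun hw k
  simp only [key] at h1
  funext i
  rw [Subsingleton.elim i 0]
  exact mul_left_cancel₀ (Complex.ofReal_ne_zero.2 hk) h1

lemma multiList_single (k : Fin N) : multiList (Pi.single k 1) = [k] := by
  obtain ⟨i, hi⟩ := List.length_eq_one_iff.1 ((length_multiList _).trans (mOrder_single k))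
  have h := prod_map_multiList (Pi.single k 1) fun j => if j = k then 2 else 1
  rw [hi, Finset.prod_eq_single k (fun j _ hj => by simp [hj]) (by simp)] at h
  by_cases hik : i = k
  · rw [hi, hik]
  · simp [hik] at h

lemma fullOp_gradCoeff (F : RN N → ℂ) (k : Fin N) :
    fullOp (gradCoeff N) 1 (fun _ => F) k = pd k F := by
  funext x
  simp only [fullOp, Fin.sum_univ_one]
  rw [Finset.sum_eq_single (Pi.single k 1)]
  · simp [gradCoeff, multiList_single, pdList]
  · intro α _ hα
    simp [gradCoeff, hα]
  · exact fun h => absurd (mem_idxLe.2 (mOrder_single k).le) h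

lemma derivSum_one (F : RN N → ℂ) (x : RN N) :
    derivSum φ M 1 ρ (fun _ : Fin 1 => F) x = peetre φ M ρ F x := by
  have h : dirLists N 1 = {[]} := by
    ext I
    simp [mem_dirLists]
  simp [derivSum, h, pdList]

/-- All derivatives of order less than `m` gain a factor `ρ`. -/
lemma Elliptic.exists_peetre_pdList_le (hN : 2 ≤ N) (hφ : GoodPhi φ) {W : Set (RN N)}
    (hell : Elliptic b m W) (hb : TameCoeff b m) {ρ₀ : ℝ} (hρ₀ : 0 < ρ₀) (hρ₁ : ρ₀ ≤ 1)
    (hW : closedBall x₀ (3 * ρ₀) ⊆ W) (M : ℕ) (I : List (Fin N)) (l : Fin n₁) :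
    ∃ C, 0 ≤ C ∧ (I.length < m → ∀ ρ, 0 < ρ → ρ ≤ ρ₀ → ∀ U : Fin n₁ → RN N → ℂ,
      (∀ l, ContDiff ℝ (⊤ : ℕ∞) (U l)) → (∀ l, tsupport (U l) ⊆ ball x₀ ρ) → ∀ x,
      peetre φ M ρ (pdList I (U l)) x ≤ ENNReal.ofReal (C * ρ) *
        (∑ i, peetre φ M ρ (fullOp b m U i) x + derivSum φ M m ρ U x)) := by
  rcases lt_trichotomy (I.length + 1) m with hI | hI | hI
  · obtain ⟨C, hC, h⟩ := (elliptic_gradCoeff N (closedBall x₀ (3 * ρ₀))).exists_peetre_le hN hφ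
      (tameCoeff_gradCoeff N) hρ₀ hρ₁ subset_rfl M [] rfl 0
    refine ⟨C * (N + 1), by positivity, fun hIm ρ hρ hρρ U hU hUs x => ?_⟩
    refine (h ρ hρ hρρ (fun _ => pdList I (U l)) (fun _ => (hU l).pdList I)
      (fun _ => (tsupport_pdList_subset _ I).trans (hUs l)) x).trans ?_
    simp only [fullOp_gradCoeff, derivSum_one]
    calc _ ≤ ENNReal.ofReal (C * ρ) * (∑ _i : Fin N, derivSum φ M m ρ U x +
          derivSum φ M m ρ U x) := by
          gcongr with i
          · exact peetre_le_derivSum (I := i :: I) hI l x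
          · exact peetre_le_derivSum hIm l x
      _ = ENNReal.ofReal (C * ρ) * ENNReal.ofReal (N + 1) * derivSum φ M m ρ U x := by
          rw [ENNReal.ofReal_add (by positivity) zero_le_one, ENNReal.ofReal_natCast]
          simp only [Finset.sum_const, Finset.card_univ, Fintype.card_fin, nsmul_eq_mul,
            ENNReal.ofReal_one]
          ring
      _ ≤ _ := by
          rw [← ENNReal.ofReal_mul (by positivity)]
          refine mul_le_mul' (le_of_eq ?_) le_add_self
          congr 1
          ring
  · obtain ⟨C, hC, h⟩ := hell.exists_peetre_le hN hφ hb hρ₀ hρ₁ hW M I hI l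
    exact ⟨C, hC, fun _ => h⟩
  · exact ⟨0, le_rfl, fun h => by omega⟩

/-- On small balls the lower order derivatives are controlled by the full operator. -/
lemma Elliptic.exists_derivSum_le (hN : 2 ≤ N) (hφ : GoodPhi φ) {W : Set (RN N)}
    (hell : Elliptic b m W) (hb : TameCoeff b m) {ρ₀ : ℝ} (hρ₀ : 0 < ρ₀) (hρ₁ : ρ₀ ≤ 1)
    (hW : closedBall x₀ (3 * ρ₀) ⊆ W) (M : ℕ) :
    ∃ ρ, 0 < ρ ∧ ρ ≤ ρ₀ ∧ ∀ U : Fin n₁ → RN N → ℂ,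
      (∀ l, ContDiff ℝ (⊤ : ℕ∞) (U l)) → (∀ l, tsupport (U l) ⊆ ball x₀ ρ) → ∀ x,
      derivSum φ M m ρ U x ≤ ∑ i, peetre φ M ρ (fullOp b m U i) x := by
  choose C hC0 hC using fun I l => hell.exists_peetre_pdList_le (I := I) (l := l) hN hφ hb hρ₀ hρ₁
    hW M
  set K := ∑ I ∈ dirLists N m, ∑ l, C I l with hK
  have hK0 : 0 ≤ K := Finset.sum_nonneg fun I _ => Finset.sum_nonneg fun l _ => hC0 I l
  refine ⟨min ρ₀ (1 / (2 * (K + 1))), by positivity, min_le_left _ _, fun U hU hUs x => ?_⟩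
  set ρ := min ρ₀ (1 / (2 * (K + 1))) with hρdef
  have hρ : 0 < ρ := by positivity
  have hKρ : K * ρ ≤ 1 / 2 := by
    calc K * ρ ≤ K * (1 / (2 * (K + 1))) := by gcongr; exact min_le_right _ _
      _ ≤ 1 / 2 := by
        rw [mul_one_div, div_le_div_iff₀ (by positivity) (by positivity)]
        linarith
  set T := ∑ i, peetre φ M ρ (fullOp b m U i) x with hT
  set D := derivSum φ M m ρ U x with hD
  have hDtop : D ≠ ⊤ := by
    refine ENNReal.sum_ne_top.2 fun I _ => ENNReal.sum_ne_top.2 fun l _ => ?_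
    obtain ⟨B, hB, -, h⟩ := hφ.exists_radMax_le (M := M) (ρ := ρ) ((hU l).pdList I).continuous
      ((hasCompactSupport_of_tsupport_subset_ball (hUs l)).pdList I)
    exact ((h x).trans_lt hB.lt_top).ne
  have h1 : D ≤ ENNReal.ofReal (1 / 2) * (T + D) := by
    calc D ≤ ∑ I ∈ dirLists N m, ∑ l, ENNReal.ofReal (C I l * ρ) * (T + D) :=
          Finset.sum_le_sum fun I hI => Finset.sum_le_sum fun l _ =>
            hC I l (mem_dirLists.1 hI) ρ hρ (min_le_left _ _) U hU hUs x
      _ = ENNReal.ofReal (K * ρ) * (T + D) := by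
          simp only [← Finset.sum_mul]
          congr 1
          rw [hK, Finset.sum_mul, ENNReal.ofReal_sum_of_nonneg fun I _ =>
            mul_nonneg (Finset.sum_nonneg fun l _ => hC0 I l) hρ.le]
          refine Finset.sum_congr rfl fun I _ => ?_
          rw [Finset.sum_mul, ENNReal.ofReal_sum_of_nonneg fun l _ => mul_nonneg (hC0 I l) hρ.le]
      _ ≤ _ := by gcongr
  have h2 : D + D ≤ T + D := by
    calc D + D = 2 * D := (two_mul D).symm
      _ ≤ 2 * (ENNReal.ofReal (1 / 2) * (T + D)) := by gcongr
      _ = ENNReal.ofReal (2 * (1 / 2)) * (T + D) := by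
          rw [ENNReal.ofReal_mul (by norm_num), _root_.mul_assoc, ENNReal.ofReal_ofNat]
      _ = T + D := by norm_num
  exact (ENNReal.add_le_add_iff_right hDtop).1 h2

end LowerOrder

/-! ### Maximal functions of lower order terms -/

section Assembly

variable {m n₁ n₂ k M : ℕ} {φ : RN N → ℝ} {ρ B p : ℝ} {x₀ : RN N} {f v : RN N → ℂ}

lemma radMax_le_smallMax (hρ : ρ ≤ 1) (v : RN N → ℂ) (x : RN N) :
    radMax φ ρ v x ≤ smallMax φ v x :=
  iSup₂_le fun s hs => le_iSup₂_of_le (f := fun s (_ : s ∈ Ioo (0 : ℝ) 1) =>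
    ENNReal.ofReal ‖convAt φ s v x‖) s ⟨hs.1, hs.2.trans_le hρ⟩ le_rfl

lemma measurable_peetre (φ : RN N → ℝ) (M : ℕ) (ρ : ℝ) (v : RN N → ℂ) :
    Measurable (peetre φ M ρ v) := by
  refine LowerSemicontinuous.measurable ?_
  unfold peetre
  refine lowerSemicontinuous_biSup fun s hs => lowerSemicontinuous_iSup fun y => ?_
  have hs0 : 0 < s := hs.1
  refine (ENNReal.continuous_ofReal.comp ?_).lowerSemicontinuous
  exact continuous_const.div (by fun_prop) fun x => by positivity

/-- At scales at least `ρ`, the mollifier restricted to a ball of radius `2 ρ` is a test function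
of scale `ρ`. -/
lemma GoodPhi.exists_isTest_bump_mul (hφ : GoodPhi φ) (M : ℕ) : ∃ c, ∀ (x₀ : RN N) (ρ : ℝ),
    0 < ρ → ∃ χ : RN N → ℂ, (∀ x ∈ ball x₀ ρ, χ x = 1) ∧ ∀ t, ρ ≤ t → ∀ x,
      IsTest M ρ x₀ (fun y => χ y * (dil φ t (x - y) : ℂ)) c := by
  obtain ⟨c, hc⟩ := hφ.exists_isTest_dil M
  have hc0 : 0 ≤ c := (hc 1 one_pos 0).nonneg
  obtain ⟨cχ, hcχ, hχ⟩ := exists_bump_family N (testOrder N M)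
  refine ⟨2 ^ testOrder N M * (cχ * c) * 3 ^ testDecay N M, fun x₀ ρ hρ => ?_⟩
  obtain ⟨χ, hχ1, hχ2, hχ3, hχ4⟩ := hχ x₀ ρ hρ
  refine ⟨χ, hχ2, fun t ht x => ?_⟩
  have ht0 : 0 < t := hρ.trans_le ht
  have hd := hc t ht0 x
  refine ⟨hχ1.mul hd.smooth, hd.compact.mul_left, by positivity, ?_⟩
  have hone : ∀ y : RN N, (0 : ℝ) ≤ (fun _ => (1 : ℝ)) y := fun _ => zero_le_one
  have h1 := hχ4.mul hρ hχ1 hd.smooth hcχ hc0 hone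
    (fun y => (wt_pos ht0 _ _).le) (hd.bound.mono_radius hρ ht hc0 fun y => (wt_pos ht0 _ _).le)
  simp only [one_mul] at h1
  refine h1.mono_on hρ (fun y => mul_nonneg (by positivity) (wt_pos hρ _ _).le) fun y hy => ?_
  have hyx : ‖y - x₀‖ ≤ 2 * ρ := by
    rw [← dist_eq_norm]
    exact hχ3 (tsupport_mul_subset_left hy)
  rw [_root_.mul_assoc _ ((3 : ℝ) ^ _)]
  refine mul_le_mul_of_nonneg_left ?_ (mul_nonneg (by positivity) (mul_nonneg hcχ hc0))
  have h2 : wt (testDecay N M) t x y ≤ 1 / ρ ^ N := by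
    unfold wt
    have h3 : ((1 + ‖y - x‖ / t) ^ testDecay N M)⁻¹ ≤ 1 := by
      refine inv_le_one_of_one_le₀ (one_le_pow₀ ?_)
      have : 0 ≤ ‖y - x‖ / t := by positivity
      linarith
    gcongr
  have h3 : ((3 : ℝ) ^ testDecay N M)⁻¹ / ρ ^ N ≤ wt (testDecay N M) ρ x₀ y := by
    unfold wt
    gcongr
    have : ‖y - x₀‖ / ρ ≤ 2 := by rwa [div_le_iff₀ hρ]
    linarith
  calc wt (testDecay N M) t x y ≤ 1 / ρ ^ N := h2
    _ = 3 ^ testDecay N M * (((3 : ℝ) ^ testDecay N M)⁻¹ / ρ ^ N) := by field_simp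
    _ ≤ _ := by gcongr

/-- Multiplication by smooth functions, measured in the small maximal function. -/
lemma GoodPhi.exists_smallMax_mul_le (hφ : GoodPhi φ) (M : ℕ) (hρ : 0 < ρ) (hρ1 : ρ ≤ 1)
    (hB : 0 ≤ B) (x₀ : RN N) : ∃ C, 0 ≤ C ∧ ∀ f : RN N → ℂ, ContDiff ℝ (⊤ : ℕ∞) f →
      DerivBound (testOrder N M) (fun _ => 1) 1 f B → ∀ v : RN N → ℂ, Continuous v →
      tsupport v ⊆ ball x₀ ρ → ∀ x,
      smallMax φ (fun y => f y * v y) x ≤ ENNReal.ofReal C * peetre φ M ρ v x := by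
  obtain ⟨c, hc⟩ := hφ.exists_isTest_dil M
  have hc0 : 0 ≤ c := (hc 1 one_pos 0).nonneg
  obtain ⟨c', hc'⟩ := hφ.exists_isTest_bump_mul M
  obtain ⟨χ, hχ1, hχ2⟩ := hc' x₀ ρ hρ
  have hc'0 : 0 ≤ c' := (hχ2 ρ le_rfl 0).nonneg
  have hT := testConst_nonneg (N := N) (M := M)
  set E : ℝ := 2 ^ testOrder N M with hE
  have hE0 : 0 ≤ E := by positivity
  refine ⟨testConst N M * (E * (B * (c + c'))) * (1 + 2 / ρ) ^ M, by positivity, ?_⟩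
  intro f hf hfB v hv hvs x
  have hvc := hasCompactSupport_of_tsupport_subset_ball hvs
  refine iSup₂_le fun t ht => ?_
  have ht0 : 0 < t := ht.1
  have hone : 1 ≤ (1 + 2 / ρ) ^ M := one_le_pow₀ (by
    have : 0 ≤ 2 / ρ := by positivity
    linarith)
  rw [convAt_eq_integral_mul]
  rcases lt_or_ge t ρ with htρ | htρ
  · have h1 : ∫ z, (dil φ t (x - z) : ℂ) * (f z * v z) =
        ∫ z, (f z * (dil φ t (x - z) : ℂ)) * v z :=
      integral_congr_ae (ae_of_all _ fun z => by ring)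
    rw [h1]
    refine (((hc t ht0 x).mul_coeff ht0 (htρ.le.trans hρ1) hB hf hfB).le_peetre hφ ht0 htρ.le hv
      hvc x).trans (mul_le_mul_left (ENNReal.ofReal_le_ofReal ?_) _)
    rw [sub_self, norm_zero, zero_div, add_zero, one_pow]
    have h2 : c ≤ c + c' := by linarith
    gcongr
  · by_cases hx : x ∈ ball x₀ (ρ + 1)
    · have h1 : ∫ z, (dil φ t (x - z) : ℂ) * (f z * v z) =
          ∫ z, (f z * (χ z * (dil φ t (x - z) : ℂ))) * v z := by
        refine integral_congr_ae (ae_of_all _ fun z => ?_)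
        by_cases hz : z ∈ ball x₀ ρ
        · simp only [hχ1 z hz]
          ring
        · simp [image_eq_zero_of_notMem_tsupport fun h => hz (hvs h)]
      rw [h1]
      refine (((hχ2 t htρ x).mul_coeff hρ hρ1 hB hf hfB).le_peetre hφ hρ le_rfl hv
        hvc x).trans (mul_le_mul_left (ENNReal.ofReal_le_ofReal ?_) _)
      have h2 : c' ≤ c + c' := by linarith
      have h3 : ‖x - x₀‖ ≤ 2 := by
        rw [← dist_eq_norm]
        have : dist x x₀ < ρ + 1 := hx
        linarith
      gcongr
    · have h1 := hφ.convAt_eq_zero (v := fun y => f y * v y) ht0 ht.2.le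
        (tsupport_mul_subset_right.trans hvs) hx
      rw [convAt_eq_integral_mul] at h1
      simp [h1]

lemma ENNReal.sum_rpow_le {ι : Type*} (s : Finset ι) (f : ι → ℝ≥0∞) (hp : 0 < p) :
    (∑ i ∈ s, f i) ^ p ≤ (s.card : ℝ≥0∞) ^ p * ∑ i ∈ s, f i ^ p := by
  rcases s.eq_empty_or_nonempty with rfl | hs
  · simp [ENNReal.zero_rpow_of_pos hp]
  obtain ⟨i, hi, hmax⟩ := s.exists_max_image f hs
  calc (∑ i ∈ s, f i) ^ p ≤ (s.card * f i) ^ p := by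
        refine ENNReal.rpow_le_rpow ?_ hp.le
        rw [← nsmul_eq_mul]
        exact Finset.sum_le_card_nsmul s f _ hmax
    _ = (s.card : ℝ≥0∞) ^ p * f i ^ p := ENNReal.mul_rpow_of_nonneg _ _ hp.le
    _ ≤ _ := by
        gcongr
        exact Finset.single_le_sum (f := fun i => f i ^ p) (fun _ _ => zero_le) hi

/-- A pointwise bound by small and Peetre maximal functions gives a bound of Hardy norms. -/
lemma GoodPhi.exists_hNorm_le (hφ : GoodPhi φ) (hN : N ≠ 0) (hp : 0 < p) (hM : N < M)
    (hpM : N < p * M) (hρ1 : ρ ≤ 1) (n : ℕ) (C : ℝ) : ∃ D : ℝ≥0∞, D ≠ ⊤ ∧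
    ∀ (g : RN N → ℂ) (F : Fin n → RN N → ℂ), (∀ i, Continuous (F i)) →
      (∀ i, HasCompactSupport (F i)) →
      (∀ x, smallMax φ g x ≤ ENNReal.ofReal C *
        ∑ i, (smallMax φ (F i) x + peetre φ M ρ (F i) x)) →
      hNorm φ p g ≤ D * ∑ i, hNorm φ p (F i) := by
  obtain ⟨A, hA, hpee⟩ := hφ.lintegral_peetre_le hN hM hp hpM
  have hp' : 0 < 1 / p := by positivity
  set K : ℝ≥0∞ := ENNReal.ofReal C ^ p * ((n : ℝ≥0∞) ^ p * (2 ^ p * (1 + A))) with hK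
  have hKtop : K ≠ ⊤ := by
    have h1 : (n : ℝ≥0∞) ≠ ⊤ := ENNReal.natCast_ne_top n
    have := hp.le
    finiteness
  refine ⟨K ^ (1 / p) * (n : ℝ≥0∞) ^ (1 / p), ?_, fun g F hF hFs hg => ?_⟩
  · have h1 : (n : ℝ≥0∞) ≠ ⊤ := ENNReal.natCast_ne_top n
    have := hp'.le
    finiteness
  have hmeas : ∀ i, Measurable (smallMax φ (F i)) := fun i =>
    hφ.measurable_radMax (hF i) (hFs i)
  have htwo : ∀ a c : ℝ≥0∞, (a + c) ^ p ≤ 2 ^ p * (a ^ p + c ^ p) := by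
    intro a c
    simpa [Fin.sum_univ_two] using ENNReal.sum_rpow_le Finset.univ ![a, c] hp
  have hint : ∫⁻ x, smallMax φ g x ^ p ≤ K * ∑ i, ∫⁻ x, smallMax φ (F i) x ^ p := by
    calc ∫⁻ x, smallMax φ g x ^ p
        ≤ ∫⁻ x, ENNReal.ofReal C ^ p * ((n : ℝ≥0∞) ^ p * ∑ i, (2 ^ p *
            (smallMax φ (F i) x ^ p + peetre φ M ρ (F i) x ^ p))) := by
          refine lintegral_mono fun x => ?_
          calc smallMax φ g x ^ p ≤ (ENNReal.ofReal C *
                ∑ i, (smallMax φ (F i) x + peetre φ M ρ (F i) x)) ^ p :=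
                ENNReal.rpow_le_rpow (hg x) hp.le
            _ = ENNReal.ofReal C ^ p *
                (∑ i, (smallMax φ (F i) x + peetre φ M ρ (F i) x)) ^ p :=
                ENNReal.mul_rpow_of_nonneg _ _ hp.le
            _ ≤ _ := by
                gcongr
                refine (ENNReal.sum_rpow_le _ _ hp).trans ?_
                rw [Finset.card_univ, Fintype.card_fin]
                gcongr with i
                exact htwo _ _
      _ = ENNReal.ofReal C ^ p * ((n : ℝ≥0∞) ^ p * ∑ i, (2 ^ p *
            ((∫⁻ x, smallMax φ (F i) x ^ p) + ∫⁻ x, peetre φ M ρ (F i) x ^ p))) := by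
          have hm1 : ∀ i, Measurable fun x => smallMax φ (F i) x ^ p :=
            fun i => (hmeas i).pow_const p
          have hm2 : ∀ i, Measurable fun x => peetre φ M ρ (F i) x ^ p :=
            fun i => (measurable_peetre φ M ρ (F i)).pow_const p
          have hm3 : ∀ i, Measurable fun x => 2 ^ p *
              (smallMax φ (F i) x ^ p + peetre φ M ρ (F i) x ^ p) :=
            fun i => ((hm1 i).add (hm2 i)).const_mul _
          rw [lintegral_const_mul _ ((Finset.measurable_fun_sum _ fun i _ => hm3 i).const_mul _),
            lintegral_const_mul _ (Finset.measurable_fun_sum _ fun i _ => hm3 i),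
            lintegral_finsetSum _ fun i _ => hm3 i]
          congr 3
          funext i
          rw [lintegral_const_mul _ ((hm1 i).fun_add (hm2 i)), lintegral_add_left (hm1 i)]
      _ ≤ ENNReal.ofReal C ^ p * ((n : ℝ≥0∞) ^ p * ∑ i, (2 ^ p *
            ((∫⁻ x, smallMax φ (F i) x ^ p) + A * ∫⁻ x, smallMax φ (F i) x ^ p))) := by
          gcongr with i
          refine (hpee ρ (F i) (hF i) (hFs i)).trans ?_
          gcongr with x
          exact radMax_le_smallMax hρ1 _ _
      _ = _ := by
          rw [hK]
          simp only [Finset.mul_sum]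
          refine Finset.sum_congr rfl fun i _ => ?_
          ring
  calc hNorm φ p g ≤ (K * ∑ i, ∫⁻ x, smallMax φ (F i) x ^ p) ^ (1 / p) :=
        ENNReal.rpow_le_rpow hint hp'.le
    _ = K ^ (1 / p) * (∑ i, ∫⁻ x, smallMax φ (F i) x ^ p) ^ (1 / p) :=
        ENNReal.mul_rpow_of_nonneg _ _ hp'.le
    _ ≤ K ^ (1 / p) * ((n : ℝ≥0∞) ^ (1 / p) * ∑ i, hNorm φ p (F i)) := by
        gcongr
        refine (ENNReal.sum_rpow_le _ _ hp').trans ?_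
        rw [Finset.card_univ, Fintype.card_fin]
        rfl
    _ = _ := by rw [_root_.mul_assoc]

lemma GoodPhi.smallMax_sub_sum_le {ι : Type*} (hφ : GoodPhi φ) (s : Finset ι) {f : RN N → ℂ}
    {h : ι → RN N → ℂ} (hf : Continuous f) (hfs : HasCompactSupport f)
    (hh : ∀ i ∈ s, Continuous (h i)) (hhs : ∀ i ∈ s, HasCompactSupport (h i)) (x : RN N) :
    smallMax φ (fun y => f y - ∑ i ∈ s, h i y) x ≤
      smallMax φ f x + ∑ i ∈ s, smallMax φ (h i) x := by
  refine iSup₂_le fun t ht => ?_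
  have hd := (hφ.dil_sub_smooth t x).continuous
  have hint : ∀ v : RN N → ℂ, Continuous v → HasCompactSupport v →
      Integrable fun z => (dil φ t (x - z) : ℂ) * v z := fun v hv hvs =>
    (hd.mul hv).integrable_of_hasCompactSupport hvs.mul_left
  have h1 : convAt φ t (fun y => f y - ∑ i ∈ s, h i y) x =
      convAt φ t f x - ∑ i ∈ s, convAt φ t (h i) x := by
    simp only [convAt_eq_integral_mul, mul_sub, Finset.mul_sum]
    rw [integral_sub (hint f hf hfs) (integrable_finsetSum _ fun i hi =>
      hint _ (hh i hi) (hhs i hi)), integral_finsetSum _ fun i hi => hint _ (hh i hi) (hhs i hi)]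
  have h2 : ∀ v, ‖convAt φ t v x‖ₑ ≤ smallMax φ v x := fun v => by
    rw [← ofReal_norm]
    exact le_iSup₂_of_le (f := fun s (_ : s ∈ Ioo (0 : ℝ) 1) =>
      ENNReal.ofReal ‖convAt φ s v x‖) t ht le_rfl
  rw [h1, ofReal_norm]
  refine (enorm_sub_le).trans (add_le_add (h2 f) ((enorm_sum_le _ _).trans ?_))
  exact Finset.sum_le_sum fun i _ => h2 _

end Assembly

/-! ### The comparison of the principal part with the full operator -/

section Comparison

variable {m n₁ n₂ M : ℕ} {φ : RN N → ℝ} {ρ p R : ℝ} {x₀ : RN N} {Ω : Set (RN N)}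
  {a b : (Fin N → ℕ) → RN N → Matrix (Fin n₂) (Fin n₁) ℂ}

/-- Cutting off coefficients that are smooth near a ball makes them tame. -/
lemma exists_tameCoeff (hΩ : IsOpen Ω)
    (ha : ∀ α : Fin N → ℕ, mOrder α ≤ m → ∀ i j, ContDiffOn ℝ (⊤ : ℕ∞) (fun x => a α x i j) Ω)
    (hR : 0 < R) (hRΩ : closedBall x₀ R ⊆ Ω) :
    ∃ b : (Fin N → ℕ) → RN N → Matrix (Fin n₂) (Fin n₁) ℂ, TameCoeff b m ∧
      ∀ α, ∀ x ∈ ball x₀ (R / 2), b α x = a α x := by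
  let χ : ContDiffBump x₀ := ⟨R / 2, R, half_pos hR, half_lt_self hR⟩
  have hχ : ContDiff ℝ (⊤ : ℕ∞) fun x => (χ x : ℂ) := Complex.ofRealCLM.contDiff.comp χ.contDiff
  have hχs : tsupport (fun x => (χ x : ℂ)) ⊆ closedBall x₀ R := by
    refine (closure_mono fun x hx => ?_ : _ ⊆ tsupport χ).trans χ.tsupport_eq.subset
    exact fun h => hx (by simp [h])
  have hsmooth : ∀ α ∈ idxLe N m, ∀ i j,
      ContDiff ℝ (⊤ : ℕ∞) fun x => ((χ x : ℂ) • a α x) i j := by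
    intro α hα i j
    refine contDiff_iff_contDiffAt.2 fun x => ?_
    by_cases hx : x ∈ tsupport fun x => (χ x : ℂ)
    · exact hχ.contDiffAt.mul ((ha α (mem_idxLe.1 hα) i j).contDiffAt
        (hΩ.mem_nhds (hRΩ (hχs hx))))
    · refine (contDiffAt_const (c := (0 : ℂ))).congr_of_eventuallyEq ?_
      filter_upwards [notMem_tsupport_iff_eventuallyEq.1 hx] with y hy
      have hy0 : (χ y : ℂ) = 0 := hy
      simp [hy0]
  refine ⟨fun α x => (χ x : ℂ) • a α x, ⟨hsmooth, fun k α hα i j => ?_⟩, fun α x hx => ?_⟩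
  · refine DerivBound.of_hasCompactSupport (hsmooth α hα i j) ?_ k
    exact (isCompact_closedBall x₀ R).of_isClosed_subset (isClosed_tsupport _)
      (tsupport_mul_subset_left.trans hχs)
  · simp [χ.one_of_mem_closedBall (ball_subset_closedBall hx)]

lemma tsupport_apply_subset {n : ℕ} (u : RN N → Fin n → ℂ) (l : Fin n) :
    tsupport (fun x => u x l) ⊆ tsupport u :=
  closure_mono fun x hx h => hx (by simp [h])

lemma sum_mulVec_md_apply {u : RN N → Fin n₁ → ℂ} (hu : ContDiff ℝ (⊤ : ℕ∞) u)
    (hus : tsupport u ⊆ ball x₀ R) (hab : ∀ α, ∀ x ∈ ball x₀ R, b α x = a α x)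
    (s : Finset (Fin N → ℕ)) (x : RN N) (j : Fin n₂) :
    (∑ α ∈ s, (a α x).mulVec (md α u x)) j =
      ∑ α ∈ s, ∑ l, b α x j l * pdList (multiList α) (fun y => u y l) x := by
  rw [Finset.sum_apply]
  refine Finset.sum_congr rfl fun α _ => ?_
  rw [Matrix.mulVec, dotProduct]
  refine Finset.sum_congr rfl fun l _ => ?_
  have h1 : md α u x l = pdList (multiList α) (fun y => u y l) x := by
    rw [md_eq_pdList]
    exact congrFun (pdList_apply hu (multiList α) l) x
  rw [h1]
  by_cases hx : x ∈ ball x₀ R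
  · rw [hab α x hx]
  · have h2 : pdList (multiList α) (fun y => u y l) x = 0 :=
      image_eq_zero_of_notMem_tsupport fun h => hx (hus (tsupport_apply_subset u l
        (tsupport_pdList_subset _ _ h)))
    rw [h2, mul_zero, mul_zero]

/-- Replacing the full operator by its principal part costs lower order derivatives. -/
lemma GoodPhi.exists_smallMax_principal_le (hφ : GoodPhi φ) (hb : TameCoeff b m) (M : ℕ)
    (hρ : 0 < ρ) (hρ1 : ρ ≤ 1) (x₀ : RN N) : ∃ C, 0 ≤ C ∧ ∀ U : Fin n₁ → RN N → ℂ,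
      (∀ l, ContDiff ℝ (⊤ : ℕ∞) (U l)) → (∀ l, tsupport (U l) ⊆ ball x₀ ρ) → ∀ j x,
      smallMax φ (fun y => ∑ α ∈ idxEq N m, ∑ l, b α y j l * pdList (multiList α) (U l) y) x ≤
        smallMax φ (fullOp b m U j) x + ENNReal.ofReal C * derivSum φ M m ρ U x := by
  obtain ⟨B, hB, hbB⟩ := hb.exists_bound (testOrder N M)
  obtain ⟨C, hC, hmul⟩ := hφ.exists_smallMax_mul_le M hρ hρ1 hB x₀
  set s := (idxLe N m \ idxEq N m) ×ˢ (Finset.univ : Finset (Fin n₁)) with hs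
  refine ⟨s.card * C, by positivity, fun U hU hUs j x => ?_⟩
  have hUc : ∀ l, HasCompactSupport (U l) := fun l =>
    hasCompactSupport_of_tsupport_subset_ball (hUs l)
  have hmem : ∀ q ∈ s, q.1 ∈ idxLe N m ∧ mOrder q.1 < m := by
    intro q hq
    have h1 := Finset.mem_sdiff.1 (Finset.mem_product.1 hq).1
    exact ⟨h1.1, lt_of_le_of_ne (mem_idxLe.1 h1.1) fun h => h1.2 (mem_idxEq.2 h)⟩
  have h1 : (fun y => ∑ α ∈ idxEq N m, ∑ l, b α y j l * pdList (multiList α) (U l) y) =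
      fun y => fullOp b m U j y - ∑ q ∈ s, b q.1 y j q.2 * pdList (multiList q.1) (U q.2) y := by
    funext y
    rw [hs, Finset.sum_product, eq_sub_iff_add_eq, add_comm]
    exact Finset.sum_sdiff idxEq_subset_idxLe
  rw [h1]
  refine (hφ.smallMax_sub_sum_le s (ContDiff.fullOp hb hU j).continuous
    (hasCompactSupport_fullOp hUc j) (fun q hq => ?_) (fun q _ => ?_) x).trans
    (add_le_add le_rfl ?_)
  · exact ((hb.smooth q.1 (hmem q hq).1 j q.2).mul ((hU q.2).pdList _)).continuous
  · exact ((hUc q.2).pdList _).mul_left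
  · calc _ ≤ ∑ q ∈ s, ENNReal.ofReal C * derivSum φ M m ρ U x := by
          refine Finset.sum_le_sum fun q hq => ?_
          refine (hmul _ (hb.smooth q.1 (hmem q hq).1 j q.2) (hbB q.1 (hmem q hq).1 j q.2) _
            ((hU q.2).pdList _).continuous ((tsupport_pdList_subset _ _).trans (hUs q.2)) x).trans
            (mul_le_mul_right (peetre_le_derivSum ?_ q.2 x) _)
          rw [length_multiList]
          exact (hmem q hq).2
      _ = _ := by
          rw [Finset.sum_const, nsmul_eq_mul, ENNReal.ofReal_mul (Nat.cast_nonneg _),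
            ENNReal.ofReal_natCast, _root_.mul_assoc]

lemma Elliptic.exists_hNormVec_principal_le (hN : 2 ≤ N) (hφ : GoodPhi φ) (hp : 0 < p)
    {W : Set (RN N)} (hell : Elliptic b m W) (hb : TameCoeff b m) (hR : 0 < R) (hR1 : R ≤ 1)
    (hW : closedBall x₀ (3 * R) ⊆ W) :
    ∃ ρ, 0 < ρ ∧ ρ ≤ R ∧ ∃ C : ℝ≥0∞, C ≠ ⊤ ∧ ∀ U : Fin n₁ → RN N → ℂ,
      (∀ l, ContDiff ℝ (⊤ : ℕ∞) (U l)) → (∀ l, tsupport (U l) ⊆ ball x₀ ρ) →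
      ∑ j, hNorm φ p (fun y => ∑ α ∈ idxEq N m, ∑ l, b α y j l * pdList (multiList α) (U l) y) ≤
        C * ∑ j, hNorm φ p (fullOp b m U j) := by
  obtain ⟨M, hM⟩ := exists_nat_gt (max (N : ℝ) (N / p))
  have hNM : N < M := by exact_mod_cast (le_max_left _ _).trans_lt hM
  have hpM : N < p * M := by
    have := (le_max_right _ _).trans_lt hM
    rwa [div_lt_iff₀' hp] at this
  obtain ⟨ρ, hρ, hρR, hder⟩ := hell.exists_derivSum_le hN hφ hb hR hR1 hW M
  have hρ1 := hρR.trans hR1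
  obtain ⟨C, hC, hprin⟩ := hφ.exists_smallMax_principal_le hb M hρ hρ1 x₀
  obtain ⟨D, hD, hnorm⟩ := hφ.exists_hNorm_le (by omega) hp hNM hpM hρ1 n₂ (1 + C)
  refine ⟨ρ, hρ, hρR, n₂ * D, ENNReal.mul_ne_top (ENNReal.natCast_ne_top _) hD, ?_⟩
  intro U hU hUs
  have hUc : ∀ l, HasCompactSupport (U l) := fun l =>
    hasCompactSupport_of_tsupport_subset_ball (hUs l)
  have hj : ∀ j, hNorm φ p
      (fun y => ∑ α ∈ idxEq N m, ∑ l, b α y j l * pdList (multiList α) (U l) y) ≤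
      D * ∑ i, hNorm φ p (fullOp b m U i) := by
    refine fun j => hnorm _ _ (fun i => (ContDiff.fullOp hb hU i).continuous)
      (fun i => hasCompactSupport_fullOp hUc i) fun x => (hprin U hU hUs j x).trans ?_
    rw [ENNReal.ofReal_add zero_le_one hC, ENNReal.ofReal_one, add_mul, one_mul]
    refine add_le_add ?_ (mul_le_mul_right ((hder U hU hUs x).trans
      (Finset.sum_le_sum fun i _ => le_add_self)) _)
    exact le_self_add.trans (Finset.single_le_sum (f := fun i =>
      smallMax φ (fullOp b m U i) x + peetre φ M ρ (fullOp b m U i) x) (fun _ _ => zero_le)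
      (Finset.mem_univ j))
  refine (Finset.sum_le_card_nsmul _ _ _ fun j _ => hj j).trans (le_of_eq ?_)
  rw [Finset.card_univ, Fintype.card_fin, nsmul_eq_mul, _root_.mul_assoc]

end Comparison

/-- Remark 5.1: local comparison of the principal part with the full operator in `h^p`. -/
theorem statement11 {N m n₁ n₂ : ℕ} (hN : 2 ≤ N) (hm : 1 ≤ m) (hn₁ : 1 ≤ n₁) (hn : n₁ ≤ n₂)
    (p : ℝ) (hp0 : 0 < p) (hpN : p < N)
    (Ω : Set (RN N)) (hΩ : IsOpen Ω)
    (a : (Fin N → ℕ) → RN N → Matrix (Fin n₂) (Fin n₁) ℂ)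
    (ha : ∀ α : Fin N → ℕ, mOrder α ≤ m → ∀ i j,
      ContDiffOn ℝ (⊤ : ℕ∞) (fun x => a α x i j) Ω)
    (hell : Elliptic a m Ω)
    (φ₀ : RN N → ℝ) (hφ₀ : GoodPhi φ₀)
    (x₀ : RN N) (hx₀ : x₀ ∈ Ω) :
    ∃ ℓ : ℝ, 0 < ℓ ∧ ball x₀ ℓ ⊆ Ω ∧
      ∃ C : ℝ, 0 < C ∧
        ∀ u : RN N → (Fin n₁ → ℂ), ContDiff ℝ (⊤ : ℕ∞) u → HasCompactSupport u →
          tsupport u ⊆ ball x₀ ℓ →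
          hNormVec φ₀ p (applyAP a m u) ≤ ENNReal.ofReal C * hNormVec φ₀ p (applyA a m u) := by
  obtain ⟨r, hr, hrΩ⟩ := Metric.isOpen_iff.1 hΩ x₀ hx₀
  obtain ⟨R, hR, hR1, hRr⟩ : ∃ R : ℝ, 0 < R ∧ R ≤ 1 ∧ R < r :=
    ⟨min 1 (r / 2), by positivity, min_le_left _ _, by
      have := min_le_right 1 (r / 2)
      linarith⟩
  obtain ⟨b, hb, hba⟩ := exists_tameCoeff hΩ ha hR ((closedBall_subset_ball hRr).trans hrΩ)
  have hRΩ : ball x₀ (R / 2) ⊆ Ω := (ball_subset_ball (by linarith)).trans hrΩ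
  have hellb : Elliptic b m (ball x₀ (R / 2)) := by
    intro x hx ξ hξ
    simp only [hba _ x hx]
    exact hell x (hRΩ hx) ξ hξ
  obtain ⟨ρ, hρ, hρR, C, hC, hmain⟩ := hellb.exists_hNormVec_principal_le (x₀ := x₀) (R := R / 8)
    hN hφ₀ hp0 hb (by positivity) (by linarith) (closedBall_subset_ball (by linarith))
  have hρball : ball x₀ ρ ⊆ ball x₀ (R / 2) := ball_subset_ball (by linarith)
  refine ⟨ρ, hρ, hρball.trans hRΩ, C.toReal + 1, by positivity, fun u hu _ hus => ?_⟩
  have happ := fun s x => sum_mulVec_md_apply hu hus (fun α x hx => hba α x (hρball hx)) s x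
  simp only [hNormVec, applyAP, applyA, happ]
  refine (hmain (fun l y => u y l) (contDiff_pi.1 hu) fun l =>
    (tsupport_apply_subset u l).trans hus).trans (mul_le_mul_left ?_ _)
  rw [← ENNReal.ofReal_toReal hC]
  exact ENNReal.ofReal_le_ofReal (by simp)
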